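/- arXiv:1611.09728 — 5 statements merged into one kernel-verified Lean document; each statement's English description precedes it below -/
import Mathlib

section
/- Let P be a lattice polytope of dimension d in ℝ^d. Then there exist polynomials a, b ∈ ℤ[z], both with nonnegative coefficients, with a symmetric with respect to degree d+1 and b symmetric with respect to degree d, such that (1−z)^{d+1} · Σ_{n≥1} L°_P(n) z^n = a(z) − b(z) as formal power series over ℤ. -/
open scoped Pointwise

/-- A polynomial `p ∈ ℤ[z]` is symmetric with respect to degree `m` if it has degree
at most `m` and its coefficients satisfy `p_i = p_{m-i}` for all `0 ≤ i ≤ m`. -/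
def SymmetricWrt (p : Polynomial ℤ) (m : ℕ) : Prop :=
  p.degree ≤ (m : ℕ) ∧ ∀ i ≤ m, p.coeff i = p.coeff (m - i)

/-- The points of `Λ` of coordinate sum `n` in the half-open orthant spanned by the coordinates
in `B`: the `i`-th coordinate may vanish only if `s i`.  The coordinates in `A` are moreover
confined to the half-open unit interval (`[0, 1)` if `s i`, and `(0, 1]` otherwise). -/
def halfOpenSlice {ι : Type*} [Fintype ι] (Λ : AddSubgroup (ι → ℝ)) (B A : Finset ι)
    (s : ι → Prop) (n : ℕ) : Set (ι → ℝ) :=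
  {l | l ∈ Λ ∧ (∀ i ∉ B, l i = 0) ∧ (∀ i ∈ B, 0 ≤ l i ∧ (l i = 0 → s i)) ∧
    (∀ i ∈ A, l i ≤ 1 ∧ (l i = 1 → ¬ s i)) ∧ ∑ i, l i = n}

theorem halfOpenSlice_subset {ι : Type*} [Fintype ι] {Λ : AddSubgroup (ι → ℝ)}
    (B A : Finset ι) (s : ι → Prop) (n : ℕ) :
    halfOpenSlice Λ B A s n ⊆ halfOpenSlice Λ B ∅ s n :=
  fun _ ⟨h1, h2, h3, _, h5⟩ => ⟨h1, h2, h3, by simp, h5⟩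

theorem halfOpenSlice_eq_empty {ι : Type*} [Fintype ι] {Λ : AddSubgroup (ι → ℝ)}
    {B : Finset ι} {s : ι → Prop} {n : ℕ} (hn : B.card < n) :
    halfOpenSlice Λ B B s n = ∅ := by
  rw [Set.eq_empty_iff_forall_notMem]
  rintro l ⟨-, h2, -, h4, h5⟩
  have h : ∑ i, l i = ∑ i ∈ B, l i :=
    (Finset.sum_subset (Finset.subset_univ B) fun i _ hi => h2 i hi).symm
  have h' : ∑ i ∈ B, l i ≤ B.card := by
    simpa using Finset.sum_le_sum fun i hi => (h4 i hi).1
  have : (B.card : ℝ) < n := by exact_mod_cast hn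
  linarith

section HalfOpen

variable {ι : Type*} [Fintype ι] [DecidableEq ι] {Λ : AddSubgroup (ι → ℝ)}

theorem halfOpenSlice_insert_zero {B A : Finset ι} {s : ι → Prop} {i : ι} :
    halfOpenSlice Λ B (insert i A) s 0 = halfOpenSlice Λ B A s 0 := by
  ext l
  simp only [halfOpenSlice, Set.mem_ofPred_eq, Finset.forall_mem_insert]
  refine ⟨fun ⟨h1, h2, h3, h4, h5⟩ => ⟨h1, h2, h3, h4.2, h5⟩,
    fun ⟨h1, h2, h3, h4, h5⟩ => ⟨h1, h2, h3, ⟨?_, h4⟩, h5⟩⟩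
  have hnn : ∀ j ∈ Finset.univ, 0 ≤ l j := fun j _ => by
    by_cases hj : j ∈ B
    · exact (h3 j hj).1
    · exact (h2 j hj).ge
  have h0 : l i = 0 := (Finset.sum_eq_zero_iff_of_nonneg hnn).1 (by simpa using h5) i (by simp)
  rw [h0]
  exact ⟨zero_le_one, fun h => absurd h zero_ne_one⟩

theorem halfOpenSlice_succ (hΛ : ∀ i, Pi.single i 1 ∈ Λ) {B A : Finset ι} {s : ι → Prop}
    {i : ι} (hi : i ∈ B) (hA : i ∉ A) (n : ℕ) :
    halfOpenSlice Λ B A s (n + 1) = halfOpenSlice Λ B (insert i A) s (n + 1) ∪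
      (fun l => l + Pi.single i 1) '' halfOpenSlice Λ B A s n := by
  ext l
  constructor
  · rintro ⟨h1, h2, h3, h4, h5⟩
    by_cases h : l i ≤ 1 ∧ (l i = 1 → ¬ s i)
    · exact Or.inl ⟨h1, h2, h3, Finset.forall_mem_insert _ _ _ |>.2 ⟨h, h4⟩, h5⟩
    · refine Or.inr ⟨l - Pi.single i 1, ⟨Λ.sub_mem h1 (hΛ i), ?_, ?_, ?_, ?_⟩, by simp⟩
      · intro j hj
        have : j ≠ i := fun e => hj (e ▸ hi)
        simp [h2 j hj, this]
      · intro j hj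
        rcases eq_or_ne j i with rfl | hji
        · simp only [Pi.sub_apply, Pi.single_eq_same]
          rw [not_and_or] at h
          push Not at h
          rcases h with h | ⟨h, h'⟩
          · exact ⟨by linarith, fun h' => by linarith⟩
          · exact ⟨by linarith, fun _ => h'⟩
        · simpa [hji] using h3 j hj
      · intro j hj
        have : j ≠ i := fun e => hA (e ▸ hj)
        simpa [this] using h4 j hj
      · simp [Finset.sum_sub_distrib, h5]
  · rintro (⟨h1, h2, h3, h4, h5⟩ | ⟨l, ⟨h1, h2, h3, h4, h5⟩, rfl⟩)
    · exact ⟨h1, h2, h3, fun j hj => h4 j (Finset.mem_insert_of_mem hj), h5⟩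
    · refine ⟨Λ.add_mem h1 (hΛ i), ?_, ?_, ?_, ?_⟩
      · intro j hj
        have : j ≠ i := fun e => hj (e ▸ hi)
        simp [h2 j hj, this]
      · intro j hj
        rcases eq_or_ne j i with rfl | hji
        · simp only [Pi.add_apply, Pi.single_eq_same]
          have := (h3 j hj).1
          exact ⟨by linarith, fun h' => by linarith⟩
        · simpa [hji] using h3 j hj
      · intro j hj
        have : j ≠ i := fun e => hA (e ▸ hj)
        simpa [this] using h4 j hj
      · simp [Finset.sum_add_distrib, h5]

theorem disjoint_halfOpenSlice_insert {B A : Finset ι} {s : ι → Prop} {i : ι} (hi : i ∈ B)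
    (n m : ℕ) : Disjoint (halfOpenSlice Λ B (insert i A) s m)
      ((fun l => l + Pi.single i 1) '' halfOpenSlice Λ B A s n) := by
  rw [Set.disjoint_left]
  rintro _ ⟨-, -, -, h4, -⟩ ⟨l, ⟨-, -, h3, -, -⟩, rfl⟩
  have h := h4 i (by simp)
  have h' := h3 i hi
  simp only [Pi.add_apply, Pi.single_eq_same] at h
  have h0 : l i = 0 := le_antisymm (by linarith [h.1]) h'.1
  exact h.2 (by linarith) (h'.2 h0)

theorem one_sub_X_pow_mul_mk_halfOpenSlice (hΛ : ∀ i, Pi.single i 1 ∈ Λ) {B : Finset ι}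
    {s : ι → Prop} (hfin : ∀ n, (halfOpenSlice Λ B ∅ s n).Finite) {A : Finset ι} (hA : A ⊆ B) :
    (1 - PowerSeries.X) ^ A.card *
      PowerSeries.mk (fun n => ((halfOpenSlice Λ B ∅ s n).ncard : ℤ)) =
    PowerSeries.mk (fun n => ((halfOpenSlice Λ B A s n).ncard : ℤ)) := by
  induction A using Finset.induction_on with
  | empty => simp
  | insert i A hiA ih =>
    have hi : i ∈ B := hA (Finset.mem_insert_self _ _)
    rw [Finset.card_insert_of_notMem hiA, pow_succ', mul_assoc,
      ih ((Finset.subset_insert _ _).trans hA)]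
    ext n
    rw [sub_mul, one_mul, map_sub]
    cases n with
    | zero => simp [halfOpenSlice_insert_zero]
    | succ n =>
      rw [PowerSeries.coeff_succ_X_mul]
      simp only [PowerSeries.coeff_mk]
      rw [halfOpenSlice_succ hΛ hi hiA,
        Set.ncard_union_eq (disjoint_halfOpenSlice_insert hi _ _)
          ((hfin _).subset (halfOpenSlice_subset _ _ _ _))
          (((hfin _).subset (halfOpenSlice_subset _ _ _ _)).image _),
        Set.ncard_image_of_injective _ (add_left_injective _)]
      push_cast
      ring

theorem ncard_halfOpenSlice_reflect (hΛ : ∀ i, Pi.single i 1 ∈ Λ) {B : Finset ι}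
    {s : ι → Prop} {n m : ℕ} (hnm : n + m = B.card) :
    (halfOpenSlice Λ B B s n).ncard = (halfOpenSlice Λ B B (fun i => ¬ s i) m).ncard := by
  have key : ∀ (s t : ι → Prop) (n m : ℕ), n + m = B.card → (∀ i, s i ↔ ¬ t i) →
      ∀ l ∈ halfOpenSlice Λ B B s n,
        (∑ i ∈ B, Pi.single i (1 : ℝ)) - l ∈ halfOpenSlice Λ B B t m := by
    rintro s t n m hnm hst l ⟨h1, h2, h3, h4, h5⟩
    have hB : ∀ j, (∑ i ∈ B, Pi.single i (1 : ℝ) : ι → ℝ) j = if j ∈ B then 1 else 0 := by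
      intro j
      simp [Finset.sum_apply, Pi.single_apply]
    refine ⟨Λ.sub_mem (Λ.sum_mem fun i _ => hΛ i) h1, ?_, ?_, ?_, ?_⟩
    · intro i hi
      simp only [Pi.sub_apply, hB, if_neg hi, h2 i hi, sub_zero]
    · intro i hi
      simp only [Pi.sub_apply, hB, if_pos hi]
      refine ⟨by linarith [(h4 i hi).1], fun h => ?_⟩
      have := (h4 i hi).2 (by linarith)
      rwa [hst, not_not] at this
    · intro i hi
      simp only [Pi.sub_apply, hB, if_pos hi]
      refine ⟨by linarith [(h3 i hi).1], fun h => ?_⟩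
      exact (hst i).1 ((h3 i hi).2 (by linarith))
    · simp only [Pi.sub_apply, hB, Finset.sum_sub_distrib, h5]
      rw [Finset.sum_ite_mem, Finset.univ_inter, Finset.sum_const, nsmul_eq_mul, mul_one, ← hnm]
      push_cast
      ring
  refine Set.ncard_congr (fun l _ => (∑ i ∈ B, Pi.single i (1 : ℝ)) - l)
    (key s _ n m hnm fun i => by simp) (fun a b _ _ h => sub_right_injective h)
    fun l hl => ⟨_, key _ s m n (by omega) (fun i => Iff.rfl) l hl, by simp⟩

end HalfOpen

/-- Lexicographic positivity with respect to a finite sequence of linear functionals. -/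
def LexPos {M : Type*} [AddCommGroup M] [Module ℝ M] {m : ℕ} (f : Fin m → M →ₗ[ℝ] ℝ) (δ : M) :
    Prop :=
  ∃ k, 0 < f k δ ∧ ∀ j < k, f j δ = 0

/-- `B` indexes a spanning subfamily of `w` which is an optimal basis of the lexicographic linear
program: maximize `f` over the nonnegative coefficient vectors of a given linear combination. -/
structure IsOptimalBasis {ι W : Type*} [Fintype ι] [AddCommGroup W] [Module ℝ W] {m : ℕ}
    (w : ι → W) (f : Fin m → (ι → ℝ) →ₗ[ℝ] ℝ) (B : Finset ι) : Prop where
  span_eq_top : Submodule.span ℝ (w '' B) = ⊤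
  not_lexPos : ∀ δ, Fintype.linearCombination ℝ w δ = 0 → (∀ i ∉ B, 0 ≤ δ i) → ¬ LexPos f δ

/-- A point lying in no proper subspace spanned by a subfamily of `w`. -/
def AvoidsSpans {ι W : Type*} [AddCommGroup W] [Module ℝ W] (w : ι → W) (x : W) : Prop :=
  ∀ S : Finset ι, x ∈ Submodule.span ℝ (w '' S) → Submodule.span ℝ (w '' S) = ⊤

section LexPos

variable {M : Type*} [AddCommGroup M] [Module ℝ M] {m : ℕ} {f : Fin m → M →ₗ[ℝ] ℝ}

theorem lexPos_or_lexPos_neg (hf : ∀ δ, (∀ k, f k δ = 0) → δ = 0) {δ : M} (hδ : δ ≠ 0) :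
    LexPos f δ ∨ LexPos f (-δ) := by
  have h : ∃ k, f k δ ≠ 0 := by
    by_contra! h
    exact hδ (hf δ h)
  obtain ⟨k, hk, hmin⟩ : ∃ k, f k δ ≠ 0 ∧ ∀ j < k, f j δ = 0 := by
    obtain ⟨k, hk, hmin⟩ := WellFounded.has_min (wellFounded_lt (α := Fin m)) {k | f k δ ≠ 0} h
    exact ⟨k, hk, fun j hj => by_contra fun h => hmin j h hj⟩
  rcases lt_or_gt_of_ne hk with h | h
  · exact Or.inr ⟨k, by simpa using h, fun j hj => by simp [hmin j hj]⟩
  · exact Or.inl ⟨k, h, hmin⟩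

theorem LexPos.smul {δ : M} (h : LexPos f δ) {t : ℝ} (ht : 0 < t) : LexPos f (t • δ) := by
  obtain ⟨k, hk, hj⟩ := h
  exact ⟨k, by simpa using mul_pos ht hk, fun j hjk => by simp [hj j hjk]⟩

end LexPos

theorem IsCompact.exists_forall_not_lex_lt {X : Type*} [TopologicalSpace X] {m : ℕ}
    (f : Fin m → X → ℝ) (hf : ∀ k, Continuous (f k)) {K : Set X} (hK : IsCompact K)
    (hne : K.Nonempty) :
    ∃ x ∈ K, ∀ y ∈ K, ∀ k, (∀ j < k, f j y = f j x) → f k y ≤ f k x := by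
  induction m generalizing K with
  | zero => exact ⟨hne.some, hne.some_mem, fun _ _ k => k.elim0⟩
  | succ m ih =>
    obtain ⟨z, hz, hmax⟩ := hK.exists_isMaxOn hne (hf 0).continuousOn
    obtain ⟨x, ⟨hxK, hx0⟩, hx⟩ := ih (fun k => f k.succ) (fun k => hf _)
      (hK.inter_right (isClosed_singleton.preimage (hf 0) : IsClosed (f 0 ⁻¹' {f 0 z})))
      ⟨z, hz, rfl⟩
    have hx0 : f 0 x = f 0 z := hx0
    refine ⟨x, hxK, fun y hy k hk => ?_⟩
    induction k using Fin.cases with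
    | zero => exact hx0 ▸ hmax hy
    | succ k =>
      exact hx y ⟨hy, (hk 0 (Fin.succ_pos k)).trans hx0⟩ k
        fun j hj => hk j.succ (Fin.succ_lt_succ_iff.2 hj)

section OptimalBasis

variable {ι W : Type*} [Fintype ι] [NormedAddCommGroup W] [NormedSpace ℝ W] {m : ℕ} {w : ι → W}

theorem linearCombination_mem_span_image {B : Finset ι} {l : ι → ℝ} (hl : ∀ i ∉ B, l i = 0) :
    Fintype.linearCombination ℝ w l ∈ Submodule.span ℝ (w '' B) := by
  rw [Fintype.linearCombination_apply]
  refine Submodule.sum_mem _ fun i _ => ?_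
  by_cases hi : i ∈ B
  · exact Submodule.smul_mem _ _ (Submodule.subset_span ⟨i, hi, rfl⟩)
  · simp [hl i hi]

theorem exists_linearCombination_of_mem_span_image {B : Finset ι} {x : W}
    (hx : x ∈ Submodule.span ℝ (w '' B)) :
    ∃ l : ι → ℝ, (∀ i ∉ B, l i = 0) ∧ Fintype.linearCombination ℝ w l = x := by
  classical
  induction hx using Submodule.span_induction with
  | mem x hx =>
    obtain ⟨i, hi, rfl⟩ := hx
    refine ⟨Pi.single i 1, fun j hj => ?_, by simp⟩
    have : j ≠ i := fun e => hj (e ▸ hi)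
    simp [this]
  | zero => exact ⟨0, by simp, by simp⟩
  | add x y _ _ hx hy =>
    obtain ⟨l, hl, rfl⟩ := hx
    obtain ⟨l', hl', rfl⟩ := hy
    exact ⟨l + l', fun i hi => by simp [hl i hi, hl' i hi], by simp⟩
  | smul a x _ hx =>
    obtain ⟨l, hl, rfl⟩ := hx
    exact ⟨a • l, fun i hi => by simp [hl i hi], by simp⟩

variable {f : Fin m → (ι → ℝ) →ₗ[ℝ] ℝ} {B : Finset ι}

theorem IsOptimalBasis.eq_zero (hB : IsOptimalBasis w f B)
    (hf : ∀ δ, (∀ k, f k δ = 0) → δ = 0) {δ : ι → ℝ} (hδ : ∀ i ∉ B, δ i = 0)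
    (h : Fintype.linearCombination ℝ w δ = 0) : δ = 0 := by
  by_contra hne
  rcases lexPos_or_lexPos_neg hf hne with h' | h'
  · exact hB.not_lexPos _ h (fun i hi => (hδ i hi).ge) h'
  · exact hB.not_lexPos _ (by simp [h]) (fun i hi => by simp [hδ i hi]) h'

theorem IsOptimalBasis.eq_of_linearCombination_eq (hB : IsOptimalBasis w f B)
    (hf : ∀ δ, (∀ k, f k δ = 0) → δ = 0) {l l' : ι → ℝ} (hl : ∀ i ∉ B, l i = 0)
    (hl' : ∀ i ∉ B, l' i = 0)
    (h : Fintype.linearCombination ℝ w l = Fintype.linearCombination ℝ w l') : l = l' :=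
  sub_eq_zero.1 <| hB.eq_zero hf (fun i hi => by simp [hl i hi, hl' i hi]) (by simp [h])

theorem IsOptimalBasis.card_eq_finrank (hB : IsOptimalBasis w f B)
    (hf : ∀ δ, (∀ k, f k δ = 0) → δ = 0) : B.card = Module.finrank ℝ W := by
  classical
  have hli : LinearIndependent ℝ (fun i : B => w i) := by
    rw [Fintype.linearIndependent_iff]
    intro g hg i
    let δ : ι → ℝ := fun i => if h : i ∈ B then g ⟨i, h⟩ else 0
    have h0 : δ = 0 := by
      refine hB.eq_zero hf (fun i hi => dif_neg hi) ?_
      rw [Fintype.linearCombination_apply, ← hg,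
        ← Finset.sum_subset (Finset.subset_univ B) (fun i _ hi => by simp [δ, hi]),
        ← Finset.sum_coe_sort]
      simp [δ]
    simpa [δ] using congrFun h0 i
  have hsp : ⊤ ≤ Submodule.span ℝ (Set.range fun i : B => w i) := by
    rw [← hB.span_eq_top, Set.image_eq_range]
    rfl
  simpa using (Module.finrank_eq_card_basis (Module.Basis.mk hli hsp)).symm

theorem exists_isOptimalBasis [FiniteDimensional ℝ W] {f : Fin (m + 1) → (ι → ℝ) →ₗ[ℝ] ℝ}
    (hf0 : ∀ δ, f 0 δ = - ∑ i, δ i) {x : W} (hx : AvoidsSpans w x) {l₀ : ι → ℝ} (hl₀ : 0 ≤ l₀)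
    (hl₀x : Fintype.linearCombination ℝ w l₀ = x) :
    ∃ B, IsOptimalBasis w f B ∧
      ∃ l : ι → ℝ, 0 ≤ l ∧ (∀ i ∉ B, l i = 0) ∧ Fintype.linearCombination ℝ w l = x := by
  classical
  let K : Set (ι → ℝ) := Set.Ici 0 ∩ (Fintype.linearCombination ℝ w ⁻¹' {x} ∩
    {l | ∑ i, l i ≤ ∑ i, l₀ i})
  have hKc : IsClosed K := by
    refine isClosed_Ici.inter (IsClosed.inter ?_ ?_)
    · exact isClosed_singleton.preimage (LinearMap.continuous_of_finiteDimensional _)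
    · exact isClosed_le (by fun_prop) continuous_const
  have hK : IsCompact K := by
    refine (isCompact_Icc (a := (0 : ι → ℝ)) (b := fun _ => ∑ i, l₀ i)).of_isClosed_subset hKc ?_
    rintro l ⟨h0, -, h⟩
    exact ⟨h0, fun i => (Finset.single_le_sum (fun j _ => h0 j) (Finset.mem_univ i)).trans h⟩
  obtain ⟨l, ⟨hl0, hlx, hls⟩, hmax⟩ := hK.exists_forall_not_lex_lt (fun k => f k)
    (fun k => LinearMap.continuous_of_finiteDimensional _) ⟨l₀, hl₀, hl₀x, le_refl (∑ i, l₀ i)⟩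
  have hlx : Fintype.linearCombination ℝ w l = x := hlx
  have hls : ∑ i, l i ≤ ∑ i, l₀ i := hls
  have hl0 : 0 ≤ l := hl0
  have hbest : ∀ μ : ι → ℝ, 0 ≤ μ → Fintype.linearCombination ℝ w μ = x →
      ¬ LexPos f (μ - l) := by
    rintro μ h0 hμ ⟨k, hk, hj⟩
    by_cases hs : ∑ i, μ i ≤ ∑ i, l i
    · have := hmax μ ⟨h0, hμ, hs.trans hls⟩ k
        fun j hjk => sub_eq_zero.1 (by simpa using hj j hjk)
      rw [map_sub] at hk
      linarith
    · have h1 : f 0 (μ - l) < 0 := by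
        rw [hf0]
        simp only [Pi.sub_apply, Finset.sum_sub_distrib]
        linarith
      rcases eq_or_ne k 0 with rfl | hk0
      · linarith
      · linarith [hj 0 (Fin.pos_of_ne_zero hk0)]
  let B : Finset ι := Finset.univ.filter fun i => l i ≠ 0
  have hlB : ∀ i ∉ B, l i = 0 := fun i hi => by simpa [B] using hi
  refine ⟨B, ⟨hx B (hlx ▸ linearCombination_mem_span_image hlB), ?_⟩, l, hl0, hlB, hlx⟩
  intro δ hδ hδB hpos
  have hev : ∀ᶠ t : ℝ in nhdsWithin 0 (Set.Ioi 0), ∀ i, 0 ≤ l i + t * δ i := by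
    rw [Filter.eventually_all]
    intro i
    by_cases hi : i ∈ B
    · have hi' : 0 < l i := lt_of_le_of_ne (hl0 i) (Ne.symm (by simpa [B] using hi))
      have hc : Filter.Tendsto (fun t : ℝ => l i + t * δ i) (nhdsWithin 0 (Set.Ioi 0))
          (nhds (l i + 0 * δ i)) :=
        (Continuous.tendsto (by fun_prop) 0).mono_left nhdsWithin_le_nhds
      rw [zero_mul, add_zero] at hc
      exact (hc.eventually_const_lt hi').mono fun _ h => h.le
    · filter_upwards [self_mem_nhdsWithin] with t ht
      rw [hlB i hi, zero_add]
      exact mul_nonneg (le_of_lt ht) (hδB i hi)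
  obtain ⟨t, ht, htpos⟩ := (hev.and self_mem_nhdsWithin).exists
  refine hbest (l + t • δ) ht (by simp [hlx, hδ]) ?_
  simpa using hpos.smul htpos

theorem IsOptimalBasis.eq_of_avoidsSpans (hf : ∀ δ, (∀ k, f k δ = 0) → δ = 0) {B' : Finset ι}
    (hB : IsOptimalBasis w f B) (hB' : IsOptimalBasis w f B') {l l' : ι → ℝ}
    (hl : 0 ≤ l) (hl' : 0 ≤ l') (hlB : ∀ i ∉ B, l i = 0) (hlB' : ∀ i ∉ B', l' i = 0)
    (h : Fintype.linearCombination ℝ w l = Fintype.linearCombination ℝ w l')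
    (hx : AvoidsSpans w (Fintype.linearCombination ℝ w l)) : B = B' := by
  classical
  have hll : l = l' := by
    by_contra hne
    rcases lexPos_or_lexPos_neg hf (sub_ne_zero.2 hne) with h' | h'
    · exact hB'.not_lexPos _ (by simp [h]) (fun i hi => by simpa [hlB' i hi] using hl i) h'
    · exact hB.not_lexPos _ (by simp [h]) (fun i hi => by simpa [hlB i hi] using hl' i) h'
  subst hll
  have key : ∀ B, IsOptimalBasis w f B → (∀ i ∉ B, l i = 0) →
      B = Finset.univ.filter fun i => l i ≠ 0 := by
    intro B hB hlB
    set S := Finset.univ.filter fun i => l i ≠ 0 with hS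
    have hlS : ∀ i ∉ S, l i = 0 := fun i hi => by simpa [S] using hi
    have hSB : S ⊆ B := fun i hi => by
      by_contra hiB
      exact (by simpa [S] using hi : l i ≠ 0) (hlB i hiB)
    refine (hSB.antisymm fun i hi => ?_).symm
    by_contra hiS
    obtain ⟨c, hc, hci⟩ := exists_linearCombination_of_mem_span_image
      (show w i ∈ Submodule.span ℝ (w '' S) by
        rw [hx S (linearCombination_mem_span_image hlS)]; trivial)
    have := hB.eq_of_linearCombination_eq hf (l := c) (l' := Pi.single i 1)
      (fun j hj => hc j fun hjS => hj (hSB hjS))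
      (fun j hj => by
        have : j ≠ i := fun e => hj (e ▸ hi)
        simp [this])
      (by simp [hci])
    have h1 := congrFun this i
    rw [hc i hiS] at h1
    simp at h1
  rw [key B hB hlB, ← key B' hB' hlB']

/-- The coordinates of `x` with respect to an optimal basis (and zero for other `B`). -/
noncomputable def optimalCoord (w : ι → W) (B : Finset ι) (x : W) : ι → ℝ :=
  open Classical in
  if h : ∃ l : ι → ℝ, (∀ i ∉ B, l i = 0) ∧ Fintype.linearCombination ℝ w l = x then h.choose
  else 0

theorem optimalCoord_eq_zero {x : W} {i : ι} (hi : i ∉ B) : optimalCoord w B x i = 0 := by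
  unfold optimalCoord
  split_ifs with h
  · exact h.choose_spec.1 i hi
  · rfl

theorem IsOptimalBasis.linearCombination_optimalCoord (hB : IsOptimalBasis w f B) (x : W) :
    Fintype.linearCombination ℝ w (optimalCoord w B x) = x := by
  have h := exists_linearCombination_of_mem_span_image
    (show x ∈ Submodule.span ℝ (w '' B) by rw [hB.span_eq_top]; trivial)
  rw [optimalCoord, dif_pos h]
  exact h.choose_spec.2

theorem IsOptimalBasis.optimalCoord_eq (hB : IsOptimalBasis w f B)
    (hf : ∀ δ, (∀ k, f k δ = 0) → δ = 0) {x : W} {l : ι → ℝ} (hl : ∀ i ∉ B, l i = 0)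
    (hlx : Fintype.linearCombination ℝ w l = x) : optimalCoord w B x = l :=
  hB.eq_of_linearCombination_eq hf (fun _ hi => optimalCoord_eq_zero hi) hl
    (by rw [hB.linearCombination_optimalCoord, hlx])

theorem IsOptimalBasis.optimalCoord_add_smul (hB : IsOptimalBasis w f B)
    (hf : ∀ δ, (∀ k, f k δ = 0) → δ = 0) (x q : W) (t : ℝ) :
    optimalCoord w B (x + t • q) = optimalCoord w B x + t • optimalCoord w B q :=
  hB.optimalCoord_eq hf
    (fun i hi => by simp [optimalCoord_eq_zero hi])
    (by simp [hB.linearCombination_optimalCoord])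

theorem IsOptimalBasis.optimalCoord_ne_zero (hB : IsOptimalBasis w f B)
    (hf : ∀ δ, (∀ k, f k δ = 0) → δ = 0) {q : W} (hq : AvoidsSpans w q) {i : ι} (hi : i ∈ B) :
    optimalCoord w B q i ≠ 0 := by
  classical
  intro h0
  have hmem : q ∈ Submodule.span ℝ (w '' (B.erase i : Finset ι)) := by
    rw [← hB.linearCombination_optimalCoord q]
    refine linearCombination_mem_span_image fun j hj => ?_
    rcases eq_or_ne j i with rfl | hji
    · exact h0
    · exact optimalCoord_eq_zero fun h => hj (Finset.mem_erase.2 ⟨hji, h⟩)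
  obtain ⟨c, hc, hci⟩ := exists_linearCombination_of_mem_span_image
      (show w i ∈ Submodule.span ℝ (w '' (B.erase i : Finset ι)) by rw [hq _ hmem]; trivial)
  have := hB.eq_of_linearCombination_eq hf (l := c) (l' := Pi.single i 1)
      (fun j hj => hc j fun h => hj (Finset.mem_of_mem_erase h))
      (fun j hj => by
        have : j ≠ i := fun e => hj (e ▸ hi)
        simp [this])
      (by simp [hci])
  have h1 := congrFun this i
  rw [hc i (Finset.notMem_erase _ _)] at h1
  simp at h1

end OptimalBasis

theorem AvoidsSpans.neg {ι W : Type*} [AddCommGroup W] [Module ℝ W] {w : ι → W} {q : W}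
    (hq : AvoidsSpans w q) : AvoidsSpans w (-q) :=
  fun S hS => hq S (by simpa using hS)

section Perturbation

variable {ι W : Type*} [Fintype ι] [NormedAddCommGroup W] [NormedSpace ℝ W] {m : ℕ} {w : ι → W}

theorem IsOpen.exists_avoidsSpans [FiniteDimensional ℝ W] (w : ι → W) {U : Set W}
    (hU : IsOpen U) (hne : U.Nonempty) : ∃ q ∈ U, AvoidsSpans w q := by
  have := FiniteDimensional.complete ℝ W
  have hd : Dense (⋂ S : {S : Finset ι // Submodule.span ℝ (w '' S) ≠ ⊤},
      ((Submodule.span ℝ (w '' S.1) : Set W))ᶜ) := by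
    refine dense_iInter_of_isOpen (fun S => ?_) (fun S => ?_)
    · exact (Submodule.closed_of_finiteDimensional _).isOpen_compl
    · rw [← interior_eq_empty_iff_dense_compl]
      by_contra h
      exact S.2 (Submodule.eq_top_of_nonempty_interior' _ (Set.nonempty_iff_ne_empty.2 h))
  obtain ⟨q, hqU, hq⟩ := hd.inter_open_nonempty U hU hne
  refine ⟨q, hqU, fun S hS => ?_⟩
  by_contra h
  exact Set.mem_iInter.1 hq ⟨S, h⟩ hS

theorem AvoidsSpans.eventually_add_smul {q : W} (hq : AvoidsSpans w q) (x : W) :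
    ∀ᶠ t : ℝ in nhdsWithin 0 (Set.Ioi 0), AvoidsSpans w (x + t • q) := by
  unfold AvoidsSpans
  rw [Filter.eventually_all]
  intro S
  by_cases h : ∃ t₀ : ℝ, 0 < t₀ ∧ x + t₀ • q ∈ Submodule.span ℝ (w '' S)
  · obtain ⟨t₀, ht₀, hmem₀⟩ := h
    filter_upwards [Ioo_mem_nhdsGT ht₀] with t ht hmem
    refine hq S ?_
    have h1 : (t₀ - t) • q ∈ Submodule.span ℝ (w '' S) := by
      have := Submodule.sub_mem _ hmem₀ hmem
      rwa [add_sub_add_left_eq_sub, ← sub_smul] at this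
    exact (Submodule.smul_mem_iff _ (sub_ne_zero.2 ht.2.ne')).1 h1
  · filter_upwards [self_mem_nhdsWithin] with t ht hmem
    exact absurd ⟨t, ht, hmem⟩ h

/-- `x` lies in the half-open simplicial cone over `B` selected by the direction `q`. -/
def MemHalfOpenCone (w : ι → W) (q : W) (B : Finset ι) (x : W) : Prop :=
  ∀ i ∈ B, 0 ≤ optimalCoord w B x i ∧ (optimalCoord w B x i = 0 → 0 < optimalCoord w B q i)

theorem eventually_nonneg_add_mul_iff {a b : ℝ} (hb : b ≠ 0) :
    ∀ᶠ t : ℝ in nhdsWithin 0 (Set.Ioi 0), (0 ≤ a + t * b ↔ 0 ≤ a ∧ (a = 0 → 0 < b)) := by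
  have hc : Filter.Tendsto (fun t : ℝ => a + t * b) (nhdsWithin 0 (Set.Ioi 0)) (nhds a) := by
    have : Filter.Tendsto (fun t : ℝ => a + t * b) (nhds 0) (nhds (a + 0 * b)) :=
      Continuous.tendsto (by fun_prop) 0
    rw [zero_mul, add_zero] at this
    exact this.mono_left nhdsWithin_le_nhds
  rcases lt_trichotomy a 0 with ha | rfl | ha
  · filter_upwards [hc.eventually_lt_const ha] with t ht
    exact ⟨fun h => absurd ht h.not_gt, fun h => absurd ha h.1.not_gt⟩
  · filter_upwards [self_mem_nhdsWithin] with t ht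
    have ht : 0 < t := ht
    rw [zero_add, mul_nonneg_iff_of_pos_left ht]
    exact ⟨fun h => ⟨le_rfl, fun _ => lt_of_le_of_ne h hb.symm⟩, fun h => (h.2 rfl).le⟩
  · filter_upwards [hc.eventually_const_lt ha] with t ht
    exact ⟨fun _ => ⟨ha.le, fun h => absurd h ha.ne'⟩, fun _ => ht.le⟩

variable {f : Fin m → (ι → ℝ) →ₗ[ℝ] ℝ} {B : Finset ι}

theorem IsOptimalBasis.eventually_iff_memHalfOpenCone (hB : IsOptimalBasis w f B)
    (hf : ∀ δ, (∀ k, f k δ = 0) → δ = 0) {q : W} (hq : AvoidsSpans w q) (x : W) :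
    ∀ᶠ t : ℝ in nhdsWithin 0 (Set.Ioi 0),
      (0 ≤ optimalCoord w B (x + t • q) ↔ MemHalfOpenCone w q B x) := by
  have h : ∀ᶠ t : ℝ in nhdsWithin 0 (Set.Ioi 0), ∀ i : B,
      (0 ≤ optimalCoord w B x i + t * optimalCoord w B q i ↔
        0 ≤ optimalCoord w B x i ∧ (optimalCoord w B x i = 0 → 0 < optimalCoord w B q i)) :=
    Filter.eventually_all.2 fun i =>
      eventually_nonneg_add_mul_iff (hB.optimalCoord_ne_zero hf hq i.2)
  filter_upwards [h] with t ht
  rw [hB.optimalCoord_add_smul hf]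
  constructor
  · exact fun h i hi => (ht ⟨i, hi⟩).1 (h i)
  · intro h i
    by_cases hi : i ∈ B
    · exact (ht ⟨i, hi⟩).2 (h i hi)
    · simp [optimalCoord_eq_zero hi]

theorem existsUnique_memHalfOpenCone [FiniteDimensional ℝ W]
    {f : Fin (m + 1) → (ι → ℝ) →ₗ[ℝ] ℝ}
    (hf : ∀ δ, (∀ k, f k δ = 0) → δ = 0) (hf0 : ∀ δ, f 0 δ = - ∑ i, δ i) {q : W}
    (hq : AvoidsSpans w q) {x : W}
    (hx : ∀ᶠ t : ℝ in nhdsWithin 0 (Set.Ioi 0),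
      ∃ l : ι → ℝ, 0 ≤ l ∧ Fintype.linearCombination ℝ w l = x + t • q) :
    ∃! B, IsOptimalBasis w f B ∧ MemHalfOpenCone w q B x := by
  have hall : ∀ᶠ t : ℝ in nhdsWithin 0 (Set.Ioi 0), ∀ B : {B // IsOptimalBasis w f B},
      (0 ≤ optimalCoord w B.1 (x + t • q) ↔ MemHalfOpenCone w q B.1 x) :=
    Filter.eventually_all.2 fun B => B.2.eventually_iff_memHalfOpenCone hf hq x
  obtain ⟨t, ⟨ht, l₀, hl₀, hl₀x⟩, hav⟩ :=
    ((hall.and hx).and (hq.eventually_add_smul x)).exists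
  obtain ⟨B, hB, l, hl0, hlB, hlx⟩ := exists_isOptimalBasis hf0 hav hl₀ hl₀x
  refine ⟨B, ⟨hB, (ht ⟨B, hB⟩).1 (by rwa [hB.optimalCoord_eq hf hlB hlx])⟩, ?_⟩
  rintro B' ⟨hB', hm⟩
  refine hB'.eq_of_avoidsSpans hf hB ((ht ⟨B', hB'⟩).2 hm) hl0
    (fun i hi => optimalCoord_eq_zero hi) hlB ?_ ?_
  · rw [hB'.linearCombination_optimalCoord, hlx]
  · rwa [hB'.linearCombination_optimalCoord]

theorem IsOptimalBasis.eventually_exists_nonneg (hB : IsOptimalBasis w f B)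
    (hf : ∀ δ, (∀ k, f k δ = 0) → δ = 0) {q : W} (hq : AvoidsSpans w q) {x : W}
    (hx : MemHalfOpenCone w q B x) :
    ∀ᶠ t : ℝ in nhdsWithin 0 (Set.Ioi 0),
      ∃ l : ι → ℝ, 0 ≤ l ∧ Fintype.linearCombination ℝ w l = x + t • q := by
  filter_upwards [hB.eventually_iff_memHalfOpenCone hf hq x] with t ht
  exact ⟨_, ht.2 hx, hB.linearCombination_optimalCoord _⟩

end Perturbation

section BoxCount

variable {ι W : Type*} [Fintype ι] [NormedAddCommGroup W] [NormedSpace ℝ W] {m : ℕ}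

/-- The number of points of `Λ` of coordinate sum `n` in the half-open boxes of all optimal
bases, the half-open structure being selected by the direction `q`. -/
noncomputable def boxCount (w : ι → W) (f : Fin m → (ι → ℝ) →ₗ[ℝ] ℝ) (Λ : AddSubgroup (ι → ℝ))
    (q : W) (n : ℕ) : ℕ :=
  open Classical in
  ∑ B with IsOptimalBasis w f B,
    (halfOpenSlice Λ B B (fun i => 0 < optimalCoord w B q i) n).ncard

variable {w : ι → W} {f : Fin m → (ι → ℝ) →ₗ[ℝ] ℝ} {Λ : AddSubgroup (ι → ℝ)}

theorem halfOpenSlice_congr {B A : Finset ι} (hAB : A ⊆ B) {s t : ι → Prop}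
    (h : ∀ i ∈ B, s i ↔ t i) (n : ℕ) : halfOpenSlice Λ B A s n = halfOpenSlice Λ B A t n := by
  ext l
  refine and_congr_right fun _ => and_congr_right fun _ => and_congr ?_ (and_congr_left fun _ => ?_)
  · exact forall₂_congr fun i hi => by rw [h i hi]
  · exact forall₂_congr fun i hi => by rw [h i (hAB hi)]

theorem boxCount_neg [DecidableEq ι] (hf : ∀ δ, (∀ k, f k δ = 0) → δ = 0)
    (hΛ : ∀ i, Pi.single i 1 ∈ Λ) {q : W} (hq : AvoidsSpans w q) {n k : ℕ}
    (hnk : n + k = Module.finrank ℝ W) : boxCount w f Λ (-q) n = boxCount w f Λ q k := by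
  classical
  refine Finset.sum_congr rfl fun B hB => ?_
  have hB : IsOptimalBasis w f B := (Finset.mem_filter.1 hB).2
  rw [ncard_halfOpenSlice_reflect hΛ (hnk.trans (hB.card_eq_finrank hf).symm)]
  rw [halfOpenSlice_congr subset_rfl fun i hi => ?_]
  have hneg : optimalCoord w B (-q) = -optimalCoord w B q :=
    hB.optimalCoord_eq hf (fun i hi => by simp [optimalCoord_eq_zero hi])
      (by simp [hB.linearCombination_optimalCoord])
  rw [hneg, Pi.neg_apply, neg_pos, not_lt]
  exact ⟨fun h => lt_of_le_of_ne h (hB.optimalCoord_ne_zero hf hq hi).symm, le_of_lt⟩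

theorem boxCount_eq_zero (hf : ∀ δ, (∀ k, f k δ = 0) → δ = 0) (q : W) {n : ℕ}
    (hn : Module.finrank ℝ W < n) : boxCount w f Λ q n = 0 := by
  classical
  refine Finset.sum_eq_zero fun B hB => ?_
  have hB : IsOptimalBasis w f B := (Finset.mem_filter.1 hB).2
  rw [halfOpenSlice_eq_empty (by rwa [hB.card_eq_finrank hf]), Set.ncard_empty]

theorem Set.Finite.ncard_eq_sum_of_existsUnique {α β : Type*} [Nonempty β] {T : Set α} (hT : T.Finite)
    {s : Finset β} {r : α → β → Prop} (h : ∀ x ∈ T, ∃! b, b ∈ s ∧ r x b) :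
    T.ncard = ∑ b ∈ s, {x ∈ T | r x b}.ncard := by
  classical
  lift T to Finset α using hT
  choose! g hg hu using h
  rw [Set.ncard_coe_finset, Finset.card_eq_sum_card_fiberwise fun x hx => (hg x hx).1]
  refine Finset.sum_congr rfl fun b hb => ?_
  rw [← Set.ncard_coe_finset]
  congr 1
  ext x
  simp only [Finset.coe_filter, Set.mem_ofPred_eq]
  refine and_congr_right fun hx => ⟨fun e => e ▸ (hg x hx).2, fun hr => (hu x hx b ⟨hb, hr⟩).symm⟩

theorem one_sub_X_pow_finrank_mul_mk_ncard [DecidableEq ι] [FiniteDimensional ℝ W]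
    {f : Fin (m + 1) → (ι → ℝ) →ₗ[ℝ] ℝ}
    (hf : ∀ δ, (∀ k, f k δ = 0) → δ = 0) (hf0 : ∀ δ, f 0 δ = - ∑ i, δ i)
    (hΛ : ∀ i, Pi.single i 1 ∈ Λ) {q : W} (hq : AvoidsSpans w q)
    {α : Type*} {φ : ℕ → α → W} (hφ : ∀ n, Function.Injective (φ n)) {T : ℕ → Set α}
    (hT : ∀ n, (T n).Finite)
    (hcone : ∀ n, ∀ x ∈ T n, ∀ᶠ t : ℝ in nhdsWithin 0 (Set.Ioi 0),
      ∃ l : ι → ℝ, 0 ≤ l ∧ Fintype.linearCombination ℝ w l = φ n x + t • q)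
    (hslice : ∀ n : ℕ, ∀ B, IsOptimalBasis w f B → ∀ x ∈ T n, MemHalfOpenCone w q B (φ n x) →
      optimalCoord w B (φ n x) ∈ Λ ∧ ∑ i, optimalCoord w B (φ n x) i = (n : ℝ))
    (hmem : ∀ n : ℕ, ∀ B, IsOptimalBasis w f B → ∀ l ∈ Λ, 0 ≤ l → (∀ i ∉ B, l i = 0) →
      ∑ i, l i = n → MemHalfOpenCone w q B (Fintype.linearCombination ℝ w l) →
      ∃ x ∈ T n, φ n x = Fintype.linearCombination ℝ w l) :
    (1 - PowerSeries.X) ^ Module.finrank ℝ W *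
      PowerSeries.mk (fun n => ((T n).ncard : ℤ)) =
    PowerSeries.mk (fun n => (boxCount w f Λ q n : ℤ)) := by
  classical
  have himage : ∀ n B, IsOptimalBasis w f B →
      Fintype.linearCombination ℝ w ''
        halfOpenSlice Λ B ∅ (fun i => 0 < optimalCoord w B q i) n =
      φ n '' {x ∈ T n | MemHalfOpenCone w q B (φ n x)} := by
    intro n B hB
    apply Set.Subset.antisymm
    · rintro _ ⟨l, ⟨h1, h2, h3, -, h5⟩, rfl⟩
      have h0 : 0 ≤ l := fun i => by
        by_cases hi : i ∈ B
        · exact (h3 i hi).1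
        · exact (h2 i hi).ge
      have hl : MemHalfOpenCone w q B (Fintype.linearCombination ℝ w l) := by
        unfold MemHalfOpenCone
        rwa [hB.optimalCoord_eq hf h2 rfl]
      obtain ⟨x, hx, hxl⟩ := hmem n B hB l h1 h0 h2 h5 hl
      exact ⟨x, ⟨hx, hxl ▸ hl⟩, hxl⟩
    · rintro _ ⟨x, ⟨hx, hxB⟩, rfl⟩
      obtain ⟨h1, h2⟩ := hslice n B hB x hx hxB
      exact ⟨_, ⟨h1, fun i hi => optimalCoord_eq_zero hi, hxB, by simp, h2⟩,
        hB.linearCombination_optimalCoord _⟩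
  have hinj : ∀ n B, IsOptimalBasis w f B → Set.InjOn (Fintype.linearCombination ℝ w)
      (halfOpenSlice Λ B ∅ (fun i => 0 < optimalCoord w B q i) n) :=
    fun n B hB l hl l' hl' h => hB.eq_of_linearCombination_eq hf hl.2.1 hl'.2.1 h
  have hfin : ∀ B, IsOptimalBasis w f B → ∀ n,
      (halfOpenSlice Λ B ∅ (fun i => 0 < optimalCoord w B q i) n).Finite := fun B hB n => by
    refine Set.Finite.of_finite_image ?_ (hinj n B hB)
    rw [himage n B hB]
    exact ((hT n).subset (Set.sep_subset _ _)).image _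
  have hncard : ∀ n, (T n).ncard = ∑ B with IsOptimalBasis w f B,
      (halfOpenSlice Λ B ∅ (fun i => 0 < optimalCoord w B q i) n).ncard := by
    intro n
    rw [(hT n).ncard_eq_sum_of_existsUnique (s := Finset.univ.filter (IsOptimalBasis w f))
      (r := fun x B => MemHalfOpenCone w q B (φ n x))]
    · refine Finset.sum_congr rfl fun B hB => ?_
      have hB : IsOptimalBasis w f B := (Finset.mem_filter.1 hB).2
      rw [← (hinj n B hB).ncard_image, himage n B hB,
        Set.ncard_image_of_injective _ (hφ n)]
    · intro x hx
      simpa using existsUnique_memHalfOpenCone hf hf0 hq (hcone n x hx)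
  have hsum : PowerSeries.mk (fun n => ((T n).ncard : ℤ)) =
      ∑ B with IsOptimalBasis w f B, PowerSeries.mk (fun n =>
        ((halfOpenSlice Λ B ∅ (fun i => 0 < optimalCoord w B q i) n).ncard : ℤ)) := by
    ext n
    simp [hncard]
  rw [hsum, Finset.mul_sum]
  ext n
  rw [PowerSeries.coeff_mk, boxCount, map_sum, Nat.cast_sum]
  refine Finset.sum_congr rfl fun B hB => ?_
  have hB : IsOptimalBasis w f B := (Finset.mem_filter.1 hB).2
  rw [← hB.card_eq_finrank hf, one_sub_X_pow_mul_mk_halfOpenSlice hΛ (hfin B hB) subset_rfl,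
    PowerSeries.coeff_mk]

end BoxCount

section PolytopeCone

variable {ι E : Type*} [Fintype ι] [NormedAddCommGroup E] [NormedSpace ℝ E] {v : ι → E}

theorem linearCombination_one_prod (v : ι → E) (l : ι → ℝ) :
    Fintype.linearCombination ℝ (fun i => ((1 : ℝ), v i)) l =
      (∑ i, l i, Fintype.linearCombination ℝ v l) := by
  simp [Fintype.linearCombination_apply, Prod.ext_iff, Prod.fst_sum, Prod.snd_sum]

theorem linearCombination_sub_const (v : ι → E) (p : E) (l : ι → ℝ) :
    Fintype.linearCombination ℝ (fun i => v i - p) l =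
      Fintype.linearCombination ℝ v l - (∑ i, l i) • p := by
  simp [Fintype.linearCombination_apply, smul_sub, Finset.sum_smul]

/-- The cone in `ℝ × E` over the convex hull of the points `v i`, placed at height one. -/
def polytopeCone (v : ι → E) : Set (ℝ × E) :=
  {y | ∃ l : ι → ℝ, 0 ≤ l ∧ Fintype.linearCombination ℝ (fun i => ((1 : ℝ), v i)) l = y}

theorem mk_mem_polytopeCone {s : ℝ} {x : E} : (s, x) ∈ polytopeCone v ↔
    ∃ l : ι → ℝ, 0 ≤ l ∧ ∑ i, l i = s ∧ Fintype.linearCombination ℝ v l = x := by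
  simp only [polytopeCone, linearCombination_one_prod, Set.mem_ofPred_eq, Prod.mk.injEq]

theorem add_mem_polytopeCone {x y : ℝ × E} (hx : x ∈ polytopeCone v) (hy : y ∈ polytopeCone v) :
    x + y ∈ polytopeCone v := by
  obtain ⟨l, hl, rfl⟩ := hx
  obtain ⟨l', hl', rfl⟩ := hy
  exact ⟨l + l', add_nonneg hl hl', map_add _ _ _⟩

theorem smul_mem_polytopeCone {x : ℝ × E} (hx : x ∈ polytopeCone v) {t : ℝ} (ht : 0 ≤ t) :
    t • x ∈ polytopeCone v := by
  obtain ⟨l, hl, rfl⟩ := hx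
  exact ⟨t • l, smul_nonneg ht hl, map_smul _ _ _⟩

theorem add_mem_interior_polytopeCone {x y : ℝ × E} (hx : x ∈ polytopeCone v)
    (hy : y ∈ interior (polytopeCone v)) : x + y ∈ interior (polytopeCone v) := by
  refine interior_maximal ?_ ((Homeomorph.addLeft x).isOpenMap _ isOpen_interior)
    (Set.mem_image_of_mem (Homeomorph.addLeft x) hy)
  rintro _ ⟨z, hz, rfl⟩
  exact add_mem_polytopeCone hx (interior_subset hz)

theorem smul_mem_interior_polytopeCone {x : ℝ × E} (hx : x ∈ interior (polytopeCone v)) {t : ℝ}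
    (ht : 0 < t) : t • x ∈ interior (polytopeCone v) := by
  refine interior_maximal ?_ (isOpen_interior.smul₀ ht.ne') (Set.smul_mem_smul_set hx)
  rintro _ ⟨z, hz, rfl⟩
  exact smul_mem_polytopeCone (interior_subset hz) ht.le

theorem eventually_add_smul_mem_of_mem_interior {V : Type*} [NormedAddCommGroup V]
    [NormedSpace ℝ V] {C : Set V} {x : V} (hx : x ∈ interior C) (q : V) :
    ∀ᶠ t : ℝ in nhdsWithin 0 (Set.Ioi 0), x + t • q ∈ C := by
  have hc : Filter.Tendsto (fun t : ℝ => x + t • q) (nhds 0) (nhds (x + (0 : ℝ) • q)) :=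
    Continuous.tendsto (by fun_prop) 0
  rw [zero_smul, add_zero] at hc
  exact (hc.mono_left nhdsWithin_le_nhds).eventually (mem_interior_iff_mem_nhds.1 hx)

theorem mk_mem_polytopeCone_iff_mem_smul [Nonempty ι] {s : ℝ} (hs : 0 ≤ s) {x : E} :
    (s, x) ∈ polytopeCone v ↔ x ∈ s • convexHull ℝ (Set.range v) := by
  classical
  have hP : convexHull ℝ (Set.range v) = Fintype.linearCombination ℝ v '' stdSimplex ℝ ι := by
    rw [← convexHull_rangle_single_eq_stdSimplex, LinearMap.image_convexHull, ← Set.range_comp]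
    congr 2
    ext i
    simp
  rw [mk_mem_polytopeCone, hP]
  rcases hs.eq_or_lt with rfl | hs
  · rw [Set.zero_smul_set (Set.Nonempty.image _
      ⟨_, single_mem_stdSimplex ℝ (Classical.arbitrary ι)⟩), Set.mem_zero]
    constructor
    · rintro ⟨l, hl, hl0, rfl⟩
      have : l = 0 := funext fun i =>
        (Finset.sum_eq_zero_iff_of_nonneg fun i _ => hl i).1 hl0 i (Finset.mem_univ i)
      simp [this]
    · rintro rfl
      exact ⟨0, le_rfl, by simp, by simp⟩
  · rw [Set.mem_smul_set]
    constructor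
    · rintro ⟨l, hl, hls, rfl⟩
      refine ⟨_, ⟨s⁻¹ • l, ⟨fun i => ?_, ?_⟩, rfl⟩, ?_⟩
      · exact mul_nonneg (inv_nonneg.2 hs.le) (hl i)
      · simp [← Finset.mul_sum, hls, hs.ne']
      · simp [smul_smul, hs.ne']
    · rintro ⟨_, ⟨l, ⟨hl, hls⟩, rfl⟩, rfl⟩
      refine ⟨s • l, fun i => mul_nonneg hs.le (hl i), ?_, by simp⟩
      simp [← Finset.mul_sum, hls]

theorem mk_mem_interior_polytopeCone_iff [Nonempty ι] {s : ℝ} (hs : 0 ≤ s) {x : E} :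
    (s, x) ∈ interior (polytopeCone v) ↔
      s ≠ 0 ∧ x ∈ interior (s • convexHull ℝ (Set.range v)) := by
  constructor
  · intro h
    refine ⟨?_, ?_⟩
    · rintro rfl
      obtain ⟨t, ht, htpos⟩ := ((eventually_add_smul_mem_of_mem_interior h
        ((-1 : ℝ), (0 : E))).and self_mem_nhdsWithin).exists
      have htpos : 0 < t := htpos
      simp only [Prod.smul_mk, Prod.mk_add_mk, mk_mem_polytopeCone] at ht
      obtain ⟨l, hl, hls, -⟩ := ht
      have : 0 ≤ ∑ i, l i := Finset.sum_nonneg fun i _ => hl i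
      simp only [smul_eq_mul] at hls
      linarith
    · refine interior_maximal ?_ (isOpen_interior.preimage
        (by fun_prop : Continuous fun z : E => (s, z))) h
      intro z hz
      exact (mk_mem_polytopeCone_iff_mem_smul hs).1 (interior_subset hz)
  · rintro ⟨hs0, hx⟩
    have hs : 0 < s := lt_of_le_of_ne hs hs0.symm
    rw [mem_interior_iff_mem_nhds]
    have hc : Filter.Tendsto (fun z : ℝ × E => (s / z.1) • z.2) (nhds (s, x)) (nhds x) := by
      have : ContinuousAt (fun z : ℝ × E => (s / z.1) • z.2) (s, x) :=
        (continuousAt_const.div continuousAt_fst hs0).smul continuousAt_snd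
      simpa [ContinuousAt, hs0] using this
    have hpos : ∀ᶠ z : ℝ × E in nhds (s, x), 0 < z.1 :=
      (continuousAt_fst (p := (s, x))).eventually_const_lt hs
    filter_upwards [hpos, hc.eventually (mem_interior_iff_mem_nhds.1 hx)] with z hz hzP
    have h := smul_mem_polytopeCone ((mk_mem_polytopeCone_iff_mem_smul hs.le).2 hzP)
      (t := z.1 / s) (by positivity)
    have hz' : (z.1 / s) • (s, (s / z.1) • z.2) = z := by
      ext1
      · simp [hs0]
      · simp [smul_smul, hs0, hz.ne']
    rwa [hz'] at h

end PolytopeCone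

theorem exists_functionals_sum_first (ι : Type*) [Fintype ι] :
    ∃ (m : ℕ) (f : Fin (m + 1) → (ι → ℝ) →ₗ[ℝ] ℝ), (∀ δ, (∀ k, f k δ = 0) → δ = 0) ∧
      ∀ δ, f 0 δ = - ∑ i, δ i := by
  refine ⟨Fintype.card ι, Fin.cons (-∑ i, LinearMap.proj i)
    fun k => LinearMap.proj ((Fintype.equivFin ι).symm k), fun δ h => ?_, fun δ => ?_⟩
  · ext i
    simpa using h (Fintype.equivFin ι i).succ
  · simp

section LatticePolytope

variable {d : ℕ} {ι : Type*} [Fintype ι]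

/-- The inclusion of `ℤ^d` in `ℝ^d`. -/
def intCastVec (d : ℕ) : (Fin d → ℤ) →+ (Fin d → ℝ) := (Int.castAddHom ℝ).compLeft (Fin d)

theorem intCastVec_injective : Function.Injective (intCastVec d) :=
  fun _ _ h => funext fun i => Int.cast_injective (congrFun h i)

/-- The coefficient vectors `l` such that `∑ i, l i • v i` is an integer point. -/
def integralCoeffs (v : ι → Fin d → ℝ) : AddSubgroup (ι → ℝ) :=
  (intCastVec d).range.comap (Fintype.linearCombination ℝ v).toAddMonoidHom

theorem mem_integralCoeffs {v : ι → Fin d → ℝ} {l : ι → ℝ} :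
    l ∈ integralCoeffs v ↔ ∃ x, intCastVec d x = Fintype.linearCombination ℝ v l :=
  Iff.rfl

theorem single_mem_integralCoeffs [DecidableEq ι] {v : ι → Fin d → ℝ}
    (hv : ∀ i, v i ∈ (intCastVec d).range) (i : ι) : Pi.single i 1 ∈ integralCoeffs v := by
  rw [mem_integralCoeffs]
  simpa using hv i

theorem finite_intCastVec_mem_polytopeCone (v : ι → Fin d → ℝ) (n : ℕ) :
    {x | ((n : ℝ), intCastVec d x) ∈ polytopeCone v}.Finite := by
  let M : Fin d → ℤ := fun j => ⌈∑ i, n * |v i j|⌉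
  refine (Set.finite_Icc (-M) M).subset fun x hx => ?_
  obtain ⟨l, hl, hls, hlx⟩ := mk_mem_polytopeCone.1 hx
  have key : ∀ j, |(x j : ℝ)| ≤ M j := by
    intro j
    have hxj : (x j : ℝ) = ∑ i, l i * v i j := by
      have := congrFun hlx j
      simpa [Fintype.linearCombination_apply, Finset.sum_apply, intCastVec] using this.symm
    rw [hxj]
    refine (Finset.abs_sum_le_sum_abs _ _).trans (le_trans ?_ (Int.le_ceil _))
    refine Finset.sum_le_sum fun i _ => ?_
    rw [abs_mul, abs_of_nonneg (hl i)]
    exact mul_le_mul_of_nonneg_right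
      (hls ▸ Finset.single_le_sum (fun i _ => hl i) (Finset.mem_univ i)) (abs_nonneg _)
  refine ⟨fun j => ?_, fun j => ?_⟩
  · have := (abs_le.1 (key j)).1
    exact_mod_cast this
  · have := (abs_le.1 (key j)).2
    exact_mod_cast this

variable [DecidableEq ι] {v : ι → Fin d → ℝ}

theorem exists_closed_and_open_numerators (hv : ∀ i, v i ∈ (intCastVec d).range)
    (hne : (interior (polytopeCone v)).Nonempty) :
    ∃ h ho : ℕ → ℕ, (∀ i k, i + k = d + 1 → ho i = h k) ∧ (∀ i, d + 1 < i → ho i = 0) ∧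
      (1 - PowerSeries.X) ^ (d + 1) * PowerSeries.mk (fun n : ℕ =>
        ({x | ((n : ℝ), intCastVec d x) ∈ polytopeCone v}.ncard : ℤ)) =
        PowerSeries.mk (fun n => (h n : ℤ)) ∧
      (1 - PowerSeries.X) ^ (d + 1) * PowerSeries.mk (fun n : ℕ =>
        ({x | ((n : ℝ), intCastVec d x) ∈ interior (polytopeCone v)}.ncard : ℤ)) =
        PowerSeries.mk (fun n => (ho n : ℤ)) := by
  obtain ⟨m, f, hf, hf0⟩ := exists_functionals_sum_first ι
  let w : ι → ℝ × (Fin d → ℝ) := fun i => (1, v i)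
  obtain ⟨q, hqC, hq⟩ := isOpen_interior.exists_avoidsSpans w hne
  have hrank : Module.finrank ℝ (ℝ × (Fin d → ℝ)) = d + 1 := by simp [add_comm]
  have hΛ := single_mem_integralCoeffs hv
  have hφ : ∀ n : ℕ, Function.Injective fun x => ((n : ℝ), intCastVec d x) :=
    fun n x y h => intCastVec_injective (congrArg Prod.snd h)
  have hsl : ∀ n : ℕ, ∀ B, IsOptimalBasis w f B → ∀ x : Fin d → ℤ,
      optimalCoord w B ((n : ℝ), intCastVec d x) ∈ integralCoeffs v ∧
        ∑ i, optimalCoord w B ((n : ℝ), intCastVec d x) i = (n : ℝ) := by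
    intro n B hB x
    have := hB.linearCombination_optimalCoord ((n : ℝ), intCastVec d x)
    rw [linearCombination_one_prod, Prod.mk.injEq] at this
    exact ⟨⟨x, this.2.symm⟩, this.1⟩
  refine ⟨boxCount w f (integralCoeffs v) q, boxCount w f (integralCoeffs v) (-q),
    fun i k hik => boxCount_neg hf hΛ hq (hik.trans hrank.symm),
    fun i hi => boxCount_eq_zero hf _ (hrank.symm ▸ hi), ?_, ?_⟩
  · rw [← hrank]
    refine one_sub_X_pow_finrank_mul_mk_ncard hf hf0 hΛ hq hφ
      (T := fun n : ℕ => {x | ((n : ℝ), intCastVec d x) ∈ polytopeCone v})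
      (finite_intCastVec_mem_polytopeCone v) ?_ (fun n B hB x _ _ => hsl n B hB x) ?_
    · intro n x hx
      filter_upwards [self_mem_nhdsWithin] with t ht
      exact add_mem_polytopeCone hx (smul_mem_polytopeCone (interior_subset hqC) (le_of_lt ht))
    · rintro n B hB l ⟨x, hx⟩ hl0 - hls -
      have hxl : ((n : ℝ), intCastVec d x) = Fintype.linearCombination ℝ w l := by
        rw [linearCombination_one_prod, hls]
        exact congrArg _ hx
      exact ⟨x, ⟨l, hl0, hxl.symm⟩, hxl⟩
  · rw [← hrank]
    refine one_sub_X_pow_finrank_mul_mk_ncard hf hf0 hΛ hq.neg hφ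
      (T := fun n : ℕ => {x | ((n : ℝ), intCastVec d x) ∈ interior (polytopeCone v)})
      (fun n => (finite_intCastVec_mem_polytopeCone v n).subset fun x hx => interior_subset (s := polytopeCone v) hx)
      ?_ (fun n B hB x _ _ => hsl n B hB x) ?_
    · exact fun n x hx => eventually_add_smul_mem_of_mem_interior hx _
    · rintro n B hB l ⟨x, hx⟩ - - hls hm
      have hxl : ((n : ℝ), intCastVec d x) = Fintype.linearCombination ℝ w l := by
        rw [linearCombination_one_prod, hls]
        exact congrArg _ hx
      refine ⟨x, ?_, hxl⟩
      obtain ⟨t, ht, htpos⟩ :=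
        ((hB.eventually_exists_nonneg hf hq.neg hm).and self_mem_nhdsWithin).exists
      have := add_mem_interior_polytopeCone (v := v) ht (smul_mem_interior_polytopeCone hqC htpos)
      rw [smul_neg, neg_add_cancel_right, ← hxl] at this
      exact this

theorem exists_boundary_numerator (hv : ∀ i, v i ∈ (intCastVec d).range) {p : Fin d → ℝ}
    (hp : ((1 : ℝ), p) ∈ interior (polytopeCone v)) :
    ∃ b : ℕ → ℕ, (∀ i k, i + k = d → b i = b k) ∧ (∀ i, d < i → b i = 0) ∧
      (1 - PowerSeries.X) ^ d * PowerSeries.mk (fun n : ℕ =>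
        ({x | ((n : ℝ), intCastVec d x) ∈ polytopeCone v ∧
          ((n : ℝ), intCastVec d x) ∉ interior (polytopeCone v)}.ncard : ℤ)) =
        PowerSeries.mk (fun n => (b n : ℤ)) := by
  obtain ⟨m, f, hf, hf0⟩ := exists_functionals_sum_first ι
  let w : ι → Fin d → ℝ := fun i => v i - p
  obtain ⟨q, -, hq⟩ := isOpen_univ.exists_avoidsSpans w Set.univ_nonempty
  have hrank : Module.finrank ℝ (Fin d → ℝ) = d := by simp
  have hpow : ∀ S : PowerSeries ℤ, (1 - PowerSeries.X) ^ d * S =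
      (1 - PowerSeries.X) ^ Module.finrank ℝ (Fin d → ℝ) * S := fun S => by rw [hrank]
  have hΛ := single_mem_integralCoeffs hv
  have hφ : ∀ n : ℕ, Function.Injective fun x => intCastVec d x - (n : ℝ) • p :=
    fun n x y h => intCastVec_injective (sub_left_injective h)
  have hcone : ∀ y : Fin d → ℝ, ∃ l : ι → ℝ, 0 ≤ l ∧ Fintype.linearCombination ℝ w l = y := by
    intro y
    obtain ⟨t, ht, htpos⟩ := ((eventually_add_smul_mem_of_mem_interior hp
      ((0 : ℝ), y)).and self_mem_nhdsWithin).exists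
    have htpos : 0 < t := htpos
    simp only [Prod.smul_mk, Prod.mk_add_mk, mk_mem_polytopeCone, smul_zero, add_zero] at ht
    obtain ⟨l, hl, hls, hlx⟩ := ht
    refine ⟨t⁻¹ • l, smul_nonneg (inv_nonneg.2 htpos.le) hl, ?_⟩
    rw [map_smul, linearCombination_sub_const, hls, hlx]
    simp [smul_smul, htpos.ne']
  have hmin : ∀ B, IsOptimalBasis w f B → ∀ l μ : ι → ℝ, (∀ i ∉ B, l i = 0) → 0 ≤ μ →
      Fintype.linearCombination ℝ w μ = Fintype.linearCombination ℝ w l →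
      ∑ i, l i ≤ ∑ i, μ i := by
    intro B hB l μ hl hμ h
    by_contra! hlt
    refine hB.not_lexPos (μ - l) (by simp [h]) (fun i hi => by simpa [hl i hi] using hμ i)
      ⟨0, ?_, fun j hj => absurd hj (Fin.not_lt_zero j)⟩
    rw [hf0]
    simp only [Pi.sub_apply, Finset.sum_sub_distrib]
    linarith
  have hmk : ∀ q, AvoidsSpans w q → (1 - PowerSeries.X) ^ d * PowerSeries.mk (fun n : ℕ =>
        ({x | ((n : ℝ), intCastVec d x) ∈ polytopeCone v ∧
          ((n : ℝ), intCastVec d x) ∉ interior (polytopeCone v)}.ncard : ℤ)) =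
        PowerSeries.mk (fun n => (boxCount w f (integralCoeffs v) q n : ℤ)) := by
    intro q hq
    rw [hpow]
    refine one_sub_X_pow_finrank_mul_mk_ncard hf hf0 hΛ hq hφ
      (T := fun n : ℕ => {x | ((n : ℝ), intCastVec d x) ∈ polytopeCone v ∧
          ((n : ℝ), intCastVec d x) ∉ interior (polytopeCone v)})
      (fun n => (finite_intCastVec_mem_polytopeCone v n).subset fun x hx => hx.1)
      (fun n x _ => Filter.Eventually.of_forall fun t => hcone _) ?_ ?_
    · rintro n B hB x ⟨hxC, hxI⟩ hm
      set l := optimalCoord w B (intCastVec d x - (n : ℝ) • p)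
      have hlB : ∀ i ∉ B, l i = 0 := fun i hi => optimalCoord_eq_zero hi
      have hl0 : 0 ≤ l := fun i => by
        by_cases hi : i ∈ B
        · exact (hm i hi).1
        · exact (hlB i hi).ge
      have hlx : Fintype.linearCombination ℝ w l = intCastVec d x - (n : ℝ) • p :=
        hB.linearCombination_optimalCoord _
      obtain ⟨μ, hμ, hμs, hμx⟩ := mk_mem_polytopeCone.1 hxC
      have hle : ∑ i, l i ≤ n := by
        rw [← hμs]
        refine hmin B hB l μ hlB hμ ?_
        rw [hlx, linearCombination_sub_const, hμs, hμx]
      have hlv : Fintype.linearCombination ℝ v l =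
          intCastVec d x - (n : ℝ) • p + (∑ i, l i) • p := by
        rw [← hlx, linearCombination_sub_const, sub_add_cancel]
      have heq : ∑ i, l i = (n : ℝ) := by
        refine hle.eq_of_not_lt fun hlt => hxI ?_
        have := add_mem_interior_polytopeCone (v := v) ⟨l, hl0, rfl⟩
          (smul_mem_interior_polytopeCone hp (sub_pos.2 hlt))
        convert this using 1
        rw [linearCombination_one_prod, hlv]
        ext1
        · simp
        · rw [Prod.snd_add, Prod.smul_snd]
          module
      rw [heq, sub_add_cancel] at hlv
      exact ⟨⟨x, hlv.symm⟩, heq⟩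
    · rintro n B hB l ⟨x, hx⟩ hl0 hlB hls -
      have hx : intCastVec d x = Fintype.linearCombination ℝ v l := hx
      refine ⟨x, ⟨mk_mem_polytopeCone.2 ⟨l, hl0, hls, hx.symm⟩, fun hI => ?_⟩, ?_⟩
      · obtain ⟨t, ht, htpos⟩ := ((eventually_add_smul_mem_of_mem_interior hI
          ((-1 : ℝ), -p)).and self_mem_nhdsWithin).exists
        have htpos : 0 < t := htpos
        simp only [Prod.smul_mk, Prod.mk_add_mk, mk_mem_polytopeCone] at ht
        obtain ⟨μ, hμ, hμs, hμx⟩ := ht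
        have := hmin B hB l μ hlB hμ (by
          rw [linearCombination_sub_const, linearCombination_sub_const, hμs, hμx, hls, hx,
            add_smul, smul_neg, smul_eq_mul, mul_neg_one, neg_smul]
          abel)
        rw [hls, hμs, smul_eq_mul] at this
        linarith
      · rw [linearCombination_sub_const, hls, hx]
  refine ⟨boxCount w f (integralCoeffs v) q, fun i k hik => ?_,
    fun i hi => boxCount_eq_zero hf _ (hrank.symm ▸ hi), hmk q hq⟩
  rw [← boxCount_neg hf hΛ hq (hik.trans hrank.symm)]
  have := congrArg (PowerSeries.coeff i) ((hmk q hq).symm.trans (hmk (-q) hq.neg))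
  simpa using this

end LatticePolytope

theorem open_ehrhart_decomposition (d : ℕ) (V : Finset (Fin d → ℝ))
    (hV : ∀ v ∈ V, ∀ i, ∃ k : ℤ, v i = (k : ℝ))
    (P : Set (Fin d → ℝ)) (hP : P = convexHull ℝ (V : Set (Fin d → ℝ)))
    (hspan : affineSpan ℝ P = ⊤) :
    ∃ a b : Polynomial ℤ,
      (∀ i, 0 ≤ a.coeff i) ∧ (∀ i, 0 ≤ b.coeff i) ∧
      SymmetricWrt a (d + 1) ∧ SymmetricWrt b d ∧
      (1 - PowerSeries.X) ^ (d + 1) *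
          PowerSeries.mk (fun n =>
            if n = 0 then 0 else
              (Set.ncard {x : Fin d → ℤ |
                (fun i => (x i : ℝ)) ∈ interior ((n : ℝ) • P)} : ℤ)) =
        (a : PowerSeries ℤ) - (b : PowerSeries ℤ) := by
  classical
  let v : V → Fin d → ℝ := Subtype.val
  have hPv : P = convexHull ℝ (Set.range v) := by simp [hP, v]
  have hv : ∀ i, v i ∈ (intCastVec d).range := fun i => by
    choose k hk using hV i i.2
    exact ⟨k, funext fun j => (hk j).symm⟩
  obtain ⟨p, hp⟩ : (interior P).Nonempty := by
    rw [hPv, interior_convexHull_nonempty_iff_affineSpan_eq_top, ← affineSpan_convexHull, ← hPv,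
      hspan]
  have : Nonempty V := by
    by_contra h
    rw [not_nonempty_iff] at h
    simp [hPv, Set.range_eq_empty] at hp
  have hp' : ((1 : ℝ), p) ∈ interior (polytopeCone v) := by
    rw [mk_mem_interior_polytopeCone_iff zero_le_one, one_smul, ← hPv]
    exact ⟨one_ne_zero, hp⟩
  obtain ⟨h, ho, hrefl, hoz, hh, hho⟩ := exists_closed_and_open_numerators hv ⟨_, hp'⟩
  obtain ⟨b, hbs, hbz, hb⟩ := exists_boundary_numerator hv hp'
  have hopen : PowerSeries.mk (fun n : ℕ => if n = 0 then 0 else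
      (Set.ncard {x : Fin d → ℤ | (fun i => (x i : ℝ)) ∈ interior ((n : ℝ) • P)} : ℤ)) =
      PowerSeries.mk (fun n : ℕ =>
        ({x | ((n : ℝ), intCastVec d x) ∈ interior (polytopeCone v)}.ncard : ℤ)) := by
    ext n
    simp only [PowerSeries.coeff_mk, mk_mem_interior_polytopeCone_iff (Nat.cast_nonneg n), ← hPv]
    split_ifs with hn
    · simp [hn]
    · simp [hn, intCastVec, Function.comp_def, AddMonoidHom.compLeft]
  have hsum : PowerSeries.mk (fun n : ℕ =>
        ({x | ((n : ℝ), intCastVec d x) ∈ polytopeCone v}.ncard : ℤ)) =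
      PowerSeries.mk (fun n : ℕ =>
        ({x | ((n : ℝ), intCastVec d x) ∈ interior (polytopeCone v)}.ncard : ℤ)) +
      PowerSeries.mk (fun n : ℕ => ({x | ((n : ℝ), intCastVec d x) ∈ polytopeCone v ∧
          ((n : ℝ), intCastVec d x) ∉ interior (polytopeCone v)}.ncard : ℤ)) := by
    ext n
    have hfin := finite_intCastVec_mem_polytopeCone v n
    have hsub : {x | ((n : ℝ), intCastVec d x) ∈ interior (polytopeCone v)} ⊆
        {x | ((n : ℝ), intCastVec d x) ∈ polytopeCone v} := fun x hx =>
      interior_subset (s := polytopeCone v) hx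
    have := Set.ncard_sdiff_add_ncard_of_subset hsub hfin
    simp only [map_add, PowerSeries.coeff_mk]
    rw [← this, Nat.cast_add, add_comm]
    rfl
  have hrel : PowerSeries.mk (fun n => (h n : ℤ)) = PowerSeries.mk (fun n => (ho n : ℤ)) +
      (1 - PowerSeries.X) * PowerSeries.mk (fun n => (b n : ℤ)) := by
    rw [← hh, ← hho, ← hb, hsum, pow_succ]
    ring
  have hrel0 : (h 0 : ℤ) = ho 0 + b 0 := by
    simpa [sub_mul] using congrArg (PowerSeries.coeff 0) hrel
  have hrels : ∀ n, (h (n + 1) : ℤ) = ho (n + 1) + (b (n + 1) - b n) := fun n => by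
    simpa [sub_mul, PowerSeries.coeff_succ_X_mul] using
      congrArg (PowerSeries.coeff (n + 1)) hrel
  let a' : Polynomial ℤ := PowerSeries.trunc (d + 2) (PowerSeries.mk fun n => (ho n + b n : ℤ))
  let b' : Polynomial ℤ := PowerSeries.trunc (d + 1) (PowerSeries.mk fun n => (b n : ℤ))
  have ha' : ∀ n, a'.coeff n = ho n + b n := fun n => by
    simp only [a', PowerSeries.coeff_trunc, PowerSeries.coeff_mk]
    split_ifs with hn
    · rfl
    · rw [hoz n (by omega), hbz n (by omega)]
      rfl
  have hb' : ∀ n, b'.coeff n = b n := fun n => by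
    simp only [b', PowerSeries.coeff_trunc, PowerSeries.coeff_mk]
    split_ifs with hn
    · rfl
    · rw [hbz n (by omega)]
      rfl
  have hsymm : ∀ i ≤ d + 1, (ho i + b i : ℤ) = ho (d + 1 - i) + b (d + 1 - i) := by
    intro i hi
    rw [hrefl (d + 1 - i) i (by omega)]
    rcases i with _ | i
    · rw [hrel0, hbz (d + 1 - 0) (by omega)]
      simp
    · rw [hrels, hbs (d + 1 - (i + 1)) i (by omega)]
      ring
  refine ⟨a', b', fun i => ?_, fun i => ?_, ⟨?_, fun i hi => ?_⟩, ⟨?_, fun i hi => ?_⟩, ?_⟩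
  · rw [ha']
    positivity
  · rw [hb']
    positivity
  · refine (Polynomial.degree_le_iff_coeff_zero _ _).2 fun n hn => ?_
    have hn : d + 1 < n := by exact_mod_cast hn
    rw [ha', hoz n hn, hbz n (by omega)]
    rfl
  · rw [ha', ha', hsymm i hi]
  · refine (Polynomial.degree_le_iff_coeff_zero _ _).2 fun n hn => ?_
    have hn : d < n := by exact_mod_cast hn
    rw [hb', hbz n hn]
    rfl
  · rw [hb', hb', hbs i (d - i) (by omega)]
  · rw [hopen, hho]
    ext n
    simp [ha', hb']
end

section
/- Let r be a partial order on {1,…,d} with order polytope O_r ⊆ ℝ^d. Then there exist polynomials a, b ∈ ℤ[z] with a symmetric with respect to degree d+1 and b symmetric with respect to degree d, such that b has nonnegative coefficients, −a has nonnegative coefficients, and (1−z)^{d+1} · Σ_{n≥1} L°_{O_r}(n) z^n = a(z) + z·b(z) as formal power series over ℤ. -/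
open scoped Pointwise

/-- Sequences `0 = g₀, g₁, …, gₘ ≤ N` whose `i`-th step is at least `t i`. -/
def chains {m : ℕ} (t : Fin m → ℕ) (N : ℕ) : Set (Fin (m + 1) → ℕ) :=
  {g | g 0 = 0 ∧ (∀ i, g i.castSucc + t i ≤ g i.succ) ∧ g (Fin.last m) ≤ N}

theorem le_of_mem_chains {m : ℕ} {t : Fin m → ℕ} {N : ℕ} {g : Fin (m + 1) → ℕ}
    (hg : g ∈ chains t N) (i : Fin (m + 1)) : g i ≤ N :=
  ((Fin.monotone_iff_le_succ.2 fun i => (Nat.le_add_right _ _).trans (hg.2.1 i))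
    (Fin.le_last i)).trans hg.2.2

theorem finite_setOf_le {E : Type*} [Finite E] (N : ℕ) : {f : E → ℕ | ∀ e, f e ≤ N}.Finite := by
  simpa [Set.pi] using Set.Finite.pi' (fun _ : E => Set.finite_Iic N)

theorem ncard_biUnion_finset {ι α : Type*} {t : Finset ι} {s : ι → Set α}
    (hs : ∀ i, (s i).Finite)
    (hd : ∀ i ∈ t, ∀ j ∈ t, i ≠ j → Disjoint (s i) (s j)) :
    (⋃ i ∈ t, s i).ncard = ∑ i ∈ t, (s i).ncard := by
  have := t.finite_toSet.ncard_biUnion (s := s) (fun i _ => hs i)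
    fun i hi j hj hne => hd i hi j hj hne
  rw [finsum_mem_coe_finset] at this
  simpa using this

theorem finite_chains {m : ℕ} (t : Fin m → ℕ) (N : ℕ) : (chains t N).Finite :=
  (finite_setOf_le N).subset fun _ hg => le_of_mem_chains hg

theorem ncard_chains_last_eq {m : ℕ} (t : Fin (m + 1) → ℕ) (N : ℕ) :
    {g ∈ chains t N | g (Fin.last (m + 1)) = N}.ncard =
      if t (Fin.last m) ≤ N then
        (chains (fun i : Fin m => t i.castSucc) (N - t (Fin.last m))).ncard else 0 := by
  split_ifs with h
  · refine Set.ncard_congr (fun g _ => fun i => g i.castSucc) ?_ ?_ ?_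
    · rintro g ⟨⟨h0, h1, h2⟩, h3⟩
      refine ⟨h0, fun i => ?_, ?_⟩
      · simpa using h1 i.castSucc
      · have := h1 (Fin.last m)
        rw [Fin.succ_last, h3] at this
        show g (Fin.last m).castSucc ≤ _
        omega
    · rintro g g' ⟨-, h3⟩ ⟨-, h3'⟩ heq
      ext i
      induction i using Fin.lastCases with
      | last => rw [h3, h3']
      | cast i => exact congrFun heq i
    · rintro g ⟨h0, h1, h2⟩
      refine ⟨Fin.snoc (α := fun _ => ℕ) g N, ⟨⟨?_, fun i => ?_, ?_⟩, ?_⟩, ?_⟩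
      · rw [← Fin.castSucc_zero, Fin.snoc_castSucc, h0]
      · induction i using Fin.lastCases with
        | last =>
          rw [Fin.snoc_castSucc, Fin.succ_last, Fin.snoc_last]
          omega
        | cast i =>
          rw [Fin.snoc_castSucc, Fin.succ_castSucc, Fin.snoc_castSucc]
          exact h1 i
      · simp
      · simp
      · ext i
        simp
  · rw [Set.ncard_eq_zero (((finite_chains t N)).subset fun _ h => h.1)]
    ext g
    simp only [Set.mem_ofPred_eq, Set.mem_empty_iff_false, iff_false, not_and]
    rintro ⟨h0, h1, h2⟩ h3
    have := h1 (Fin.last m)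
    rw [Fin.succ_last, h3] at this
    omega

theorem ncard_chains_succ {m : ℕ} (t : Fin m → ℕ) (N : ℕ) :
    (chains t (N + 1)).ncard =
      (chains t N).ncard + {g ∈ chains t (N + 1) | g (Fin.last m) = N + 1}.ncard := by
  rw [← Set.ncard_union_eq _ (finite_chains t N)
    ((finite_chains t (N + 1)).subset fun _ h => h.1)]
  · congr 1
    ext g
    simp only [chains, Set.mem_union, Set.mem_ofPred_eq]
    grind
  · rw [Set.disjoint_left]
    rintro g ⟨_, _, h⟩ ⟨-, h'⟩
    omega

theorem genFun_chains {m : ℕ} (t : Fin m → ℕ) :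
    (1 - PowerSeries.X) ^ (m + 1) * PowerSeries.mk (fun N => ((chains t N).ncard : ℤ)) =
      PowerSeries.X ^ (∑ i, t i) := by
  induction m with
  | zero =>
    have h : ∀ N, (chains t N).ncard = 1 := fun N => by
      rw [Set.ncard_eq_one]
      refine ⟨fun _ => 0, ?_⟩
      ext g
      simp only [chains, Set.mem_ofPred_eq, Set.mem_singleton_iff]
      constructor
      · rintro ⟨h, -⟩
        ext i
        rw [Fin.fin_one_eq_zero i, h]
      · rintro rfl
        simp
    simp only [h, Nat.cast_one, Finset.univ_eq_empty, Finset.sum_empty, pow_zero, zero_add, pow_one]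
    rw [mul_comm]
    exact PowerSeries.mk_one_mul_one_sub_eq_one ℤ
  | succ m ih =>
    have key : (1 - PowerSeries.X) * PowerSeries.mk (fun N => ((chains t N).ncard : ℤ)) =
        PowerSeries.X ^ t (Fin.last m) *
          PowerSeries.mk (fun N => ((chains (fun i : Fin m => t i.castSucc) N).ncard : ℤ)) := by
      ext N
      rw [PowerSeries.coeff_X_pow_mul', sub_mul, one_mul, map_sub]
      have h := ncard_chains_last_eq t N
      cases N with
      | zero =>
        have h' : {g ∈ chains t 0 | g (Fin.last (m + 1)) = 0} = chains t 0 := by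
          ext g
          simp only [chains, Set.mem_ofPred_eq]
          grind
        rw [h'] at h
        simp [h]
      | succ N =>
        rw [PowerSeries.coeff_succ_X_mul]
        simp only [PowerSeries.coeff_mk, ncard_chains_succ t N, h]
        push_cast
        ring
    rw [pow_succ, mul_assoc, key, mul_left_comm, ih, ← pow_add, Fin.sum_univ_castSucc, add_comm]

/-- The pair `(f e, ω e)`, to be compared lexicographically. -/
def lexKey {E : Type*} (ω : E → ℤ) (f : E → ℕ) (e : E) : ℕ ×ₗ ℤ := toLex (f e, ω e)

theorem lexKey_lt {E : Type*} {ω : E → ℤ} {f : E → ℕ} {a b : E} :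
    lexKey ω f a < lexKey ω f b ↔ f a < f b ∨ f a = f b ∧ ω a < ω b := by
  simp [lexKey, Prod.Lex.toLex_lt_toLex]

theorem lexKey_le {E : Type*} {ω : E → ℤ} {f : E → ℕ} {a b : E} :
    lexKey ω f a ≤ lexKey ω f b ↔ f a < f b ∨ f a = f b ∧ ω a ≤ ω b := by
  simp [lexKey, Prod.Lex.toLex_le_toLex]

theorem lexKey_injective {E : Type*} {ω : E → ℤ} (hω : Function.Injective ω) (f : E → ℕ) :
    Function.Injective (lexKey ω f) := fun a b h => hω (by
  simpa [lexKey] using congrArg (fun p => (ofLex p).2) h)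

/-- Stanley's `(R, ω)`-partitions bounded by `N`, normalised to vanish at `e₀`: along `R` the
values increase weakly, and strictly wherever `ω` decreases. -/
def labelledMaps {E : Type*} (R : E → E → Prop) (ω : E → ℤ) (e₀ : E) (N : ℕ) : Set (E → ℕ) :=
  {f | f e₀ = 0 ∧ (∀ e, f e ≤ N) ∧ ∀ a b, R a b → lexKey ω f a ≤ lexKey ω f b}

/-- The linear extensions of `R`, as enumerations of the ground set. -/
def linExts {E : Type*} (R : E → E → Prop) (m : ℕ) : Set (Fin (m + 1) ≃ E) :=
  {σ | ∀ a b, R a b → σ.symm a ≤ σ.symm b}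

/-- The indicator of the descents of `ω ∘ σ`. -/
def descent {E : Type*} (ω : E → ℤ) {m : ℕ} (σ : Fin (m + 1) ≃ E) (i : Fin m) : ℕ :=
  if ω (σ i.castSucc) < ω (σ i.succ) then 0 else 1

/-- The maps bounded by `N` that are sorted by `σ`. -/
def sortedMaps {E : Type*} (ω : E → ℤ) {m : ℕ} (σ : Fin (m + 1) ≃ E) (N : ℕ) : Set (E → ℕ) :=
  {f | f (σ 0) = 0 ∧ StrictMono (lexKey ω f ∘ σ) ∧ f (σ (Fin.last m)) ≤ N}

theorem ncard_sortedMaps {E : Type*} (ω : E → ℤ) {m : ℕ} (σ : Fin (m + 1) ≃ E) (N : ℕ) :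
    (sortedMaps ω σ N).ncard = (chains (descent ω σ) N).ncard := by
  have key : ∀ f : E → ℕ, f ∈ sortedMaps ω σ N ↔ f ∘ σ ∈ chains (descent ω σ) N := fun f => by
    simp only [sortedMaps, chains, Set.mem_ofPred_eq, Fin.strictMono_iff_lt_succ,
      Function.comp_apply, lexKey_lt, descent]
    refine and_congr_right fun _ => and_congr_left fun _ => forall_congr' fun i => ?_
    split_ifs <;> omega
  refine Set.ncard_congr (fun f _ => f ∘ σ) (fun f hf => (key f).1 hf) ?_ ?_
  · intro f g _ _ h
    exact σ.surjective.injective_comp_right h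
  · intro g hg
    refine ⟨g ∘ σ.symm, (key _).2 ?_, ?_⟩
    · simpa [Function.comp_assoc] using hg
    · simp [Function.comp_assoc]

theorem exists_strictMono_comp {E α : Type*} [Fintype E] [LinearOrder α] {m : ℕ}
    (hE : Fintype.card E = m + 1) {k : E → α} (hk : Function.Injective k) :
    ∃ σ : Fin (m + 1) ≃ E, StrictMono (k ∘ σ) := by
  let e := (Fintype.equivFinOfCardEq hE).symm
  refine ⟨(Tuple.sort (k ∘ e)).trans e, ?_⟩
  exact (Tuple.monotone_sort (k ∘ e)).strictMono_of_injective
    (hk.comp ((Tuple.sort (k ∘ e)).trans e).injective)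

theorem labelledMaps_eq_iUnion {E : Type*} [Fintype E] {R : E → E → Prop} {ω : E → ℤ}
    (hω : Function.Injective ω) {e₀ : E} (hR : ∀ e, e ≠ e₀ → R e₀ e) {m : ℕ}
    (hE : Fintype.card E = m + 1) (N : ℕ) :
    labelledMaps R ω e₀ N = ⋃ σ ∈ linExts R m, sortedMaps ω σ N := by
  ext f
  simp only [Set.mem_iUnion, exists_prop]
  constructor
  · rintro ⟨h0, hN, hf⟩
    obtain ⟨σ, hσ⟩ := exists_strictMono_comp hE (lexKey_injective hω f)
    have hmem : σ ∈ linExts R m := fun a b hab => by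
      simpa using hσ.le_iff_le.1 (by simpa using hf a b hab : (lexKey ω f ∘ σ) (σ.symm a) ≤ _)
    refine ⟨σ, hmem, ?_, hσ, hN _⟩
    have : σ 0 = e₀ := by
      by_contra hne
      have := hmem _ _ (hR _ hne)
      rw [Equiv.symm_apply_apply, Fin.le_zero_iff, Equiv.symm_apply_eq] at this
      exact hne this.symm
    rw [this, h0]
  · rintro ⟨σ, hmem, h0, hσ, hN⟩
    have hmono : ∀ a b, σ.symm a ≤ σ.symm b → lexKey ω f a ≤ lexKey ω f b := fun a b hab => by
      simpa using hσ.monotone hab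
    have hmono' : ∀ a b, σ.symm a ≤ σ.symm b → f a ≤ f b := fun a b hab => by
      rcases lexKey_le.1 (hmono a b hab) with h | h
      exacts [h.le, h.1.le]
    refine ⟨?_, fun e => ?_, fun a b hab => hmono a b (hmem a b hab)⟩
    · by_cases h : σ 0 = e₀
      · rw [← h, h0]
      · have := hmono' _ _ (hmem _ _ (hR _ h))
        omega
    · exact (hmono' e (σ (Fin.last m)) (by simpa using Fin.le_last _)).trans hN

theorem finite_sortedMaps {E : Type*} {ω : E → ℤ} {m : ℕ}
    (σ : Fin (m + 1) ≃ E) (N : ℕ) : (sortedMaps ω σ N).Finite := by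
  have : Finite E := Finite.of_equiv _ σ
  refine (finite_setOf_le N).subset fun f hf e => ?_
  have h : lexKey ω f e ≤ lexKey ω f (σ (Fin.last m)) := by
    simpa using hf.2.1.monotone (Fin.le_last (σ.symm e))
  have := hf.2.2
  rcases lexKey_le.1 h with h | h <;> omega

theorem disjoint_sortedMaps {E : Type*} {ω : E → ℤ} {m : ℕ} {σ τ : Fin (m + 1) ≃ E}
    (h : σ ≠ τ) (hω : Function.Injective ω) (N : ℕ) :
    Disjoint (sortedMaps ω σ N) (sortedMaps ω τ N) := by
  rw [Set.disjoint_left]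
  rintro f ⟨_, hσ, _⟩ ⟨_, hτ, _⟩
  refine h (Equiv.ext fun i => lexKey_injective hω f ?_)
  exact congrFun ((StrictMono.range_inj hσ hτ).1 (by simp [Set.range_comp])) i

open Classical in
/-- The descent enumerator of the linear extensions of `R`. -/
noncomputable def descentPoly {E : Type*} [Fintype E] (R : E → E → Prop) (ω : E → ℤ) (m : ℕ) :
    Polynomial ℤ :=
  ∑ σ ∈ (linExts R m).toFinset, Polynomial.X ^ ∑ i, descent ω σ i

theorem genFun_labelledMaps {E : Type*} [Fintype E] {R : E → E → Prop} {ω : E → ℤ}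
    (hω : Function.Injective ω) {e₀ : E} (hR : ∀ e, e ≠ e₀ → R e₀ e) {m : ℕ}
    (hE : Fintype.card E = m + 1) :
    (1 - PowerSeries.X) ^ (m + 1) *
        PowerSeries.mk (fun N => ((labelledMaps R ω e₀ N).ncard : ℤ)) =
      (descentPoly R ω m : PowerSeries ℤ) := by
  classical
  have h : ∀ N, ((labelledMaps R ω e₀ N).ncard : ℤ) =
      ∑ σ ∈ (linExts R m).toFinset, ((chains (descent ω σ) N).ncard : ℤ) := fun N => by
    rw [labelledMaps_eq_iUnion hω hR hE, ← Nat.cast_sum]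
    congr 1
    have : (⋃ σ ∈ linExts R m, sortedMaps ω σ N) =
        ⋃ σ ∈ (linExts R m).toFinset, sortedMaps ω σ N := by simp
    rw [this, ncard_biUnion_finset (fun σ => finite_sortedMaps σ N)
      fun _ _ _ _ hne => disjoint_sortedMaps hne hω N]
    exact Finset.sum_congr rfl fun σ _ => ncard_sortedMaps ω σ N
  have h' : PowerSeries.mk (fun N => ((labelledMaps R ω e₀ N).ncard : ℤ)) =
      ∑ σ ∈ (linExts R m).toFinset,
        PowerSeries.mk (fun N => ((chains (descent ω σ) N).ncard : ℤ)) := by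
    ext N
    simp [h]
  rw [h', Finset.mul_sum, descentPoly]
  simp only [genFun_chains]
  rw [← Polynomial.coeToPowerSeries.ringHom_apply, map_sum]
  simp

theorem descentPoly_coeff_nonneg {E : Type*} [Fintype E] (R : E → E → Prop) (ω : E → ℤ) (m : ℕ)
    (i : ℕ) : 0 ≤ (descentPoly R ω m).coeff i := by
  rw [descentPoly, Polynomial.finsetSum_coeff]
  refine Finset.sum_nonneg fun σ _ => ?_
  rw [Polynomial.coeff_X_pow]
  split_ifs <;> simp

theorem sum_descent_neg {E : Type*} {ω : E → ℤ} (hω : Function.Injective ω) {m : ℕ}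
    (σ : Fin (m + 1) ≃ E) : ∑ i, descent ω σ i + ∑ i, descent (-ω) σ i = m := by
  rw [← Finset.sum_add_distrib]
  have : ∀ i : Fin m, descent ω σ i + descent (-ω) σ i = 1 := fun i => by
    have : ω (σ i.castSucc) ≠ ω (σ i.succ) := fun h =>
      (Fin.castSucc_lt_succ (i := i)).ne (σ.injective (hω h))
    simp only [descent, Pi.neg_apply]
    split_ifs <;> omega
  simp [this]

theorem descentPoly_coeff_neg {E : Type*} [Fintype E] (R : E → E → Prop) {ω : E → ℤ}
    (hω : Function.Injective ω) {m i j : ℕ} (hij : i + j = m) :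
    (descentPoly R (-ω) m).coeff i = (descentPoly R ω m).coeff j := by
  simp only [descentPoly, Polynomial.finsetSum_coeff, Polynomial.coeff_X_pow]
  refine Finset.sum_congr rfl fun σ _ => ?_
  have := sum_descent_neg hω σ
  split_ifs <;> omega

theorem descentPoly_coeff_eq_zero {E : Type*} [Fintype E] (R : E → E → Prop) (ω : E → ℤ)
    {m i : ℕ} (hi : m < i) : (descentPoly R ω m).coeff i = 0 := by
  simp only [descentPoly, Polynomial.finsetSum_coeff, Polynomial.coeff_X_pow]
  refine Finset.sum_eq_zero fun σ _ => if_neg ?_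
  have : ∑ i, descent ω σ i ≤ ∑ _i : Fin m, 1 :=
    Finset.sum_le_sum fun i _ => by unfold descent; split_ifs <;> simp
  simp at this
  omega

theorem mem_labelledMaps_of_strictMono {E : Type*} [PartialOrder E] [OrderBot E] {l : E → ℤ}
    (hl : StrictMono l) {N : ℕ} {f : E → ℕ} :
    f ∈ labelledMaps (· < ·) l ⊥ N ↔ f ⊥ = 0 ∧ (∀ e, f e ≤ N) ∧ Monotone f := by
  refine and_congr_right fun _ => and_congr_right fun _ => ?_
  rw [monotone_iff_forall_lt]
  refine forall_congr' fun a => forall_congr' fun b => forall_congr' fun hab => ?_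
  have := hl hab
  rw [lexKey_le]
  omega

theorem mem_labelledMaps_neg {E : Type*} [PartialOrder E] [OrderBot E] {l : E → ℤ}
    (hl : StrictMono l) {N : ℕ} {f : E → ℕ} :
    f ∈ labelledMaps (· < ·) (-l) ⊥ N ↔ f ⊥ = 0 ∧ (∀ e, f e ≤ N) ∧ StrictMono f := by
  refine and_congr_right fun _ => and_congr_right fun _ => ?_
  refine forall_congr' fun a => forall_congr' fun b => forall_congr' fun hab => ?_
  have := hl hab
  rw [lexKey_le, Pi.neg_apply, Pi.neg_apply]
  omega

/-- Order preserving maps whose lexicographically last tied pair `i < j`, comparing first the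
labels of `j` and then those of `i`, is `x < y`. -/
def tiedMaps {E : Type*} [PartialOrder E] [OrderBot E] (l : E → ℤ) (x y : E) (N : ℕ) :
    Set (E → ℕ) :=
  {f | f ⊥ = 0 ∧ (∀ e, f e ≤ N) ∧ f x = f y ∧ ∀ i j, i < j →
    f i < f j ∨ f i = f j ∧ (l j < l y ∨ l j = l y ∧ l i ≤ l x)}

open Classical in
/-- The map identifying `y` with `x`. -/
noncomputable def collapse {E : Type*} {x y : E} (h : x ≠ y) (e : E) : {e // e ≠ y} :=
  if he : e = y then ⟨x, h⟩ else ⟨e, he⟩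

/-- The image of the strict order under `collapse`. -/
def collapseRel {E : Type*} [PartialOrder E] {x y : E} (h : x ≠ y) (a b : {e // e ≠ y}) : Prop :=
  ∃ i j, i < j ∧ collapse h i = a ∧ collapse h j = b

/-- The labels after moving those above `y` to the bottom, in reversed order. -/
def collapseLabel {E : Type*} (l : E → ℤ) (y : E) (e : {e // e ≠ y}) : ℤ :=
  if l y < l e then -l e else l e

theorem collapse_self {E : Type*} {x y : E} (h : x ≠ y) : collapse h y = ⟨x, h⟩ := by
  simp [collapse]

theorem collapse_of_ne {E : Type*} {x y : E} (h : x ≠ y) {e : E} (he : e ≠ y) :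
    collapse h e = ⟨e, he⟩ := by
  simp [collapse, he]

theorem collapse_surjective {E : Type*} {x y : E} (h : x ≠ y) :
    Function.Surjective (collapse h) := fun e => ⟨e, collapse_of_ne h e.2⟩

theorem collapseLabel_injective {E : Type*} {l : E → ℤ} (hl : Function.Injective l)
    (hl0 : ∀ e, 0 ≤ l e) (y : E) : Function.Injective (collapseLabel l y) := fun a b hab => by
  have ha := hl0 a
  have hb := hl0 b
  have hy := hl0 y
  refine Subtype.ext (hl ?_)
  unfold collapseLabel at hab
  split_ifs at hab <;> omega

theorem collapseLabel_collapse_le {E : Type*} [PartialOrder E] {l : E → ℤ}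
    (hl : Function.Injective l) (hmono : StrictMono l) (hl0 : ∀ e, 0 ≤ l e) {x y : E}
    (hxy : x < y) {i j : E} (hij : i < j) :
    collapseLabel l y (collapse hxy.ne i) ≤ collapseLabel l y (collapse hxy.ne j) ↔
      l j < l y ∨ l j = l y ∧ l i ≤ l x := by
  have h1 := hmono hxy
  have h2 := hmono hij
  have h3 := hl0 i
  have h4 := hl0 x
  by_cases hj : j = y
  · subst hj
    rw [collapse_self, collapse_of_ne hxy.ne hij.ne]
    simp [collapseLabel, h1.not_gt, h2.not_gt]
  · have hj' : l j ≠ l y := fun h => hj (hl h)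
    rw [collapse_of_ne hxy.ne hj]
    by_cases hi : i = y
    · subst hi
      rw [collapse_self]
      simp only [collapseLabel]
      split_ifs <;> omega
    · rw [collapse_of_ne hxy.ne hi]
      simp only [collapseLabel]
      split_ifs <;> omega

theorem comp_collapse_mem_tiedMaps {E : Type*} [PartialOrder E] [OrderBot E] {l : E → ℤ}
    (hl : Function.Injective l) (hmono : StrictMono l) (hl0 : ∀ e, 0 ≤ l e) {x y : E}
    (hxy : x < y) {N : ℕ} {g : {e // e ≠ y} → ℕ} :
    g ∘ collapse hxy.ne ∈ tiedMaps l x y N ↔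
      g ∈ labelledMaps (collapseRel hxy.ne) (collapseLabel l y) ⟨⊥, hxy.bot_lt.ne⟩ N := by
  simp only [tiedMaps, labelledMaps, Set.mem_ofPred_eq, Function.comp_apply]
  rw [collapse_of_ne hxy.ne hxy.bot_lt.ne, (collapse_surjective hxy.ne).forall]
  refine and_congr_right fun _ => and_congr_right fun _ => ?_
  rw [and_iff_right (by rw [collapse_self, collapse_of_ne hxy.ne hxy.ne])]
  constructor
  · rintro h _ _ ⟨i, j, hij, rfl, rfl⟩
    rw [lexKey_le, collapseLabel_collapse_le hl hmono hl0 hxy hij]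
    exact h i j hij
  · intro h i j hij
    have := h _ _ ⟨i, j, hij, rfl, rfl⟩
    rwa [lexKey_le, collapseLabel_collapse_le hl hmono hl0 hxy hij] at this

theorem ncard_tiedMaps {E : Type*} [PartialOrder E] [OrderBot E] {l : E → ℤ}
    (hl : Function.Injective l) (hmono : StrictMono l) (hl0 : ∀ e, 0 ≤ l e) {x y : E}
    (hxy : x < y) (N : ℕ) :
    (tiedMaps l x y N).ncard =
      (labelledMaps (collapseRel hxy.ne) (collapseLabel l y) ⟨⊥, hxy.bot_lt.ne⟩ N).ncard := by
  have : tiedMaps l x y N = (· ∘ collapse hxy.ne) ''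
      labelledMaps (collapseRel hxy.ne) (collapseLabel l y) ⟨⊥, hxy.bot_lt.ne⟩ N := by
    ext f
    constructor
    · intro hf
      have hfc : (fun e : {e // e ≠ y} => f e) ∘ collapse hxy.ne = f := by
        ext e
        by_cases he : e = y
        · subst he
          simpa [collapse_self] using hf.2.2.1
        · simp [collapse_of_ne hxy.ne he]
      exact ⟨_, (comp_collapse_mem_tiedMaps hl hmono hl0 hxy).1 (hfc.symm ▸ hf), hfc⟩
    · rintro ⟨g, hg, rfl⟩
      exact (comp_collapse_mem_tiedMaps hl hmono hl0 hxy).2 hg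
  rw [this, Set.ncard_image_of_injective _ (collapse_surjective _).injective_comp_right]

theorem genFun_tiedMaps {E : Type*} [Fintype E] [PartialOrder E] [OrderBot E] {l : E → ℤ}
    (hl : Function.Injective l) (hmono : StrictMono l) (hl0 : ∀ e, 0 ≤ l e) {m : ℕ}
    (hE : Fintype.card E = m + 1) {x y : E} (hxy : x < y) :
    ∃ q : Polynomial ℤ, (∀ i, 0 ≤ q.coeff i) ∧
      (1 - PowerSeries.X) ^ m * PowerSeries.mk (fun N => ((tiedMaps l x y N).ncard : ℤ)) =
        (q : PowerSeries ℤ) := by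
  classical
  have hcard : Fintype.card {e // e ≠ y} = m := by
    rw [Fintype.card_subtype_compl, Fintype.card_subtype_eq, hE, Nat.add_sub_cancel]
  obtain ⟨k, rfl⟩ : ∃ k, m = k + 1 := by
    have : 0 < Fintype.card {e // e ≠ y} := Fintype.card_pos_iff.2 ⟨⟨x, hxy.ne⟩⟩
    exact ⟨m - 1, by omega⟩
  refine ⟨descentPoly (collapseRel hxy.ne) (collapseLabel l y) k,
    descentPoly_coeff_nonneg _ _ _, ?_⟩
  simp only [ncard_tiedMaps hl hmono hl0 hxy]
  refine genFun_labelledMaps (collapseLabel_injective hl hl0 y) (fun e he => ?_) hcard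
  exact ⟨⊥, e, bot_lt_iff_ne_bot.2 fun h => he (Subtype.ext h), collapse_of_ne _ _,
    collapse_of_ne _ e.2⟩

open Classical in
theorem ncard_labelledMaps_eq_add_sum {E : Type*} [Fintype E] [PartialOrder E] [OrderBot E]
    {l : E → ℤ} (hl : Function.Injective l) (hmono : StrictMono l) (N : ℕ) :
    (labelledMaps (· < ·) l (⊥ : E) N).ncard =
      (labelledMaps (· < ·) (-l) (⊥ : E) N).ncard +
        ∑ p : E × E with p.1 < p.2, (tiedMaps l p.1 p.2 N).ncard := by
  have hfin : ∀ p : E × E, (tiedMaps l p.1 p.2 N).Finite := fun p =>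
    (finite_setOf_le N).subset fun f hf => hf.2.1
  have hfin' : (⋃ p ∈ ({p | p.1 < p.2} : Finset (E × E)), tiedMaps l p.1 p.2 N).Finite :=
    Set.Finite.biUnion (Finset.finite_toSet _) fun p _ => hfin p
  rw [← ncard_biUnion_finset hfin, ← Set.ncard_union_eq _
    ((finite_setOf_le N).subset fun f hf => hf.2.1) hfin']
  · congr 1
    ext f
    simp only [Set.mem_union, mem_labelledMaps_of_strictMono hmono, mem_labelledMaps_neg hmono,
      Set.mem_iUnion, Finset.mem_filter, Finset.mem_univ, true_and, exists_prop]
    constructor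
    · rintro ⟨h0, hN, hf⟩
      let B : Finset (E × E) := {p | p.1 < p.2 ∧ f p.1 = f p.2}
      rcases B.eq_empty_or_nonempty with hB | hB
      · refine Or.inl ⟨h0, hN, fun i j hij => (hf hij.le).lt_of_ne fun h => ?_⟩
        have : (i, j) ∈ B := by simp [B, hij, h]
        simp [hB] at this
      · obtain ⟨p, hp, hmax⟩ := B.exists_max_image (fun p => toLex (l p.2, l p.1)) hB
        simp only [B, Finset.mem_filter, Finset.mem_univ, true_and] at hp
        refine Or.inr ⟨p, hp.1, h0, hN, hp.2, fun i j hij => ?_⟩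
        rcases (hf hij.le).lt_or_eq with h | h
        · exact Or.inl h
        · have := hmax (i, j) (by simp [B, hij, h])
          rw [Prod.Lex.toLex_le_toLex] at this
          exact Or.inr ⟨h, this⟩
    · rintro (⟨h0, hN, hf⟩ | ⟨p, -, h0, hN, -, hf⟩)
      · exact ⟨h0, hN, hf.monotone⟩
      · refine ⟨h0, hN, monotone_iff_forall_lt.2 fun i j hij => ?_⟩
        rcases hf i j hij with h | h
        exacts [h.le, h.1.le]
  · rw [Set.disjoint_left]
    intro f hf hf'
    simp only [Set.mem_iUnion, Finset.mem_filter, Finset.mem_univ, true_and, exists_prop] at hf'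
    obtain ⟨p, hp, hfp⟩ := hf'
    exact (((mem_labelledMaps_neg hmono).1 hf).2.2 hp).ne hfp.2.2.1
  · intro p hp p' hp' hne
    simp only [Finset.mem_filter, Finset.mem_univ, true_and] at hp hp'
    rw [Set.disjoint_left]
    intro f hf hf'
    have h1 := hf.2.2.2 _ _ hp'
    have h2 := hf'.2.2.2 _ _ hp
    have h3 := hf.2.2.1
    have h4 := hf'.2.2.1
    exact hne (Prod.ext (hl (by omega)) (hl (by omega)))

theorem exists_injective_strictMono_nonneg (E : Type*) [Fintype E] [PartialOrder E] :
    ∃ l : E → ℤ, Function.Injective l ∧ StrictMono l ∧ ∀ e, 0 ≤ l e := by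
  let : Fintype (LinearExtension E) := inferInstanceAs (Fintype E)
  let e := (Fintype.orderIsoFinOfCardEq (LinearExtension E) rfl).symm
  have hinj : Function.Injective fun x : E => ((e (toLinearExtension x) : ℕ) : ℤ) := fun x y h =>
    e.injective (Fin.ext (Int.ofNat_inj.1 h))
  refine ⟨_, hinj, Monotone.strictMono_of_injective (fun x y h => ?_) hinj, fun x => by simp⟩
  simpa using toLinearExtension.monotone h

theorem symm_of_succ_sub_eq {u h : ℕ → ℤ} {d M : ℕ} (h0 : u 0 = 0)
    (hle : ∀ i ≤ d, u (i + 1) - u i = h i - h (d - i)) (hgt : ∀ i, d < i → u (i + 1) = u i)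
    (hM : ∀ i, M < i → u i = 0) :
    (∀ i ≤ d + 1, u i = u (d + 1 - i)) ∧ ∀ i, d < i → u i = 0 := by
  have hconst : ∀ k, u (d + 1 + k) = u (d + 1) := fun k => by
    induction k with
    | zero => rfl
    | succ k ih => rw [← ih, ← add_assoc, hgt _ (by omega)]
  have hzero : ∀ i, d < i → u i = 0 := fun i hi => by
    obtain ⟨k, rfl⟩ := Nat.exists_eq_add_of_le hi
    have h1 := hconst k
    have h2 := hconst (M + 1)
    rw [hM (d + 1 + (M + 1)) (by omega)] at h2
    rw [Nat.succ_eq_add_one, h1, h2]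
  refine ⟨fun i hi => ?_, hzero⟩
  induction i with
  | zero => rw [h0, hzero _ (by omega)]
  | succ i ih =>
    have h1 := ih (by omega)
    have h2 := hle i (by omega)
    have h3 := hle (d - i) (by omega)
    rw [show d - (d - i) = i by omega, show d - i + 1 = d + 1 - i by omega] at h3
    rw [show d + 1 - (i + 1) = d - i by omega]
    linarith

theorem exists_decomposition_strictMono {E : Type*} [Fintype E] [PartialOrder E] [OrderBot E]
    {d : ℕ} (hE : Fintype.card E = d + 1) :
    ∃ a b : Polynomial ℤ,
      SymmetricWrt a (d + 1) ∧ SymmetricWrt b d ∧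
      (∀ i, 0 ≤ b.coeff i) ∧ (∀ i, 0 ≤ (-a).coeff i) ∧
      (1 - PowerSeries.X) ^ (d + 1) *
          PowerSeries.mk (fun n => if n = 0 then 0 else
            ({f : E → ℕ | f ⊥ = 0 ∧ (∀ e, f e ≤ n - 1) ∧ StrictMono f}.ncard : ℤ)) =
        (a : PowerSeries ℤ) + PowerSeries.X * (b : PowerSeries ℤ) := by
  classical
  obtain ⟨l, hl, hmono, hl0⟩ := exists_injective_strictMono_nonneg E
  have hl' : Function.Injective (-l) := neg_injective.comp hl
  have hbot : ∀ e : E, e ≠ ⊥ → ⊥ < e := fun e he => bot_lt_iff_ne_bot.2 he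
  have hweak := genFun_labelledMaps hl hbot hE
  have hstrict := genFun_labelledMaps hl' hbot hE
  set W := descentPoly (fun a b : E => a < b) l d with hW
  set S := descentPoly (fun a b : E => a < b) (-l) d with hS
  have htied : ∀ p : E × E, ∃ q : Polynomial ℤ, (∀ i, 0 ≤ q.coeff i) ∧ (p.1 < p.2 →
      (1 - PowerSeries.X) ^ d * PowerSeries.mk (fun N => ((tiedMaps l p.1 p.2 N).ncard : ℤ)) =
        (q : PowerSeries ℤ)) := fun p => by
    by_cases hp : p.1 < p.2
    · obtain ⟨q, hq, h⟩ := genFun_tiedMaps hl hmono hl0 hE hp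
      exact ⟨q, hq, fun _ => h⟩
    · exact ⟨0, by simp, fun h => absurd h hp⟩
  choose q hq0 hq using htied
  set Q : Polynomial ℤ := ∑ p : E × E with p.1 < p.2, q p with hQ
  have hQ0 : ∀ i, 0 ≤ Q.coeff i := fun i => by
    rw [hQ, Polynomial.finsetSum_coeff]
    exact Finset.sum_nonneg fun p _ => hq0 p i
  have hQcoe : (Q : PowerSeries ℤ) = (1 - PowerSeries.X) ^ d *
      ∑ p : E × E with p.1 < p.2,
        PowerSeries.mk (fun N => ((tiedMaps l p.1 p.2 N).ncard : ℤ)) := by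
    rw [hQ, ← Polynomial.coeToPowerSeries.ringHom_apply, map_sum, Finset.mul_sum]
    refine Finset.sum_congr rfl fun p hp => ?_
    rw [hq p (Finset.mem_filter.1 hp).2, Polynomial.coeToPowerSeries.ringHom_apply]
  have hsplit : PowerSeries.mk (fun N => ((labelledMaps (· < ·) l (⊥ : E) N).ncard : ℤ)) =
      PowerSeries.mk (fun N => ((labelledMaps (· < ·) (-l) (⊥ : E) N).ncard : ℤ)) +
        ∑ p : E × E with p.1 < p.2,
          PowerSeries.mk (fun N => ((tiedMaps l p.1 p.2 N).ncard : ℤ)) := by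
    ext N
    simp [ncard_labelledMaps_eq_add_sum hl hmono N]
  have hWS : (W : PowerSeries ℤ) = (S : PowerSeries ℤ) + (1 - PowerSeries.X) * (Q : PowerSeries ℤ) := by
    rw [← hweak, ← hstrict, hQcoe, hsplit]
    ring
  have hWS' : W = S + (1 - Polynomial.X) * Q := by
    apply Polynomial.coe_injective
    push_cast
    exact hWS
  have hstep : ∀ i, (Polynomial.X * Q).coeff (i + 1) - (Polynomial.X * Q).coeff i =
      W.coeff i - S.coeff i := fun i => by
    rw [hWS', sub_mul, one_mul, Polynomial.coeff_add, Polynomial.coeff_sub,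
      Polynomial.coeff_X_mul]
    ring
  have hSW : ∀ i ≤ d, S.coeff i = W.coeff (d - i) := fun i hi =>
    descentPoly_coeff_neg _ hl (by omega)
  obtain ⟨hsymm, hzero⟩ := symm_of_succ_sub_eq (u := (Polynomial.X * Q).coeff) (h := W.coeff)
    (d := d) (M := (Polynomial.X * Q).natDegree) (by simp)
    (fun i hi => by rw [hstep, hSW i hi])
    (fun i hi => by
      rw [← sub_eq_zero, hstep, hW, hS, descentPoly_coeff_eq_zero _ _ hi,
        descentPoly_coeff_eq_zero _ _ hi, sub_zero])
    (fun i hi => Polynomial.coeff_eq_zero_of_natDegree_lt hi)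
  have hXQ0 : ∀ i, 0 ≤ (Polynomial.X * Q).coeff i := fun i => by
    cases i with
    | zero => simp
    | succ i => rw [Polynomial.coeff_X_mul]; exact hQ0 i
  refine ⟨-(Polynomial.X * Q), W + Polynomial.X * Q, ⟨?_, fun i hi => ?_⟩,
    ⟨?_, fun i hi => ?_⟩, fun i => ?_, fun i => ?_, ?_⟩
  · rw [Polynomial.degree_le_iff_coeff_zero]
    intro i hi
    rw [Polynomial.coeff_neg, hzero i (by have := Nat.cast_lt.1 hi; omega), neg_zero]
  · rw [Polynomial.coeff_neg, Polynomial.coeff_neg, hsymm i hi]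
  · rw [Polynomial.degree_le_iff_coeff_zero]
    intro i hi
    have hi := Nat.cast_lt.1 hi
    rw [Polynomial.coeff_add, hzero i hi, hW, descentPoly_coeff_eq_zero _ _ hi, add_zero]
  · have h1 := hstep i
    have h2 := hsymm (i + 1) (by omega)
    rw [hSW i hi] at h1
    rw [show d + 1 - (i + 1) = d - i by omega] at h2
    rw [Polynomial.coeff_add, Polynomial.coeff_add]
    linarith
  · rw [Polynomial.coeff_add]
    exact add_nonneg (descentPoly_coeff_nonneg _ _ _ _) (hXQ0 i)
  · rw [neg_neg]
    exact hXQ0 i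
  · have hshift : PowerSeries.mk (fun n => if n = 0 then 0 else
        ({f : E → ℕ | f ⊥ = 0 ∧ (∀ e, f e ≤ n - 1) ∧ StrictMono f}.ncard : ℤ)) =
        PowerSeries.X *
          PowerSeries.mk (fun N => ((labelledMaps (· < ·) (-l) (⊥ : E) N).ncard : ℤ)) := by
      ext n
      cases n with
      | zero => simp
      | succ n =>
        rw [PowerSeries.coeff_succ_X_mul]
        simp only [PowerSeries.coeff_mk, Nat.add_one_ne_zero, if_false, Nat.add_sub_cancel]
        congr 2
        ext f
        exact (mem_labelledMaps_neg hmono).symm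
    rw [hshift, mul_left_comm, hstrict]
    push_cast
    rw [hWS]
    ring

theorem mem_interior_smul_orderPolytope {α : Type*} [Fintype α] [PartialOrder α] {n : ℝ}
    (hn : 0 < n) {x : α → ℝ} :
    x ∈ interior (n • {x : α → ℝ | (∀ i, 0 ≤ x i ∧ x i ≤ 1) ∧ ∀ i j, i ≤ j → x i ≤ x j}) ↔
      (∀ i, 0 < x i ∧ x i < n) ∧ ∀ i j, i < j → x i < x j := by
  classical
  have hset : n • {x : α → ℝ | (∀ i, 0 ≤ x i ∧ x i ≤ 1) ∧ ∀ i j, i ≤ j → x i ≤ x j} =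
      {x : α → ℝ | (∀ i, 0 ≤ x i ∧ x i ≤ n) ∧ ∀ i j, i ≤ j → x i ≤ x j} := by
    ext y
    rw [Set.mem_smul_set_iff_inv_smul_mem₀ hn.ne']
    simp only [Set.mem_ofPred_eq, Pi.smul_apply, smul_eq_mul]
    have hn' : 0 < n⁻¹ := inv_pos.2 hn
    refine and_congr (forall_congr' fun i => and_congr ?_ ?_) (forall_congr' fun i =>
      forall_congr' fun j => imp_congr_right fun _ => ?_)
    · exact mul_nonneg_iff_of_pos_left hn'
    · rw [inv_mul_le_iff₀ hn, mul_one]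
    · exact mul_le_mul_iff_right₀ hn'
  rw [hset]
  constructor
  · intro hx
    have hpert : ∀ i : α, ∃ δ > 0, ∀ s : ℝ, |s| < δ → x + Pi.single i s ∈
        {x : α → ℝ | (∀ i, 0 ≤ x i ∧ x i ≤ n) ∧ ∀ i j, i ≤ j → x i ≤ x j} := fun i => by
      have hc : Continuous fun s : ℝ => x + Pi.single i s :=
        continuous_const.add (continuous_single (A := fun _ : α => ℝ) i)
      have h := hc.continuousAt.preimage_mem_nhds (x := 0)
        (by simpa using mem_interior_iff_mem_nhds.1 hx)
      obtain ⟨δ, hδ, hball⟩ := Metric.mem_nhds_iff.1 h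
      exact ⟨δ, hδ, fun s hs => hball (by simpa using hs)⟩
    refine ⟨fun i => ?_, fun i j hij => ?_⟩
    · obtain ⟨δ, hδ, h⟩ := hpert i
      have h1 := ((h (-(δ / 2)) (by rw [abs_neg, abs_of_pos] <;> linarith)).1 i).1
      have h2 := ((h (δ / 2) (by rw [abs_of_pos] <;> linarith)).1 i).2
      rw [Pi.add_apply, Pi.single_eq_same] at h1 h2
      constructor <;> linarith
    · obtain ⟨δ, hδ, h⟩ := hpert i
      have h1 := (h (δ / 2) (by rw [abs_of_pos] <;> linarith)).2 i j hij.le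
      rw [Pi.add_apply, Pi.add_apply, Pi.single_eq_same, Pi.single_eq_of_ne hij.ne'] at h1
      linarith
  · intro hx
    have hopen : IsOpen {x : α → ℝ | (∀ i, 0 < x i ∧ x i < n) ∧ ∀ i j, i < j → x i < x j} := by
      simp only [Set.ofPred_and, Set.ofPred_forall]
      refine IsOpen.inter (isOpen_iInter_of_finite fun i => IsOpen.inter ?_ ?_)
        (isOpen_iInter_of_finite fun i => isOpen_iInter_of_finite fun j =>
          isOpen_iInter_of_finite fun _ => ?_)
      · exact isOpen_lt continuous_const (continuous_apply i)
      · exact isOpen_lt (continuous_apply i) continuous_const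
      · exact isOpen_lt (continuous_apply i) (continuous_apply j)
    refine interior_maximal ?_ hopen hx
    rintro y ⟨h1, h2⟩
    refine ⟨fun i => ⟨(h1 i).1.le, (h1 i).2.le⟩, fun i j hij => ?_⟩
    rcases hij.eq_or_lt with rfl | h
    exacts [le_rfl, (h2 _ _ h).le]

theorem ncard_interior_orderPolytope {α : Type*} [Fintype α] [PartialOrder α] {n : ℕ}
    (hn : n ≠ 0) :
    {x : α → ℤ | (fun i => (x i : ℝ)) ∈ interior ((n : ℝ) •
      {x : α → ℝ | (∀ i, 0 ≤ x i ∧ x i ≤ 1) ∧ ∀ i j, i ≤ j → x i ≤ x j})}.ncard =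
      {f : WithBot α → ℕ | f ⊥ = 0 ∧ (∀ e, f e ≤ n - 1) ∧ StrictMono f}.ncard := by
  have hn' : (0 : ℝ) < n := by positivity
  have hmem : ∀ x : α → ℤ, (fun i => (x i : ℝ)) ∈ interior ((n : ℝ) •
      {x : α → ℝ | (∀ i, 0 ≤ x i ∧ x i ≤ 1) ∧ ∀ i j, i ≤ j → x i ≤ x j}) ↔
      (∀ i, 0 < x i ∧ x i < n) ∧ ∀ i j, i < j → x i < x j := fun x => by
    rw [mem_interior_smul_orderPolytope hn']
    norm_cast
  simp only [hmem]
  symm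
  refine Set.ncard_congr (fun f _ => fun i : α => (f i : ℤ)) ?_ ?_ ?_
  · rintro f ⟨h0, hN, hf⟩
    refine ⟨fun i => ?_, fun i j hij => ?_⟩
    · have h1 := hf (WithBot.bot_lt_coe i)
      have h2 := hN i
      dsimp only
      constructor <;> omega
    · dsimp only
      exact_mod_cast hf (WithBot.coe_lt_coe.2 hij)
  · rintro f g ⟨h0, -⟩ ⟨h0', -⟩ h
    ext e
    induction e with
    | bot => rw [h0, h0']
    | coe i => exact_mod_cast congrFun h i
  · rintro x ⟨h1, h2⟩
    refine ⟨fun e => WithBot.recBotCoe 0 (fun i => (x i).toNat) e, ⟨rfl, fun e => ?_, ?_⟩, ?_⟩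
    · induction e with
      | bot => exact Nat.zero_le _
      | coe i =>
        have := h1 i
        show (x i).toNat ≤ _
        omega
    · intro a b hab
      induction b with
      | bot => exact absurd hab not_lt_bot
      | coe j =>
        have hj := h1 j
        induction a with
        | bot => show 0 < (x j).toNat; omega
        | coe i =>
          have := h2 i j (WithBot.coe_lt_coe.1 hab)
          show (x i).toNat < (x j).toNat
          omega
    · ext i
      exact Int.toNat_of_nonneg (h1 i).1.le

theorem exists_decomposition_orderPolytope {α : Type*} [Fintype α] [PartialOrder α] {d : ℕ}
    (hα : Fintype.card α = d) :
    ∃ a b : Polynomial ℤ,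
      SymmetricWrt a (d + 1) ∧ SymmetricWrt b d ∧
      (∀ i, 0 ≤ b.coeff i) ∧ (∀ i, 0 ≤ (-a).coeff i) ∧
      (1 - PowerSeries.X) ^ (d + 1) *
          PowerSeries.mk (fun n =>
            if n = 0 then 0 else
              (Set.ncard {x : α → ℤ | (fun i => (x i : ℝ)) ∈ interior ((n : ℝ) •
                {x : α → ℝ | (∀ i, 0 ≤ x i ∧ x i ≤ 1) ∧ ∀ i j, i ≤ j → x i ≤ x j})} : ℤ)) =
        (a : PowerSeries ℤ) + PowerSeries.X * (b : PowerSeries ℤ) := by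
  let : Fintype (WithBot α) := inferInstanceAs (Fintype (Option α))
  have hcard : Fintype.card (WithBot α) = d + 1 := by
    rw [← hα]
    exact Fintype.card_option
  obtain ⟨a, b, ha, hb, hb0, ha0, h⟩ := exists_decomposition_strictMono hcard
  refine ⟨a, b, ha, hb, hb0, ha0, ?_⟩
  rw [← h]
  congr 2
  ext n
  split_ifs with hn
  · rfl
  · rw [ncard_interior_orderPolytope hn]

/-- **Theorem.** For the order polytope `O_r ⊆ ℝ^d` of a partial order `r` on `{1,…,d}`,
the numerator polynomial of the Ehrhart series of the open polytope `O_r°` decomposes as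
`a(z) + z·b(z)` where `a` is symmetric with respect to degree `d+1`, `b` is symmetric
with respect to degree `d`, `b` has nonnegative coefficients and `-a` has nonnegative
coefficients. -/
theorem open_order_polytope_decomposition (d : ℕ) (r : Fin d → Fin d → Prop)
    (hr : IsPartialOrder (Fin d) r)
    (O : Set (Fin d → ℝ))
    (hO : O = {x : Fin d → ℝ |
      (∀ i, 0 ≤ x i ∧ x i ≤ 1) ∧ ∀ i j, r i j → x i ≤ x j}) :
    ∃ a b : Polynomial ℤ,
      SymmetricWrt a (d + 1) ∧ SymmetricWrt b d ∧
      (∀ i, 0 ≤ b.coeff i) ∧ (∀ i, 0 ≤ (-a).coeff i) ∧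
      (1 - PowerSeries.X) ^ (d + 1) *
          PowerSeries.mk (fun n =>
            if n = 0 then 0 else
              (Set.ncard {x : Fin d → ℤ |
                (fun i => (x i : ℝ)) ∈ interior ((n : ℝ) • O)} : ℤ)) =
        (a : PowerSeries ℤ) + PowerSeries.X * (b : PowerSeries ℤ) := by
  subst hO
  let : PartialOrder (Fin d) :=
    { le := r
      lt := fun a b => r a b ∧ ¬ r b a
      le_refl := hr.refl
      le_trans := hr.trans
      le_antisymm := hr.antisymm }
  exact exists_decomposition_orderPolytope (Fintype.card_fin d)
end

section
/- Let G be a finite simple graph on d vertices. Then there exist polynomials h, a, b ∈ ℤ[z] such that (1−z)^{d+1} · Σ_{n≥0} χ_G(n) z^n = h(z) as formal power series over ℤ, z·h(z) = a(z) + z·b(z), a is symmetric with respect to degree d+1, b is symmetric with respect to degree d, and both b and −a have nonnegative coefficients. -/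
section ChromaticNumerator

open Finset PowerSeries

/-- The functions `g : Fin d → {0, …, n - 1}` such that `i ↦ (g i, c i)` is strictly increasing in
the lexicographic order. -/
noncomputable def lexIncreasing (d : ℕ) (c : Fin d → ℤ) (n : ℕ) : Finset (Fin d → ℕ) :=
  open Classical in
  {g ∈ Fintype.piFinset fun _ => range n | StrictMono fun i => toLex (g i, c i)}

theorem mem_lexIncreasing {d : ℕ} {c : Fin d → ℤ} {n : ℕ} {g : Fin d → ℕ} :
    g ∈ lexIncreasing d c n ↔ (∀ i, g i < n) ∧ StrictMono fun i => toLex (g i, c i) := by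
  simp [lexIncreasing]

theorem card_lexIncreasing_last (d : ℕ) (c : Fin (d + 1) → ℤ) :
    ∃ ε ≤ 1, (d = 0 → ε = 0) ∧ ∀ n,
      #{g ∈ lexIncreasing (d + 1) c (n + 1) | g (Fin.last d) = n} =
        #(lexIncreasing d (Fin.init c) (n + ε)) := by
  obtain ⟨ε, hε, h0, hlt⟩ : ∃ ε ≤ 1, (d = 0 → ε = 0) ∧ ∀ (n : ℕ) (g : Fin d → ℕ),
      StrictMono (fun i => toLex (g i, Fin.init c i)) →
      ((∀ i, toLex (g i, Fin.init c i) < toLex (n, c (Fin.last d))) ↔ ∀ i, g i < n + ε) := by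
    cases d with
    | zero => exact ⟨0, by simp⟩
    | succ e =>
      refine ⟨if c (Fin.last e).castSucc < c (Fin.last (e + 1)) then 1 else 0,
        by split_ifs <;> simp, by simp, fun n g hg => ?_⟩
      have key : toLex (g (Fin.last e), Fin.init c (Fin.last e)) < toLex (n, c (Fin.last (e + 1))) ↔
          g (Fin.last e) < n + if c (Fin.last e).castSucc < c (Fin.last (e + 1)) then 1 else 0 := by
        rw [Prod.Lex.toLex_lt_toLex]
        simp only [Fin.init]
        split_ifs with h
        · simp [h]; omega
        · simp [h]
      refine ⟨fun h i => ?_, fun h i => ?_⟩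
      · have h1 : g i ≤ g (Fin.last e) := by
          have := hg.monotone (Fin.le_last i)
          rw [Prod.Lex.toLex_le_toLex] at this
          omega
        exact h1.trans_lt (key.1 (h _))
      · exact (hg.monotone (Fin.le_last i)).trans_lt (key.2 (h _))
  refine ⟨ε, hε, h0, fun n => ?_⟩
  refine card_bij' (fun g _ => Fin.init g) (fun g _ => Fin.snoc g n) ?_ ?_ ?_ ?_
  · intro g hg
    simp only [mem_filter, mem_lexIncreasing] at hg ⊢
    obtain ⟨⟨-, hm⟩, hl⟩ := hg
    have hm' : StrictMono fun i => toLex (Fin.init g i, Fin.init c i) :=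
      fun i j hij => hm (Fin.castSucc_lt_castSucc_iff.2 hij)
    refine ⟨(hlt n _ hm').1 fun i => ?_, hm'⟩
    have := hm (Fin.castSucc_lt_last i)
    simp only [hl] at this
    exact this
  · intro g hg
    simp only [mem_filter, mem_lexIncreasing, Fin.snoc_last, and_true] at hg ⊢
    obtain ⟨hb, hm⟩ := hg
    refine ⟨fun i => ?_, fun i j hij => ?_⟩
    · induction i using Fin.lastCases with
      | last => simp
      | cast i => have := hb i; simp only [Fin.snoc_castSucc]; omega
    · induction j using Fin.lastCases with
      | last =>
        induction i using Fin.lastCases with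
        | last => exact absurd hij (lt_irrefl _)
        | cast i => simpa [Fin.init] using (hlt n g hm).2 hb i
      | cast j =>
        induction i using Fin.lastCases with
        | last => exact absurd hij (Fin.castSucc_lt_last j).not_gt
        | cast i => simpa [Fin.init] using hm (Fin.castSucc_lt_castSucc_iff.1 hij)
  · intro g hg
    simp only [mem_filter] at hg
    rw [← hg.2]
    exact Fin.snoc_init_self g
  · intro g hg
    simp

theorem card_lexIncreasing_succ (d : ℕ) (c : Fin (d + 1) → ℤ) (n : ℕ) :
    #(lexIncreasing (d + 1) c (n + 1)) = #(lexIncreasing (d + 1) c n) +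
      #{g ∈ lexIncreasing (d + 1) c (n + 1) | g (Fin.last d) = n} := by
  rw [← card_filter_add_card_filter_not (fun g => g (Fin.last d) = n), add_comm]
  congr 2
  ext g
  simp only [mem_filter, mem_lexIncreasing]
  refine ⟨fun ⟨⟨h, hm⟩, hl⟩ => ⟨fun i => ?_, hm⟩, fun ⟨h, hm⟩ =>
    ⟨⟨fun i => (h i).trans n.lt_succ_self, hm⟩, (h _).ne⟩⟩
  have h1 := hm.monotone (Fin.le_last i)
  rw [Prod.Lex.toLex_le_toLex] at h1
  have h2 := h (Fin.last d)
  simp only at h1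
  omega

theorem lexIncreasing_zero (d : ℕ) (c : Fin (d + 1) → ℤ) : lexIncreasing (d + 1) c 0 = ∅ := by
  ext g; simp [mem_lexIncreasing]

theorem exists_pow_mul_lexIncreasing_series (d : ℕ) (c : Fin d → ℤ) :
    ∃ k ≤ d, (1 - X : ℤ⟦X⟧) ^ (d + 1) * .mk (fun n => (#(lexIncreasing d c n) : ℤ)) = X ^ k := by
  induction d with
  | zero =>
    refine ⟨0, le_rfl, ?_⟩
    have : ∀ n, #(lexIncreasing 0 c n) = 1 := fun n => by
      rw [card_eq_one]
      exact ⟨0, by ext g; simp [mem_lexIncreasing, Subsingleton.strictMono, eq_iff_true_of_subsingleton]⟩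
    simp only [this]
    rw [mul_comm]
    simpa using! PowerSeries.mk_one_mul_one_sub_eq_one ℤ
  | succ d ih =>
    obtain ⟨k, hk, ih⟩ := ih (Fin.init c)
    obtain ⟨ε, hε, h0, hcard⟩ := card_lexIncreasing_last d c
    set F : ℤ⟦X⟧ := .mk fun n => (#(lexIncreasing d (Fin.init c) n) : ℤ) with hF
    set F' : ℤ⟦X⟧ := .mk fun n => (#(lexIncreasing (d + 1) c n) : ℤ) with hF'
    have hrec : (1 - X) * F' = X * .mk fun n => (#(lexIncreasing d (Fin.init c) (n + ε)) : ℤ) := by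
      ext n
      cases n with
      | zero => simp [hF', lexIncreasing_zero]
      | succ n =>
        rw [sub_mul, one_mul, map_sub, coeff_succ_X_mul, coeff_succ_X_mul]
        simp [hF', card_lexIncreasing_succ d c n, hcard]
    obtain rfl | rfl : ε = 0 ∨ ε = 1 := by omega
    · refine ⟨k + 1, by omega, ?_⟩
      rw [pow_succ, mul_assoc, hrec, mul_left_comm]
      simp only [add_zero]
      rw [ih, pow_succ']
    · cases d with
      | zero => simp at h0
      | succ d =>
      refine ⟨k, by omega, ?_⟩
      have hshift : X * .mk (fun n => (#(lexIncreasing (d + 1) (Fin.init c) (n + 1)) : ℤ)) = F := by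
        ext n
        cases n with
        | zero => simp [hF, lexIncreasing_zero]
        | succ n => simp [hF]
      rw [pow_succ, mul_assoc, hrec, hshift, ih]

section Coloring

variable {V : Type*} [Fintype V]

/-- The proper colorings of `G` with colors `0, …, n - 1`. -/
noncomputable def properColorings (G : SimpleGraph V) (n : ℕ) : Finset (V → ℕ) :=
  open Classical in
  {f ∈ Fintype.piFinset fun _ => range n | ∀ u v, G.Adj u v → f u ≠ f v}

/-- The generating series of the chromatic polynomial of `G`. -/
noncomputable def chromaticSeries (G : SimpleGraph V) : ℤ⟦X⟧ :=
  .mk fun n => (#(properColorings G n) : ℤ)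

theorem mem_properColorings {G : SimpleGraph V} {n : ℕ} {f : V → ℕ} :
    f ∈ properColorings G n ↔ (∀ v, f v < n) ∧ ∀ u v, G.Adj u v → f u ≠ f v := by
  simp [properColorings]

variable (V) in
theorem exists_antitone_extension :
    ∃ ω : (V → V → Prop) → V → ℤ, (∀ r, Function.Injective (ω r)) ∧
      ∀ r, (∃ f : V → ℕ, ∀ u v, r u v → f u < f v) → ∀ u v, r u v → ω r v < ω r u := by
  suffices ∀ r : V → V → Prop, ∃ ω : V → ℤ, Function.Injective ω ∧
      ((∃ f : V → ℕ, ∀ u v, r u v → f u < f v) → ∀ u v, r u v → ω v < ω u) by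
    choose ω h1 h2 using this
    exact ⟨ω, h1, h2⟩
  intro r
  have e := Fintype.equivFin V
  by_cases hr : ∃ f : V → ℕ, ∀ u v, r u v → f u < f v
  · obtain ⟨f, hf⟩ := hr
    have key : ∀ u v, f u < f v → f u * Fintype.card V + e u < f v * Fintype.card V + e v := by
      intro u v h
      have h1 := Nat.mul_le_mul_right (Fintype.card V) (Nat.succ_le_of_lt h)
      rw [Nat.succ_mul] at h1
      have := (e u).isLt
      omega
    refine ⟨fun v => -((f v * Fintype.card V + e v : ℕ) : ℤ), fun u v huv => ?_,
      fun _ u v h => ?_⟩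
    · simp only [neg_inj, Nat.cast_inj] at huv
      rcases lt_trichotomy (f u) (f v) with h | h | h
      · exact absurd huv (key _ _ h).ne
      · rw [h] at huv
        exact e.injective (Fin.ext (Nat.add_left_cancel huv))
      · exact absurd huv (key _ _ h).ne'
    · exact neg_lt_neg (Nat.cast_lt.2 (key _ _ (hf _ _ h)))
  · exact ⟨fun v => (e v : ℕ), fun u v h => e.injective (Fin.ext (Nat.cast_injective h)),
      fun h => absurd h hr⟩

theorem existsUnique_sorting {α : Type*} [LinearOrder α] {κ : V → α} (hκ : Function.Injective κ) :
    ∃! w : Fin (Fintype.card V) ≃ V, StrictMono (κ ∘ w) := by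
  let _ : LinearOrder V := LinearOrder.lift' κ hκ
  have e : Fin (Fintype.card V) ≃o V := Fintype.orderIsoFinOfCardEq V rfl
  refine ⟨e.toEquiv, fun i j h => e.strictMono h, fun w hw => ?_⟩
  ext i
  have hw' : StrictMono w := fun i j h => hw h
  exact congrFun ((hw'.range_inj e.strictMono).1
    (by rw [w.surjective.range_eq, e.surjective.range_eq])) i

theorem card_properColorings_eq_sum [DecidableEq V] (G : SimpleGraph V) :
    ∃ c : (Fin (Fintype.card V) ≃ V) → Fin (Fintype.card V) → ℤ, ∀ n,
      #(properColorings G n) = ∑ w, #(lexIncreasing _ (c w) n) := by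
  classical
  obtain ⟨ω, hinj, hω⟩ := exists_antitone_extension V
  let r (w : Fin (Fintype.card V) ≃ V) : V → V → Prop := fun u v => G.Adj u v ∧ w.symm u < w.symm v
  let r' (f : V → ℕ) : V → V → Prop := fun u v => G.Adj u v ∧ f u < f v
  have hr : ∀ w u v, r w u v → ω (r w) v < ω (r w) u := fun w =>
    hω (r w) ⟨fun v => w.symm v, fun u v h => h.2⟩
  have hmono : ∀ (f : V → ℕ) (w : Fin (Fintype.card V) ≃ V) (ν : V → ℤ),
      StrictMono ((fun v => toLex (f v, ν v)) ∘ w) →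
      ∀ u v, w.symm u < w.symm v → f u < f v ∨ f u = f v ∧ ν u < ν v := by
    intro f w ν h u v huv
    have := h huv
    rwa [Function.comp_apply, Function.comp_apply, w.apply_symm_apply, w.apply_symm_apply,
      Prod.Lex.toLex_lt_toLex] at this
  have hrr : ∀ (f : V → ℕ) (w : Fin (Fintype.card V) ≃ V) (ν : V → ℤ),
      StrictMono ((fun v => toLex (f v, ν v)) ∘ w) → (∀ u v, G.Adj u v → f u ≠ f v) →
      r' f = r w := by
    intro f w ν h hp
    ext u v
    refine and_congr_right fun huv => ⟨fun hf => ?_, fun hw => ?_⟩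
    · by_contra hw
      rcases (not_lt.1 hw).lt_or_eq with hw | hw
      · rcases hmono f w ν h v u hw with h | h
        · omega
        · omega
      · exact huv.ne' (w.symm.injective hw)
    · rcases hmono f w ν h u v hw with h | h
      · exact h
      · exact absurd h.1 (hp u v huv)
  refine ⟨fun w => ω (r w) ∘ w, fun n => ?_⟩
  have h1 : ∀ f ∈ properColorings G n,
      #((univ : Finset (Fin (Fintype.card V) ≃ V)).bipartiteAbove
        (fun (f : V → ℕ) (w : Fin (Fintype.card V) ≃ V) => StrictMono ((fun v => toLex (f v, ω (r' f) v)) ∘ w)) f) = 1 := by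
    intro f _
    obtain ⟨w, hw, huniq⟩ := existsUnique_sorting (κ := fun v => toLex (f v, ω (r' f) v))
      fun u v h => hinj (r' f) (Prod.ext_iff.1 (toLex.injective h)).2
    rw [card_eq_one]
    refine ⟨w, ?_⟩
    ext w'
    simp only [bipartiteAbove, mem_filter, mem_univ, true_and, mem_singleton]
    exact ⟨huniq w', fun h => h ▸ hw⟩
  rw [card_eq_sum_ones, ← sum_congr rfl h1, sum_card_bipartiteAbove_eq_sum_card_bipartiteBelow]
  refine sum_congr rfl fun w _ => ?_
  refine card_bij' (fun f _ => f ∘ w) (fun g _ => g ∘ w.symm) ?_ ?_ ?_ ?_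
  · intro f hf
    simp only [bipartiteBelow, mem_filter, mem_properColorings] at hf
    obtain ⟨⟨hb, hp⟩, hm⟩ := hf
    rw [mem_lexIncreasing]
    refine ⟨fun i => hb _, ?_⟩
    rw [hrr f w _ hm hp] at hm
    exact hm
  · intro g hg
    rw [mem_lexIncreasing] at hg
    obtain ⟨hb, hm⟩ := hg
    have hm' : StrictMono ((fun v => toLex ((g ∘ w.symm) v, ω (r w) v)) ∘ w) := by
      intro i j hij
      simpa using! hm hij
    have hlt : ∀ u v, G.Adj u v → w.symm u < w.symm v → (g ∘ w.symm) u < (g ∘ w.symm) v := by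
      intro u v huv hw
      rcases hmono _ w _ hm' u v hw with h | h
      · exact h
      · exact absurd h.2 (hr w u v ⟨huv, hw⟩).not_gt
    have hp : ∀ u v, G.Adj u v → (g ∘ w.symm) u ≠ (g ∘ w.symm) v := by
      intro u v huv
      rcases lt_trichotomy (w.symm u) (w.symm v) with h | h | h
      · exact (hlt u v huv h).ne
      · exact absurd (w.symm.injective h) huv.ne
      · exact (hlt v u huv.symm h).ne'
    simp only [bipartiteBelow, mem_filter, mem_properColorings]
    refine ⟨⟨fun v => hb _, hp⟩, ?_⟩
    rw [hrr _ w _ hm' hp]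
    exact hm'
  · intro f _
    ext v
    simp
  · intro g _
    ext i
    simp

theorem exists_nonneg_numerator (G : SimpleGraph V) :
    ∃ h : Polynomial ℤ, h.natDegree ≤ Fintype.card V ∧ (∀ i, 0 ≤ h.coeff i) ∧
      (1 - X) ^ (Fintype.card V + 1) * chromaticSeries G = (h : ℤ⟦X⟧) := by
  classical
  obtain ⟨c, hc⟩ := card_properColorings_eq_sum G
  choose k hk hs using fun w => exists_pow_mul_lexIncreasing_series _ (c w)
  refine ⟨∑ w, Polynomial.X ^ k w, ?_, fun i => ?_, ?_⟩
  · exact Polynomial.natDegree_sum_le_of_forall_le _ _ fun w _ => by simpa using hk w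
  · rw [Polynomial.finsetSum_coeff]
    exact sum_nonneg fun w _ => by rw [Polynomial.coeff_X_pow]; split_ifs <;> simp
  · have : chromaticSeries G = ∑ w, .mk fun n => (#(lexIncreasing _ (c w) n) : ℤ) := by
      ext n
      simp [chromaticSeries, hc]
    rw [this, mul_sum, sum_congr rfl fun w _ => hs w]
    rw [← Polynomial.coeToPowerSeries.ringHom_apply, map_sum]
    simp

theorem chromaticSeries_bot :
    chromaticSeries (⊥ : SimpleGraph V) = .mk fun n => (n : ℤ) ^ Fintype.card V := by
  ext n
  simp [chromaticSeries, properColorings]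

theorem constantCoeff_chromaticSeries [Nonempty V] (G : SimpleGraph V) :
    constantCoeff (chromaticSeries G) = 0 := by
  rw [← coeff_zero_eq_constantCoeff_apply, chromaticSeries, coeff_mk, Nat.cast_eq_zero, card_eq_zero]
  ext f
  simp [mem_properColorings]

/-- Merging the vertex `v` into the vertex `u`. -/
def mergeVertex [DecidableEq V] {u v : V} (huv : u ≠ v) (x : V) : {x // x ≠ v} :=
  if h : x = v then ⟨u, huv⟩ else ⟨x, h⟩

/-- The graph obtained from `G` by merging the vertex `v` into the vertex `u`. -/
def contractVertex [DecidableEq V] (G : SimpleGraph V) {u v : V} (huv : u ≠ v) :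
    SimpleGraph {x // x ≠ v} :=
  SimpleGraph.fromRel fun x y =>
    ∃ a b, G.Adj a b ∧ mergeVertex huv a = x ∧ mergeVertex huv b = y

theorem card_properColorings_deleteEdges [DecidableEq V] (G : SimpleGraph V) {u v : V}
    (huv : G.Adj u v) (n : ℕ) :
    #(properColorings (G.deleteEdges {s(u, v)}) n) =
      #(properColorings G n) + #(properColorings (contractVertex G huv.ne) n) := by
  rw [← card_filter_add_card_filter_not (fun f => f u ≠ f v)]
  have hself : ∀ x : {x // x ≠ v}, mergeVertex huv.ne x = x := fun x => by
    simp [mergeVertex, x.2]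
  have hmerge : ∀ {f : V → ℕ}, f u = f v → ∀ x, f (mergeVertex huv.ne x) = f x := by
    intro f hf x
    rw [mergeVertex]
    split_ifs with h
    · rw [h, hf]
    · rfl
  congr 1
  · congr 1
    ext f
    simp only [mem_filter, mem_properColorings, SimpleGraph.deleteEdges_adj,
      Set.mem_singleton_iff, Sym2.eq_iff]
    refine ⟨fun ⟨⟨hb, hp⟩, hne⟩ => ⟨hb, fun x y hxy => ?_⟩,
      fun ⟨hb, hp⟩ => ⟨⟨hb, fun x y hxy => hp x y hxy.1⟩, hp u v huv⟩⟩
    by_cases h : x = u ∧ y = v ∨ x = v ∧ y = u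
    · rcases h with ⟨rfl, rfl⟩ | ⟨rfl, rfl⟩
      · exact hne
      · exact hne.symm
    · exact hp x y ⟨hxy, h⟩
  · refine card_bij' (fun f _ x => f x) (fun g _ x => g (mergeVertex huv.ne x)) ?_ ?_ ?_ ?_
    · intro f hf
      simp only [mem_filter, mem_properColorings, not_not, SimpleGraph.deleteEdges_adj,
        Set.mem_singleton_iff] at hf
      obtain ⟨⟨hb, hp⟩, he⟩ := hf
      have hp' : ∀ a b, G.Adj a b → mergeVertex huv.ne a ≠ mergeVertex huv.ne b →
          f (mergeVertex huv.ne a) ≠ f (mergeVertex huv.ne b) := by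
        intro a b hab hne
        rw [hmerge he, hmerge he]
        refine hp a b ⟨hab, fun h => hne ?_⟩
        rcases Sym2.eq_iff.1 h with ⟨rfl, rfl⟩ | ⟨rfl, rfl⟩ <;> simp [mergeVertex]
      rw [mem_properColorings]
      refine ⟨fun x => hb x, fun x y hxy => ?_⟩
      rw [contractVertex, SimpleGraph.fromRel_adj] at hxy
      obtain ⟨hne, ⟨a, b, hab, rfl, rfl⟩ | ⟨a, b, hab, rfl, rfl⟩⟩ := hxy
      · exact hp' a b hab hne
      · exact (hp' a b hab hne.symm).symm
    · intro g hg
      rw [mem_properColorings] at hg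
      obtain ⟨hb, hp⟩ := hg
      simp only [mem_filter, mem_properColorings, not_not, SimpleGraph.deleteEdges_adj,
        Set.mem_singleton_iff]
      refine ⟨⟨fun x => hb _, fun x y ⟨hxy, hne⟩ => hp _ _ ?_⟩, by simp [mergeVertex, huv.ne]⟩
      rw [contractVertex, SimpleGraph.fromRel_adj]
      refine ⟨fun h => ?_, Or.inl ⟨x, y, hxy, rfl, rfl⟩⟩
      have hxy' := hxy.ne
      rw [Sym2.eq_iff] at hne
      simp only [mergeVertex] at h
      split_ifs at h <;> simp only [Subtype.mk.injEq] at h <;> grind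
    · intro f hf
      simp only [mem_filter, not_not] at hf
      ext x
      exact hmerge hf.2 x
    · intro g _
      ext x
      exact congrArg g (hself x)

theorem chromaticSeries_eq_sub [DecidableEq V] (G : SimpleGraph V) {u v : V} (huv : G.Adj u v) :
    chromaticSeries G = chromaticSeries (G.deleteEdges {s(u, v)}) -
      chromaticSeries (contractVertex G huv.ne) := by
  ext n
  simp [chromaticSeries, card_properColorings_deleteEdges G huv]

theorem exists_symmetric_numerator_pow (d : ℕ) :
    ∃ E : Polynomial ℤ, E.natDegree ≤ d + 1 ∧ (∀ i ≤ d + 2, E.coeff i = E.coeff (d + 2 - i)) ∧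
      (1 - X) ^ (d + 2) * .mk (fun n => (n : ℤ) ^ (d + 1)) = (E : ℤ⟦X⟧) := by
  induction d with
  | zero =>
    refine ⟨.X, by simp, fun i hi => by interval_cases i <;> simp [Polynomial.coeff_X], ?_⟩
    have h : (1 - X : ℤ⟦X⟧) * .mk (fun n => (n : ℤ) ^ (0 + 1)) = X * .mk 1 := by
      ext n
      cases n with
      | zero => simp
      | succ n => rw [sub_mul, one_mul, map_sub, coeff_succ_X_mul, coeff_succ_X_mul]; simp
    rw [pow_succ, mul_assoc, h, pow_one, mul_left_comm, mul_comm (1 - X),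
      mk_one_mul_one_sub_eq_one, mul_one, Polynomial.coe_X]
  | succ d ih =>
    obtain ⟨E, hdeg, hsymm, hE⟩ := ih
    set E' := Polynomial.X * ((1 - Polynomial.X) * Polynomial.derivative E +
      Polynomial.C (d + 2 : ℤ) * E) with hE'
    have hcoeff : ∀ i, E'.coeff (i + 1) =
        (i + 1) * E.coeff (i + 1) + (d + 2 - i) * E.coeff i := by
      intro i
      rw [hE', Polynomial.coeff_X_mul, Polynomial.coeff_add, Polynomial.coeff_C_mul, sub_mul,
        one_mul, Polynomial.coeff_sub, Polynomial.coeff_derivative]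
      cases i with
      | zero => simp
      | succ i => rw [Polynomial.coeff_X_mul, Polynomial.coeff_derivative]; push_cast; ring
    have hcoeff0 : E'.coeff 0 = 0 := by simp [hE']
    have hvanish : ∀ i, d + 1 < i → E.coeff i = 0 := fun i hi =>
      Polynomial.coeff_eq_zero_of_natDegree_lt (hdeg.trans_lt hi)
    have htop : E'.coeff (d + 3) = 0 := by
      rw [hcoeff, hvanish (d + 2 + 1) (by omega)]
      push_cast
      ring
    refine ⟨E', ?_, fun i hi => ?_, ?_⟩
    · rw [Polynomial.natDegree_le_iff_coeff_eq_zero]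
      intro i hi
      obtain ⟨j, rfl⟩ : ∃ j, i = j + 1 := ⟨i - 1, by omega⟩
      rw [hcoeff, hvanish _ (by omega), hvanish j (by omega)]
      ring
    · obtain _ | j := i
      · rw [hcoeff0, Nat.sub_zero, htop]
      · obtain rfl | hj : j = d + 2 ∨ j ≤ d + 1 := by omega
        · rw [htop, Nat.sub_self, hcoeff0]
        · rw [show d + 1 + 2 - (j + 1) = d + 1 - j + 1 by omega, hcoeff, hcoeff,
            hsymm j (by omega), hsymm (j + 1) (by omega), show d + 2 - j = d + 1 - j + 1 by omega,
            show d + 2 - (j + 1) = d + 1 - j by omega]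
          push_cast [hj]
          ring
    · have hpow : (.mk fun n => (n : ℤ) ^ (d + 2) : ℤ⟦X⟧) =
          X * d⁄dX ℤ (.mk fun n => (n : ℤ) ^ (d + 1)) := by
        ext n
        cases n with
        | zero => simp
        | succ n => rw [coeff_succ_X_mul, coeff_derivative, coeff_mk, coeff_mk]; push_cast; ring
      have hderiv := congrArg (d⁄dX ℤ) hE
      rw [Derivation.leibniz, derivative_coe, Derivation.leibniz_pow, map_sub, derivative_one,
        derivative_X, smul_eq_mul, smul_eq_mul, Nat.add_sub_assoc (by norm_num)] at hderiv
      rw [hpow, hE']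
      push_cast
      rw [← hderiv, ← hE]
      simp only [nsmul_eq_mul, smul_eq_mul, map_add, map_natCast, map_ofNat]
      push_cast
      ring

theorem exists_symmetric_quotient [Nonempty V] (G : SimpleGraph V) (h : Polynomial ℤ)
    (hG : (1 - X) ^ (Fintype.card V + 1) * chromaticSeries G = (h : ℤ⟦X⟧)) :
    ∃ M : Polynomial ℤ, M.natDegree ≤ Fintype.card V ∧ (∀ i, 0 ≤ M.coeff i) ∧
      M.reflect (Fintype.card V) = M ∧
      h.reflect (Fintype.card V + 1) - h = (1 - Polynomial.X) * M := by
  classical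
  obtain ⟨m, hm⟩ := Nat.exists_eq_succ_of_ne_zero (Fintype.card_ne_zero (α := V))
  rw [Nat.succ_eq_add_one] at hm
  induction G using WellFoundedLT.induction generalizing h with
  | ind G ih =>
  by_cases hbot : G = ⊥
  · subst hbot
    obtain ⟨E, hdeg, hsymm, hE⟩ := exists_symmetric_numerator_pow m
    rw [chromaticSeries_bot, hm, hE, Polynomial.coe_inj] at hG
    subst hG
    refine ⟨0, by simp, by simp, by simp, ?_⟩
    rw [mul_zero, sub_eq_zero, hm]
    ext i
    rw [Polynomial.coeff_reflect]
    rcases le_or_gt i (m + 2) with hi | hi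
    · rw [Polynomial.revAt_le hi, hsymm i hi]
    · rw [Polynomial.revAt_eq_self_of_lt hi]
  · obtain ⟨u, v, huv⟩ := SimpleGraph.ne_bot_iff_exists_adj.1 hbot
    have hcard : Fintype.card {x // x ≠ v} = m := by simp [Fintype.card_subtype_compl, hm]
    obtain ⟨h', -, -, hh'⟩ := exists_nonneg_numerator (G.deleteEdges {s(u, v)})
    obtain ⟨k, hkdeg, hk0, hk⟩ := exists_nonneg_numerator (contractVertex G huv.ne)
    rw [hcard] at hkdeg hk
    have hlt : G.deleteEdges {s(u, v)} < G := by
      refine lt_of_le_of_ne (G.deleteEdges_le _) fun heq => ?_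
      rw [← heq] at huv
      simp at huv
    obtain ⟨M, hMdeg, hM0, hMsymm, hM⟩ := ih _ hlt h' hh'
    have hh : h = h' - (1 - Polynomial.X) * k := by
      rw [← Polynomial.coe_inj (R := ℤ)]
      push_cast
      rw [← hG, ← hh', ← hk, chromaticSeries_eq_sub G huv, hm]
      ring
    have hrefl : ((1 - Polynomial.X) * k).reflect (m + 2) =
        (Polynomial.X - 1) * k.reflect (m + 1) := by
      rw [show m + 2 = 1 + (m + 1) by ring, Polynomial.reflect_mul _ _ (F := 1) (G := m + 1)]
      · simp [Polynomial.reflect_sub]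
      · exact (Polynomial.natDegree_sub_le _ _).trans (by simp)
      · omega
    rw [hm] at hMdeg hMsymm hM ⊢
    refine ⟨M + (k.reflect (m + 1) + k), ?_, fun i => ?_, ?_, ?_⟩
    · refine Polynomial.natDegree_add_le_of_degree_le hMdeg
        (Polynomial.natDegree_add_le_of_degree_le (Polynomial.natDegree_reflect_le.trans ?_)
          (hkdeg.trans m.le_succ))
      exact max_le le_rfl (hkdeg.trans m.le_succ)
    · simp only [Polynomial.coeff_add, Polynomial.coeff_reflect]
      exact add_nonneg (hM0 _) (add_nonneg (hk0 _) (hk0 _))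
    · rw [Polynomial.reflect_add, hMsymm, Polynomial.reflect_add, Polynomial.reflect_reflect,
        add_comm k]
    · rw [hh, Polynomial.reflect_sub, hrefl]
      linear_combination hM

end Coloring

theorem exists_numerator_decomposition {V : Type*} [Fintype V] [Nonempty V] (G : SimpleGraph V) :
    ∃ h a b : Polynomial ℤ,
      (1 - X) ^ (Fintype.card V + 1) * chromaticSeries G = (h : ℤ⟦X⟧) ∧
      Polynomial.X * h = a + Polynomial.X * b ∧
      SymmetricWrt a (Fintype.card V + 1) ∧ SymmetricWrt b (Fintype.card V) ∧
      (∀ i, 0 ≤ b.coeff i) ∧ (∀ i, 0 ≤ (-a).coeff i) := by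
  obtain ⟨h, hdeg, h0, hG⟩ := exists_nonneg_numerator G
  obtain ⟨M, hMdeg, hM0, hMsymm, hM⟩ := exists_symmetric_quotient G h hG
  have hzero : h.coeff 0 = 0 := by
    have := congrArg constantCoeff hG
    rw [map_mul, constantCoeff_chromaticSeries, mul_zero] at this
    simpa using this.symm
  generalize Fintype.card V = d at *
  have hvanish : ∀ i, d < i → h.coeff i = 0 := fun i hi =>
    Polynomial.coeff_eq_zero_of_natDegree_lt (hdeg.trans_lt hi)
  have hMvanish : ∀ i, d < i → M.coeff i = 0 := fun i hi =>
    Polynomial.coeff_eq_zero_of_natDegree_lt (hMdeg.trans_lt hi)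
  have hMrev : ∀ i ≤ d, M.coeff (d - i) = M.coeff i := fun i hi => by
    conv_rhs => rw [← hMsymm, Polynomial.coeff_reflect, Polynomial.revAt_le hi]
  have hMzero : M.coeff 0 = 0 := by
    have := congrArg (Polynomial.coeff · 0) hM
    simpa [sub_mul, Polynomial.coeff_reflect, hzero, hvanish (d + 1) d.lt_succ_self] using this.symm
  have hstep : ∀ i ≤ d, h.coeff (d - i) - h.coeff (i + 1) = M.coeff (i + 1) - M.coeff i := by
    intro i hi
    have := congrArg (Polynomial.coeff · (i + 1)) hM
    simpa [sub_mul, Polynomial.coeff_reflect, Polynomial.revAt_le (Nat.succ_le_succ hi)] using this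
  have hb : ∀ i, (M + (1 + Polynomial.X) * h).divX.coeff i =
      M.coeff (i + 1) + h.coeff (i + 1) + h.coeff i := by
    intro i
    rw [Polynomial.coeff_divX, Polynomial.coeff_add, add_mul, Polynomial.coeff_add, one_mul,
      Polynomial.coeff_X_mul, add_assoc]
  refine ⟨h, -(M + h), (M + (1 + Polynomial.X) * h).divX, hG, ?_, ⟨?_, fun i hi => ?_⟩,
    ⟨?_, fun i hi => ?_⟩, fun i => ?_, fun i => ?_⟩
  · have hconst : (M + (1 + Polynomial.X) * h).coeff 0 = 0 := by simp [hMzero, hzero, add_mul]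
    have := Polynomial.divX_mul_X_add (M + (1 + Polynomial.X) * h)
    rw [hconst, Polynomial.C_0, add_zero] at this
    rw [mul_comm Polynomial.X (Polynomial.divX _), this]
    ring
  · rw [Polynomial.degree_neg, ← Polynomial.natDegree_le_iff_degree_le]
    exact Polynomial.natDegree_add_le_of_degree_le (hMdeg.trans d.le_succ) (hdeg.trans d.le_succ)
  · rw [Polynomial.coeff_neg, Polynomial.coeff_neg, Polynomial.coeff_add, Polynomial.coeff_add]
    obtain _ | j := i
    · simp [hMzero, hzero, hvanish, hMvanish]
    · rw [Nat.add_sub_add_right, hMrev j (by omega)]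
      linear_combination hstep j (by omega)
  · rw [Polynomial.degree_le_iff_coeff_zero]
    intro i hi
    have hi : d < i := by exact_mod_cast hi
    rw [hb, hvanish _ hi, hvanish _ (by omega), hMvanish _ (by omega)]
    rfl
  · rw [hb, hb]
    have h1 := hstep i hi
    have h2 := hstep (d - i) (by omega)
    rw [hMrev i hi, Nat.sub_sub_self hi] at h2
    linear_combination h2 - h1
  · rw [hb]
    exact add_nonneg (add_nonneg (hM0 _) (h0 _)) (h0 _)
  · rw [neg_neg, Polynomial.coeff_add]
    exact add_nonneg (hM0 _) (h0 _)

theorem card_coloring_eq_card_properColorings {V : Type*} [Fintype V] (G : SimpleGraph V) (n : ℕ) :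
    Nat.card {φ : V → Fin n // ∀ u v, G.Adj u v → φ u ≠ φ v} = #(properColorings G n) := by
  rw [← Fintype.card_coe, ← Nat.card_eq_fintype_card]
  exact Nat.card_congr
    { toFun := fun φ => ⟨fun v => φ.1 v, by
        simpa [mem_properColorings, Fin.val_inj] using φ.2⟩
      invFun := fun f => ⟨fun v => ⟨f.1 v, (mem_properColorings.1 f.2).1 v⟩, fun u v huv h =>
        (mem_properColorings.1 f.2).2 u v huv (Fin.ext_iff.1 h)⟩
      left_inv := fun φ => rfl
      right_inv := fun f => rfl }

end ChromaticNumerator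

/-- **Theorem.** For a finite simple graph `G` on `d` vertices, writing
`(1-z)^{d+1} · Σ_{n≥0} χ_G(n) zⁿ = h(z)`, the polynomial `z·h(z)` decomposes as
`a(z) + z·b(z)` where `a` is symmetric with respect to degree `d+1`, `b` is symmetric
with respect to degree `d`, and both `b` and `-a` have nonnegative coefficients. -/
theorem chromatic_numerator_decomposition (d : ℕ) (G : SimpleGraph (Fin d)) :
    ∃ h a b : Polynomial ℤ,
      (1 - PowerSeries.X) ^ (d + 1) *
          PowerSeries.mk (fun n =>
            (Nat.card {φ : Fin d → Fin n // ∀ u v, G.Adj u v → φ u ≠ φ v} : ℤ)) =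
        (h : PowerSeries ℤ) ∧
      Polynomial.X * h = a + Polynomial.X * b ∧
      SymmetricWrt a (d + 1) ∧ SymmetricWrt b d ∧
      (∀ i, 0 ≤ b.coeff i) ∧ (∀ i, 0 ≤ (-a).coeff i) := by
  cases d with
  | zero =>
    refine ⟨1, 0, 1, ?_, by simp, ?_, ?_, fun i => ?_, by simp⟩
    · have hcard : ∀ n, Nat.card {φ : Fin 0 → Fin n // ∀ u v, G.Adj u v → φ u ≠ φ v} = 1 := by
        intro n
        simp
      simp only [hcard]
      rw [mul_comm]
      simpa using! PowerSeries.mk_one_mul_one_sub_eq_one ℤ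
    · exact ⟨by simp, by simp⟩
    · exact ⟨by simp, fun i hi => by simp [Nat.le_zero.1 hi]⟩
    · rw [Polynomial.coeff_one]
      split_ifs <;> simp
  | succ d =>
    have h := exists_numerator_decomposition G
    simp only [card_coloring_eq_card_properColorings]
    simpa only [Fintype.card_fin, chromaticSeries] using h
end

section
/- Let G be a finite simple graph on d ≥ 1 vertices. Then there exists a polynomial h_G ∈ ℤ[z] with (1−z)^{d+1} · Σ_{n≥0} χ_G(n) z^n = h_G(z) as formal power series over ℤ; moreover h_G has degree exactly d and all coefficients of h_G are nonnegative. -/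
/-- The sequences `ψ` of `d` naturals below `n` that are weakly increasing, where an equality
`ψ i = ψ j` with `i < j` is allowed only if `m j < m i`. -/
def compatibleSeqs (d : ℕ) (m : Fin d → ℕ) (n : ℕ) : Set (Fin d → ℕ) :=
  {ψ | (∀ i, ψ i < n) ∧ ∀ i j, i < j → ψ i < ψ j ∨ (ψ i = ψ j ∧ m j < m i)}

lemma compatibleSeqs_finite (d : ℕ) (m : Fin d → ℕ) (n : ℕ) : (compatibleSeqs d m n).Finite := by
  refine (Set.Finite.pi' (fun _ : Fin d => Set.finite_Iio n)).subset ?_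
  intro ψ hψ i
  exact hψ.1 i

lemma compatibleSeqs_succ (d : ℕ) (m : Fin (d + 1) → ℕ) (n : ℕ) :
    compatibleSeqs (d + 1) m (n + 1) = compatibleSeqs (d + 1) m n ∪
      (fun ψ : Fin d → ℕ => (Fin.snoc ψ n : Fin (d + 1) → ℕ)) ''
        {ψ | ψ ∈ compatibleSeqs d (Fin.init m) (n + 1) ∧
          ∀ i, ψ i < n ∨ (ψ i = n ∧ m (Fin.last d) < m i.castSucc)} := by
  ext ψ
  constructor
  · rintro ⟨h1, h2⟩
    by_cases h : ψ (Fin.last d) = n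
    · right
      refine ⟨Fin.init ψ, ⟨⟨fun i => h1 _, fun i j hij => h2 _ _ ?_⟩, fun i => ?_⟩, ?_⟩
      · simpa using hij
      · have := h2 i.castSucc (Fin.last d) (Fin.castSucc_lt_last i)
        rwa [h] at this
      · simp only [← h]
        exact Fin.snoc_init_self ψ
    · left
      refine ⟨fun i => ?_, h2⟩
      have hl := h1 (Fin.last d)
      rcases (Fin.le_last i).lt_or_eq with hi | hi
      · have := h2 i _ hi
        omega
      · subst hi
        omega
  · rintro (⟨h1, h2⟩ | ⟨ψ, ⟨⟨h1, h2⟩, h3⟩, rfl⟩)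
    · exact ⟨fun i => (h1 i).trans (Nat.lt_succ_self n), h2⟩
    · refine ⟨fun i => ?_, fun i j hij => ?_⟩
      · induction i using Fin.lastCases with
        | last => simp
        | cast i => simpa using h1 i
      · induction j using Fin.lastCases with
        | last =>
          induction i using Fin.lastCases with
          | last => exact absurd hij (lt_irrefl _)
          | cast i => simpa using h3 i
        | cast j =>
          induction i using Fin.lastCases with
          | last => exact absurd hij (Fin.castSucc_lt_last j).not_gt
          | cast i => simpa [Fin.init] using h2 i j (by simpa using hij)

lemma ncard_compatibleSeqs_succ (d : ℕ) (m : Fin (d + 1) → ℕ) (n : ℕ) :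
    (compatibleSeqs (d + 1) m (n + 1)).ncard = (compatibleSeqs (d + 1) m n).ncard +
      {ψ | ψ ∈ compatibleSeqs d (Fin.init m) (n + 1) ∧
          ∀ i, ψ i < n ∨ (ψ i = n ∧ m (Fin.last d) < m i.castSucc)}.ncard := by
  rw [compatibleSeqs_succ, Set.ncard_union_eq ?_ (compatibleSeqs_finite _ _ _)
    (((compatibleSeqs_finite _ _ _).subset fun ψ h => h.1).image _), Set.ncard_image_of_injective]
  · intro a b hab
    simpa using congrArg Fin.init hab
  · rw [Set.disjoint_left]
    rintro _ ⟨h1, -⟩ ⟨ψ, -, rfl⟩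
    simpa using h1 (Fin.last d)

lemma compatibleSeqs_zero_right (d : ℕ) (m : Fin (d + 1) → ℕ) :
    compatibleSeqs (d + 1) m 0 = ∅ := by
  ext ψ
  simp [compatibleSeqs]

lemma compatibleSeqs_strict_step (d : ℕ) (m : Fin (d + 1) → ℕ) (n : ℕ)
    (hm : ∀ i : Fin d, i.val + 1 = d → m i.castSucc ≤ m (Fin.last d)) :
    {ψ | ψ ∈ compatibleSeqs d (Fin.init m) (n + 1) ∧
          ∀ i, ψ i < n ∨ (ψ i = n ∧ m (Fin.last d) < m i.castSucc)} =
      compatibleSeqs d (Fin.init m) n := by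
  ext ψ
  constructor
  · rintro ⟨⟨h1, h2⟩, h3⟩
    refine ⟨fun i => ?_, h2⟩
    obtain ⟨e, rfl⟩ : ∃ e, d = e + 1 := ⟨d - 1, by have := i.2; omega⟩
    have h4 := hm (Fin.last e) rfl
    have h5 := h3 (Fin.last e)
    rcases (Fin.le_last i).lt_or_eq with hi | hi
    · have := h2 i _ hi
      omega
    · subst hi
      omega
  · rintro ⟨h1, h2⟩
    exact ⟨⟨fun i => (h1 i).trans (Nat.lt_succ_self n), h2⟩, fun i => Or.inl (h1 i)⟩

lemma compatibleSeqs_weak_step (d : ℕ) (m : Fin (d + 2) → ℕ) (n : ℕ)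
    (hm : m (Fin.last (d + 1)) < m (Fin.last d).castSucc) :
    {ψ | ψ ∈ compatibleSeqs (d + 1) (Fin.init m) (n + 1) ∧
          ∀ i, ψ i < n ∨ (ψ i = n ∧ m (Fin.last (d + 1)) < m i.castSucc)} =
      compatibleSeqs (d + 1) (Fin.init m) (n + 1) := by
  ext ψ
  refine ⟨fun h => h.1, fun h => ⟨h, fun i => ?_⟩⟩
  obtain ⟨h1, h2⟩ := h
  have h4 := h1 (Fin.last d)
  rcases (Fin.le_last i).lt_or_eq with hi | hi
  · have := h2 i _ hi
    simp only [Fin.init] at this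
    omega
  · subst hi
    omega

/-- The generating function of the numbers of compatible sequences. -/
noncomputable def compatibleSeries (d : ℕ) (m : Fin d → ℕ) : PowerSeries ℤ :=
  PowerSeries.mk fun n => ((compatibleSeqs d m n).ncard : ℤ)

lemma compatibleSeries_strict (d : ℕ) (m : Fin (d + 1) → ℕ)
    (hm : ∀ i : Fin d, i.val + 1 = d → m i.castSucc ≤ m (Fin.last d)) :
    (1 - PowerSeries.X) * compatibleSeries (d + 1) m =
      PowerSeries.X * compatibleSeries d (Fin.init m) := by
  ext n
  rw [sub_mul, one_mul, map_sub]
  cases n with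
  | zero => simp [compatibleSeries, compatibleSeqs_zero_right]
  | succ n =>
    rw [PowerSeries.coeff_succ_X_mul, PowerSeries.coeff_succ_X_mul]
    simp [compatibleSeries, ncard_compatibleSeqs_succ, compatibleSeqs_strict_step d m n hm]

lemma compatibleSeries_weak (d : ℕ) (m : Fin (d + 2) → ℕ)
    (hm : m (Fin.last (d + 1)) < m (Fin.last d).castSucc) :
    (1 - PowerSeries.X) * compatibleSeries (d + 2) m =
      compatibleSeries (d + 1) (Fin.init m) := by
  ext n
  rw [sub_mul, one_mul, map_sub]
  cases n with
  | zero => simp [compatibleSeries, compatibleSeqs_zero_right]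
  | succ n =>
    rw [PowerSeries.coeff_succ_X_mul]
    simp [compatibleSeries, ncard_compatibleSeqs_succ, compatibleSeqs_weak_step d m n hm]

lemma compatibleSeries_zero (m : Fin 0 → ℕ) :
    (1 - PowerSeries.X) * compatibleSeries 0 m = 1 := by
  have h : compatibleSeries 0 m = PowerSeries.mk 1 := by
    ext n
    have : compatibleSeqs 0 m n = Set.univ := by
      ext ψ
      simp [compatibleSeqs]
    simp [compatibleSeries, this]
  rw [h, mul_comm]
  exact PowerSeries.mk_one_mul_one_sub_eq_one ℤ

lemma exists_compatibleSeries_eq (d : ℕ) (m : Fin d → ℕ) :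
    ∃ k ≤ d, (1 - PowerSeries.X) ^ (d + 1) * compatibleSeries d m = PowerSeries.X ^ k ∧
      (Monotone m → k = d) := by
  induction d with
  | zero => exact ⟨0, le_rfl, by simpa using compatibleSeries_zero m, fun _ => rfl⟩
  | succ d ih =>
    obtain ⟨k, hk, h1, h2⟩ := ih (Fin.init m)
    have hmono : Monotone m → Monotone (Fin.init m) := fun h i j hij =>
      h (Fin.castSucc_le_castSucc_iff.2 hij)
    by_cases hm : ∀ i : Fin d, i.val + 1 = d → m i.castSucc ≤ m (Fin.last d)
    · refine ⟨k + 1, by omega, ?_, fun h => by rw [h2 (hmono h)]⟩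
      rw [pow_succ, mul_assoc, compatibleSeries_strict d m hm, mul_left_comm, h1, pow_succ']
    · push Not at hm
      obtain ⟨i, hi, hlt⟩ := hm
      obtain ⟨e, rfl⟩ : ∃ e, d = e + 1 := ⟨d - 1, by omega⟩
      obtain rfl : i = Fin.last e := Fin.ext (by simpa using hi)
      refine ⟨k, by omega, ?_, fun h => absurd (h (Fin.le_last _)) hlt.not_ge⟩
      rw [pow_succ, mul_assoc, compatibleSeries_weak e m hlt, h1]

namespace SimpleGraph

variable {d : ℕ} (G : SimpleGraph (Fin d))

/-- The orientation of the edges of `G` from smaller to larger values of `f`. -/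
def orientationOf {α : Type*} [LT α] (f : Fin d → α) : Fin d → Fin d → Prop :=
  fun u v => G.Adj u v ∧ f u < f v

/-- A vertex ordering chosen for the orientation that the ordering `p` induces. -/
noncomputable def orderingRep (p : Equiv.Perm (Fin d)) : Equiv.Perm (Fin d) :=
  Function.invFun (fun q : Equiv.Perm (Fin d) => G.orientationOf q) (G.orientationOf p)

lemma orientationOf_orderingRep (p : Equiv.Perm (Fin d)) :
    G.orientationOf (G.orderingRep p) = G.orientationOf p :=
  Function.invFun_eq (f := fun q : Equiv.Perm (Fin d) => G.orientationOf q) ⟨p, rfl⟩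

lemma orderingRep_congr {p q : Equiv.Perm (Fin d)} (h : G.orientationOf p = G.orientationOf q) :
    G.orderingRep p = G.orderingRep q := by
  unfold orderingRep
  rw [h]

/-- The representative ordering, read along the ordering `p`. -/
noncomputable def orderingWord (p : Equiv.Perm (Fin d)) : Fin d → ℕ :=
  fun i => G.orderingRep p (p.symm i)

lemma ne_of_mem_compatibleSeqs {n : ℕ} {p : Equiv.Perm (Fin d)} {ψ : Fin d → ℕ}
    (h : ψ ∈ compatibleSeqs d (G.orderingWord p) n) {u v : Fin d} (huv : G.Adj u v) :
    ψ (p u) ≠ ψ (p v) := by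
  wlog hlt : p u < p v generalizing u v
  · have hne : p u ≠ p v := fun e => huv.ne (p.injective e)
    exact (this huv.symm (lt_of_le_of_ne (not_lt.1 hlt) hne.symm)).symm
  have ho : G.orientationOf (G.orderingRep p) u v := by
    rw [orientationOf_orderingRep]
    exact ⟨huv, hlt⟩
  have := h.2 _ _ hlt
  simp only [orderingWord, Equiv.symm_apply_apply] at this
  have h' : (G.orderingRep p u : ℕ) < G.orderingRep p v := ho.2
  omega

lemma orientationOf_eq_of_mono {α : Type*} [LinearOrder α] {p : Equiv.Perm (Fin d)} {φ : Fin d → α}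
    (hφ : ∀ u v, G.Adj u v → φ u ≠ φ v) (h : ∀ u v, p u < p v → φ u ≤ φ v) :
    G.orientationOf p = G.orientationOf φ := by
  ext u v
  refine ⟨fun ⟨ha, hlt⟩ => ⟨ha, lt_of_le_of_ne (h u v hlt) (hφ u v ha)⟩, fun ⟨ha, hlt⟩ => ⟨ha, ?_⟩⟩
  by_contra hn
  exact (h v u (lt_of_le_of_ne (not_lt.1 hn) fun e => ha.ne (p.injective e).symm)).not_gt hlt

end SimpleGraph

lemma Equiv.Perm.eq_of_lt_imp_lt {d : ℕ} {p q : Equiv.Perm (Fin d)}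
    (h : ∀ u v, p u < p v → q u < q v) : p = q := by
  have hs : StrictMono (q ∘ p.symm) := fun i j hij => h _ _ (by simpa using hij)
  have : q ∘ p.symm = id := (hs.range_inj strictMono_id).1 (by simp)
  ext u
  have := congrFun this (p u)
  simp at this
  rw [this]

lemma exists_perm_lt_imp_lt {d : ℕ} {α : Type*} [LinearOrder α] {f : Fin d → α}
    (hf : Function.Injective f) :
    ∃ p : Equiv.Perm (Fin d), ∀ u v, p u < p v → f u < f v := by
  refine ⟨(Tuple.sort f).symm, fun u v huv => ?_⟩
  have := (Tuple.monotone_sort f).strictMono_of_injective (hf.comp (Tuple.sort f).injective) huv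
  simpa using this

namespace SimpleGraph

variable {d : ℕ} (G : SimpleGraph (Fin d))

/-- The coloring obtained from an ordering and a compatible sequence of colors. -/
def coloringOfSeq (n : ℕ) (x : Σ p : Equiv.Perm (Fin d), compatibleSeqs d (G.orderingWord p) n) :
    {φ : Fin d → Fin n // ∀ u v, G.Adj u v → φ u ≠ φ v} :=
  ⟨fun v => ⟨x.2.1 (x.1 v), x.2.2.1 _⟩, fun _ _ huv e =>
    G.ne_of_mem_compatibleSeqs x.2.2 huv (congrArg Fin.val e)⟩

lemma orientationOf_eq_coloringOfSeq (n : ℕ)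
    (x : Σ p : Equiv.Perm (Fin d), compatibleSeqs d (G.orderingWord p) n) :
    G.orientationOf x.1 = G.orientationOf (G.coloringOfSeq n x).1 := by
  refine G.orientationOf_eq_of_mono (G.coloringOfSeq n x).2 fun u v huv => ?_
  have := x.2.2.2 _ _ huv
  change x.2.1 (x.1 u) ≤ x.2.1 (x.1 v)
  omega

lemma coloringOfSeq_injective (n : ℕ) : Function.Injective (G.coloringOfSeq n) := by
  intro x y hxy
  have ho : G.orientationOf x.1 = G.orientationOf y.1 := by
    rw [orientationOf_eq_coloringOfSeq, hxy, ← orientationOf_eq_coloringOfSeq]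
  have hr := G.orderingRep_congr ho
  have hval : ∀ v, x.2.1 (x.1 v) = y.2.1 (y.1 v) := fun v =>
    congrArg Fin.val (congrFun (congrArg Subtype.val hxy) v)
  obtain ⟨p, ψ, hψ⟩ := x
  obtain ⟨q, χ, hχ⟩ := y
  simp only at hr hval
  obtain rfl : p = q := by
    refine Equiv.Perm.eq_of_lt_imp_lt fun u v huv => ?_
    by_contra hn
    have hne : q u ≠ q v := fun e => huv.ne (congrArg p (q.injective e))
    have h1 := hψ.2 _ _ huv
    have h2 := hχ.2 _ _ (lt_of_le_of_ne (not_lt.1 hn) hne.symm)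
    simp only [orderingWord, Equiv.symm_apply_apply, hr, hval] at h1 h2
    omega
  obtain rfl : ψ = χ := by
    ext i
    simpa using hval (p.symm i)
  rfl

lemma coloringOfSeq_surjective (n : ℕ) : Function.Surjective (G.coloringOfSeq n) := by
  rintro ⟨φ, hφ⟩
  obtain ⟨q, hq⟩ := exists_perm_lt_imp_lt (f := fun v => toLex (φ v, v))
    fun u v h => by simpa using congrArg (fun z => (ofLex z).2) h
  have hoq : G.orientationOf q = G.orientationOf φ := by
    refine G.orientationOf_eq_of_mono hφ fun u v huv => ?_
    rcases Prod.Lex.toLex_lt_toLex.1 (hq u v huv) with h | h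
    · exact h.le
    · exact h.1.le
  obtain ⟨p, hp⟩ := exists_perm_lt_imp_lt
    (f := fun v => toLex (φ v, OrderDual.toDual (G.orderingRep q v)))
    fun u v h => (G.orderingRep q).injective
      (congrArg (fun z => OrderDual.ofDual (ofLex z).2) h)
  have hp' : ∀ u v, p u < p v →
      φ u < φ v ∨ (φ u = φ v ∧ G.orderingRep q v < G.orderingRep q u) :=
    fun u v huv => Prod.Lex.toLex_lt_toLex.1 (hp u v huv)
  have hop : G.orientationOf p = G.orientationOf φ := by
    refine G.orientationOf_eq_of_mono hφ fun u v huv => ?_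
    rcases hp' u v huv with h | h
    · exact h.le
    · exact h.1.le
  have hr := G.orderingRep_congr (hop.trans hoq.symm)
  refine ⟨⟨p, fun i => φ (p.symm i), fun i => (φ (p.symm i)).2, fun i j hij => ?_⟩, ?_⟩
  · have := hp' (p.symm i) (p.symm j) (by simpa using hij)
    simp only [orderingWord, hr]
    omega
  · ext v
    simp [coloringOfSeq]

lemma card_coloring_eq_sum (n : ℕ) :
    Nat.card {φ : Fin d → Fin n // ∀ u v, G.Adj u v → φ u ≠ φ v} =
      ∑ p : Equiv.Perm (Fin d), (compatibleSeqs d (G.orderingWord p) n).ncard := by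
  have (p : Equiv.Perm (Fin d)) : Finite (compatibleSeqs d (G.orderingWord p) n) :=
    (compatibleSeqs_finite _ _ _).to_subtype
  rw [← Nat.card_congr (Equiv.ofBijective _
    ⟨G.coloringOfSeq_injective n, G.coloringOfSeq_surjective n⟩), Nat.card_sigma]
  rfl

lemma exists_monotone_orderingWord : ∃ p : Equiv.Perm (Fin d), Monotone (G.orderingWord p) := by
  refine ⟨G.orderingRep 1, fun i j hij => ?_⟩
  simpa [orderingWord, G.orderingRep_congr (G.orientationOf_orderingRep 1)] using hij

end SimpleGraph

/-- **Theorem.** For a finite simple graph `G` on `d ≥ 1` vertices, the numerator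
polynomial `h_G` of the series `Σ_{n≥0} χ_G(n) zⁿ` (with denominator `(1-z)^{d+1}`)
has degree exactly `d` and nonnegative coefficients. -/
theorem chromatic_numerator_nonneg (d : ℕ) (hd : 1 ≤ d) (G : SimpleGraph (Fin d)) :
    ∃ h : Polynomial ℤ,
      (1 - PowerSeries.X) ^ (d + 1) *
          PowerSeries.mk (fun n =>
            (Nat.card {φ : Fin d → Fin n // ∀ u v, G.Adj u v → φ u ≠ φ v} : ℤ)) =
        (h : PowerSeries ℤ) ∧
      h.degree = (d : ℕ) ∧ (∀ i, 0 ≤ h.coeff i) := by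
  choose k hkd hk hmono using fun p => exists_compatibleSeries_eq d (G.orderingWord p)
  have hcoeff (i : ℕ) : (∑ p, (Polynomial.X : Polynomial ℤ) ^ k p).coeff i =
      ∑ p, if i = k p then 1 else 0 := by
    simp [Polynomial.finsetSum_coeff, Polynomial.coeff_X_pow]
  refine ⟨∑ p, Polynomial.X ^ k p, ?_, ?_, fun i => ?_⟩
  · have hsum : PowerSeries.mk (fun n =>
        (Nat.card {φ : Fin d → Fin n // ∀ u v, G.Adj u v → φ u ≠ φ v} : ℤ)) =
        ∑ p, compatibleSeries d (G.orderingWord p) := by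
      ext n
      simp [compatibleSeries, G.card_coloring_eq_sum]
    rw [hsum, Finset.mul_sum, ← Polynomial.coeToPowerSeries.ringHom_apply, map_sum]
    exact Finset.sum_congr rfl fun p _ => by simp [hk]
  · obtain ⟨p, hp⟩ := G.exists_monotone_orderingWord
    refine Polynomial.degree_eq_of_le_of_coeff_ne_zero ?_ ?_
    · refine (Polynomial.degree_sum_le _ _).trans (Finset.sup_le fun q _ => ?_)
      rw [Polynomial.degree_X_pow]
      exact_mod_cast hkd q
    · rw [hcoeff]
      refine (Finset.sum_pos' (fun q _ => by positivity) ⟨p, Finset.mem_univ p, ?_⟩).ne'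
      simp [hmono p hp]
  · rw [hcoeff]
    positivity
end

section
/- Let G be a finite simple graph on d ≥ 1 vertices and let h_G = Σ_{i=0}^{d} h_i z^i ∈ ℤ[z] be the polynomial with (1−z)^{d+1} · Σ_{n≥0} χ_G(n) z^n = h_G(z) as formal power series over ℤ. Then for every integer i with 1 ≤ i ≤ ⌊(d+1)/2⌋, one has h_d + h_{d−1} + ⋯ + h_{d−i+1} − h_0 − h_1 − ⋯ − h_{i−1} ≥ 0. -/
/-- The maps `V → {0, …, n - 1}` satisfying `P`. -/
noncomputable def boundedMaps {V : Type*} [Fintype V] (P : (V → ℕ) → Prop) (n : ℕ) :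
    Finset (V → ℕ) := by
  classical
  exact (Fintype.piFinset fun _ : V => Finset.range n).filter P

/-- The numerator over `(1 - z) ^ (|V| + 1)` of the generating function counting the maps
`V → {0, …, n - 1}` satisfying `P`. -/
noncomputable def numeratorSeries {V : Type*} [Fintype V] (P : (V → ℕ) → Prop) :
    PowerSeries ℤ :=
  (1 - PowerSeries.X) ^ (Fintype.card V + 1) *
    PowerSeries.mk fun n => ((boundedMaps P n).card : ℤ)

/-- The numerator has nonnegative coefficients and degree at most `|V|`. -/
def HasNonnegNumerator {V : Type*} [Fintype V] (P : (V → ℕ) → Prop) : Prop :=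
  ∀ k, 0 ≤ PowerSeries.coeff k (numeratorSeries P) ∧
    (Fintype.card V < k → PowerSeries.coeff k (numeratorSeries P) = 0)

section BoundedMaps

variable {V W : Type*} [Fintype V] [Fintype W]

theorem mem_boundedMaps {P : (V → ℕ) → Prop} {n : ℕ} {φ : V → ℕ} :
    φ ∈ boundedMaps P n ↔ (∀ v, φ v < n) ∧ P φ := by
  simp [boundedMaps]

theorem card_boundedMaps_eq_sum_fiber {ι : Type*} [Fintype ι] (P : (V → ℕ) → Prop)
    (K : (V → ℕ) → ι) (n : ℕ) :
    (boundedMaps P n).card = ∑ k, (boundedMaps (fun φ => P φ ∧ K φ = k) n).card := by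
  classical
  rw [Finset.card_eq_sum_card_fiberwise (f := K) (t := Finset.univ) (by simp)]
  refine Finset.sum_congr rfl fun k _ => congrArg _ ?_
  ext φ
  simp [mem_boundedMaps, and_assoc]

theorem numeratorSeries_eq_sum_fiber {ι : Type*} [Fintype ι] (P : (V → ℕ) → Prop)
    (K : (V → ℕ) → ι) :
    numeratorSeries P = ∑ k, numeratorSeries (fun φ => P φ ∧ K φ = k) := by
  simp only [numeratorSeries, ← Finset.mul_sum]
  congr 1
  ext n
  simp [card_boundedMaps_eq_sum_fiber P K n]

theorem hasNonnegNumerator_of_fibers {ι : Type*} [Finite ι] {P : (V → ℕ) → Prop}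
    (K : (V → ℕ) → ι)
    (h : ∀ φ₀, P φ₀ → HasNonnegNumerator (fun φ => P φ ∧ K φ = K φ₀)) :
    HasNonnegNumerator P := by
  classical
  have := Fintype.ofFinite ι
  have key : ∀ k, HasNonnegNumerator (fun φ => P φ ∧ K φ = k) := by
    intro k
    by_cases hk : ∃ φ₀, P φ₀ ∧ K φ₀ = k
    · obtain ⟨φ₀, h₀, rfl⟩ := hk
      exact h φ₀ h₀
    · have hz : numeratorSeries (fun φ => P φ ∧ K φ = k) = 0 := by
        have : ∀ n, boundedMaps (fun φ => P φ ∧ K φ = k) n = ∅ := fun n =>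
          Finset.eq_empty_of_forall_notMem fun φ hφ => hk ⟨φ, (mem_boundedMaps.1 hφ).2⟩
        ext n
        simp [numeratorSeries, this, PowerSeries.coeff_mul]
      intro j
      simp [hz]
  intro j
  rw [numeratorSeries_eq_sum_fiber P K, map_sum]
  exact ⟨Finset.sum_nonneg fun k _ => (key k j).1,
    fun hj => Finset.sum_eq_zero fun k _ => (key k j).2 hj⟩

theorem numeratorSeries_comp_equiv (e : W ≃ V) (P : (W → ℕ) → Prop) :
    numeratorSeries (fun φ : V → ℕ => P (φ ∘ e)) = numeratorSeries P := by
  unfold numeratorSeries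
  rw [Fintype.card_congr e]
  congr 2
  ext n
  congr 1
  refine Finset.card_bij' (fun φ _ => φ ∘ e) (fun ψ _ => ψ ∘ e.symm) ?_ ?_ ?_ ?_
  · intro φ hφ
    rw [mem_boundedMaps] at hφ ⊢
    exact ⟨fun w => hφ.1 _, hφ.2⟩
  · intro ψ hψ
    rw [mem_boundedMaps] at hψ ⊢
    refine ⟨fun w => hψ.1 _, ?_⟩
    simpa [Function.comp_assoc] using hψ.2
  · intro φ _
    simp [Function.comp_assoc]
  · intro ψ _
    simp [Function.comp_assoc]

/-- Identifying the vertex `v` with `u` multiplies the numerator by `1 - z`. -/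
theorem numeratorSeries_identify [DecidableEq V] {u v : V} (huv : u ≠ v)
    (P : (V → ℕ) → Prop) :
    numeratorSeries (fun φ : V → ℕ => P φ ∧ φ u = φ v) =
      (1 - PowerSeries.X) * numeratorSeries (fun ψ : {x // x ≠ v} → ℕ =>
        P fun x => ψ (if h : x = v then ⟨u, huv⟩ else ⟨x, h⟩)) := by
  have hc : Fintype.card V = Fintype.card {x // x ≠ v} + 1 := by
    have : 0 < Fintype.card V := Fintype.card_pos_iff.2 ⟨u⟩
    rw [Fintype.card_subtype_compl, Fintype.card_subtype_eq]
    omega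
  unfold numeratorSeries
  rw [hc, pow_succ' _ (_ + 1), mul_assoc]
  congr 3
  ext n
  congr 1
  have ext_restrict : ∀ φ : V → ℕ, φ u = φ v → (fun x => (fun y : {x // x ≠ v} => φ y)
      (if h : x = v then ⟨u, huv⟩ else ⟨x, h⟩)) = φ := by
    intro φ hφ
    funext x
    by_cases h : x = v
    · simp [h, hφ]
    · simp [h]
  refine Finset.card_bij' (fun φ _ => fun y => φ y)
    (fun ψ _ => fun x => ψ (if h : x = v then ⟨u, huv⟩ else ⟨x, h⟩)) ?_ ?_ ?_ ?_
  · intro φ hφ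
    rw [mem_boundedMaps] at hφ ⊢
    refine ⟨fun w => hφ.1 _, ?_⟩
    rw [ext_restrict φ hφ.2.2]
    exact hφ.2.1
  · intro ψ hψ
    rw [mem_boundedMaps] at hψ ⊢
    exact ⟨fun w => hψ.1 _, hψ.2, by simp [huv]⟩
  · intro φ hφ
    exact ext_restrict φ (mem_boundedMaps.1 hφ).2.2
  · intro ψ _
    funext y
    simp [y.2]

end BoundedMaps

/-- Sequences that increase weakly at the steps where `w` holds and strictly elsewhere. -/
def IncreasesAlong {m : ℕ} (w : Fin m → Prop) (c : Fin (m + 1) → ℕ) : Prop :=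
  ∀ i : Fin m, c i.castSucc < c i.succ ∨ c i.castSucc = c i.succ ∧ w i

theorem IncreasesAlong.le_last {m : ℕ} {w : Fin m → Prop} {c : Fin (m + 1) → ℕ}
    (h : IncreasesAlong w c) (i : Fin (m + 1)) : c i ≤ c (Fin.last m) := by
  have : Monotone c := Fin.monotone_iff_le_succ.2 fun j => by
    rcases h j with h | h <;> omega
  exact this (Fin.le_last i)

theorem increasesAlong_snoc {m : ℕ} {w : Fin (m + 1) → Prop} {c : Fin (m + 1) → ℕ} {a : ℕ} :
    IncreasesAlong w (Fin.snoc c a : Fin (m + 2) → ℕ) ↔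
      IncreasesAlong (fun i => w i.castSucc) c ∧
        (c (Fin.last m) < a ∨ c (Fin.last m) = a ∧ w (Fin.last m)) := by
  unfold IncreasesAlong
  rw [Fin.forall_fin_succ']
  simp only [Fin.snoc_castSucc, Fin.succ_last, Fin.snoc_last, ← Fin.castSucc_succ]

theorem card_boundedMaps_increasesAlong_succ {m : ℕ} (w : Fin (m + 1) → Prop) (n ε : ℕ)
    (hε : (w (Fin.last m) ∧ ε = 1) ∨ (¬ w (Fin.last m) ∧ ε = 0)) :
    (boundedMaps (IncreasesAlong w) (n + 1)).card = (boundedMaps (IncreasesAlong w) n).card +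
      (boundedMaps (IncreasesAlong fun i => w i.castSucc) (n + ε)).card := by
  classical
  have hinj : Function.Injective fun c : Fin (m + 1) → ℕ => (Fin.snoc c n : Fin (m + 2) → ℕ) := by
    intro c c' h
    exact (Fin.snoc_injective2 h).1
  rw [← Finset.card_image_of_injective _ hinj, ← Finset.card_union_of_disjoint]
  · congr 1
    ext c
    simp only [Finset.mem_union, Finset.mem_image, mem_boundedMaps]
    constructor
    · rintro ⟨hb, hc⟩
      by_cases hl : c (Fin.last _) < n
      · exact Or.inl ⟨fun i => (hc.le_last i).trans_lt hl, hc⟩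
      · have hl' : c (Fin.last _) = n := by have := hb (Fin.last _); omega
        rw [← Fin.snoc_init_self c, increasesAlong_snoc, hl'] at hc
        refine Or.inr ⟨Fin.init c, ⟨fun i => ?_, hc.1⟩, ?_⟩
        · have := hc.1.le_last i
          rcases hε with hε | hε <;> rcases hc.2 with h | h <;> first | omega | tauto
        · rw [← hl', Fin.snoc_init_self]
    · rintro (⟨hb, hc⟩ | ⟨c, ⟨hb, hc⟩, rfl⟩)
      · exact ⟨fun i => (hb i).trans n.lt_succ_self, hc⟩
      · refine ⟨fun i => ?_, increasesAlong_snoc.2 ⟨hc, ?_⟩⟩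
        · refine Fin.lastCases ?_ (fun j => ?_) i
          · simp
          · simp only [Fin.snoc_castSucc]
            have := hb j
            omega
        · have := hb (Fin.last m)
          rcases hε with hε | hε
          · rcases Nat.lt_or_ge (c (Fin.last m)) n with h | h
            · exact Or.inl h
            · exact Or.inr ⟨by omega, hε.1⟩
          · left; omega
  · rw [Finset.disjoint_left]
    intro c hc hc'
    obtain ⟨c, -, rfl⟩ := Finset.mem_image.1 hc'
    have := (mem_boundedMaps.1 hc).1 (Fin.last _)
    simp at this

theorem boundedMaps_zero {V : Type*} [Fintype V] [Nonempty V] (P : (V → ℕ) → Prop) :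
    boundedMaps P 0 = ∅ := by
  refine Finset.eq_empty_of_forall_notMem fun φ hφ => ?_
  exact absurd ((mem_boundedMaps.1 hφ).1 (Classical.arbitrary V)) (Nat.not_lt_zero _)

theorem numeratorSeries_increasesAlong (m : ℕ) (w : Fin m → Prop) :
    ∃ s ≤ m, numeratorSeries (IncreasesAlong w) = PowerSeries.X ^ (s + 1) := by
  induction m with
  | zero =>
    refine ⟨0, le_rfl, ?_⟩
    have hcard : ∀ n, (boundedMaps (IncreasesAlong w) n).card = n := by
      intro n
      have : boundedMaps (IncreasesAlong w) n =
          Fintype.piFinset fun _ : Fin (0 + 1) => Finset.range n := by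
        ext c
        simp [mem_boundedMaps, IncreasesAlong]
      simp [this]
    simp only [numeratorSeries, hcard, Fintype.card_fin, zero_add, pow_one]
    have h1 : (1 - PowerSeries.X) * PowerSeries.mk (fun n : ℕ => (n : ℤ)) =
        PowerSeries.X * PowerSeries.mk 1 := by
      ext n
      rcases n with _ | n
      · simp [sub_mul]
      · simp [sub_mul, PowerSeries.coeff_succ_X_mul]
    rw [pow_succ, pow_one, mul_assoc, h1, mul_left_comm, mul_comm (1 - PowerSeries.X),
      PowerSeries.mk_one_mul_one_sub_eq_one, mul_one]
  | succ m ih =>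
    obtain ⟨s, hs, ih⟩ := ih fun i => w i.castSucc
    by_cases hw : w (Fin.last m)
    · refine ⟨s, by omega, ?_⟩
      rw [← ih]
      unfold numeratorSeries
      rw [Fintype.card_fin, Fintype.card_fin, pow_succ _ (_ + 1), mul_assoc]
      congr 1
      ext n
      rcases n with _ | n
      · simp [sub_mul, boundedMaps_zero]
      · simp [sub_mul, PowerSeries.coeff_succ_X_mul,
          card_boundedMaps_increasesAlong_succ w n 1 (Or.inl ⟨hw, rfl⟩)]
    · refine ⟨s + 1, by omega, ?_⟩
      rw [pow_succ', ← ih]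
      unfold numeratorSeries
      rw [Fintype.card_fin, Fintype.card_fin, pow_succ _ (_ + 1), mul_assoc,
        mul_left_comm PowerSeries.X]
      congr 1
      ext n
      rcases n with _ | n
      · simp [sub_mul, boundedMaps_zero]
      · simp [sub_mul, PowerSeries.coeff_succ_X_mul,
          card_boundedMaps_increasesAlong_succ w n 0 (Or.inr ⟨hw, rfl⟩)]

theorem exists_equiv_strictMono {V α : Type*} [Fintype V] [LinearOrder α] {k : V → α}
    (hk : Function.Injective k) {d : ℕ} (hd : Fintype.card V = d) :
    ∃ e : Fin d ≃ V, StrictMono (k ∘ e) := by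
  let : LinearOrder V := LinearOrder.lift' k hk
  let e := Fintype.orderIsoFinOfCardEq V hd
  exact ⟨e.toEquiv, fun i j hij => e.strictMono hij⟩

theorem hasNonnegNumerator_ne {V : Type*} [Fintype V] [Nonempty V] (r : V → V → Prop) :
    HasNonnegNumerator fun φ : V → ℕ => ∀ a b, r a b → φ a ≠ φ b := by
  classical
  obtain ⟨m, hm⟩ : ∃ m, Fintype.card V = m + 1 :=
    Nat.exists_eq_succ_of_ne_zero Fintype.card_ne_zero
  refine hasNonnegNumerator_of_fibers
    (fun φ (a b : V) => (r a b ∨ r b a) ∧ φ a < φ b) fun φ₀ h₀ => ?_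
  obtain ⟨L, hL, hL₀⟩ : ∃ L : V → ℕ, L.Injective ∧ ∀ a b, φ₀ a < φ₀ b → L a < L b := by
    obtain ⟨e, he⟩ := exists_equiv_strictMono
      (k := fun v => toLex (φ₀ v, Fintype.equivFin V v))
      (fun a b h => by simpa using (Prod.ext_iff.1 (toLex_inj.1 h)).2) rfl
    refine ⟨fun v => e.symm v, fun a b h => e.symm.injective (Fin.ext h), fun a b h => ?_⟩
    have := he.lt_iff_lt (a := e.symm a) (b := e.symm b)
    simp only [Function.comp, Equiv.apply_symm_apply] at this
    exact this.1 (Prod.Lex.toLex_lt_toLex.2 (Or.inl h))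
  let key : (V → ℕ) → V → ℕ ×ₗ ℕᵒᵈ := fun φ v => toLex (φ v, OrderDual.toDual (L v))
  have hkey : ∀ φ, (key φ).Injective := fun φ a b h =>
    hL (by simpa using (Prod.ext_iff.1 (toLex_inj.1 h)).2)
  have hlt : ∀ φ a b, key φ a < key φ b ↔ φ a < φ b ∨ φ a = φ b ∧ L b < L a := fun φ a b => by
    simp [key, Prod.Lex.toLex_lt_toLex]
  refine hasNonnegNumerator_of_fibers (fun φ (a b : V) => key φ a < key φ b) fun φ₁ h₁ => ?_
  obtain ⟨e, he⟩ := exists_equiv_strictMono (hkey φ₁) hm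
  have main : (fun φ : V → ℕ => ((∀ a b, r a b → φ a ≠ φ b) ∧
      (fun (a b : V) => (r a b ∨ r b a) ∧ φ a < φ b) =
        fun (a b : V) => (r a b ∨ r b a) ∧ φ₀ a < φ₀ b) ∧
      (fun (a b : V) => key φ a < key φ b) = fun (a b : V) => key φ₁ a < key φ₁ b) =
      fun φ => IncreasesAlong (fun i : Fin m => L (e i.succ) < L (e i.castSucc)) (φ ∘ e) := by
    funext φ
    have hinc : IncreasesAlong (fun i : Fin m => L (e i.succ) < L (e i.castSucc)) (φ ∘ e) ↔
        StrictMono (key φ ∘ e) := by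
      rw [Fin.strictMono_iff_lt_succ]
      exact forall_congr' fun i => (hlt φ _ _).symm
    rw [hinc, eq_iff_iff]
    constructor
    · rintro ⟨-, h⟩ i j hij
      exact (congrFun (congrFun h (e i)) (e j)).mpr (he hij)
    · intro h
      have hT : ∀ a b, key φ a < key φ b ↔ key φ₁ a < key φ₁ b := fun a b => by
        have h1 := h.lt_iff_lt (a := e.symm a) (b := e.symm b)
        have h2 := he.lt_iff_lt (a := e.symm a) (b := e.symm b)
        simp only [Function.comp, Equiv.apply_symm_apply] at h1 h2
        rw [h1, h2]
      have hR : ∀ a b, (r a b ∨ r b a) → φ₀ a < φ₀ b → φ a < φ b := fun a b hr hab => by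
        have h1 : φ₁ a < φ₁ b :=
          ((congrFun (congrFun h₁.2 a) b).mpr ⟨hr, hab⟩).2
        have h2 := (hlt φ a b).1 ((hT a b).2 ((hlt φ₁ a b).2 (Or.inl h1)))
        have h3 := hL₀ a b hab
        omega
      have hne : ∀ a b, (r a b ∨ r b a) → φ₀ a ≠ φ₀ b := fun a b hr =>
        hr.elim (h₀ a b) fun hr => (h₀ b a hr).symm
      refine ⟨⟨fun a b hr => ?_, ?_⟩, by funext a b; exact propext (hT a b)⟩
      · rcases (h₀ a b hr).lt_or_gt with h | h
        · exact (hR a b (Or.inl hr) h).ne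
        · exact (hR b a (Or.inr hr) h).ne'
      · funext a b
        refine propext ⟨fun ⟨hr, hab⟩ => ⟨hr, ?_⟩, fun ⟨hr, hab⟩ => ⟨hr, hR a b hr hab⟩⟩
        rcases (hne a b hr).lt_or_gt with h | h
        · exact h
        · exact absurd (hR b a hr.symm h) hab.le.not_gt
  rw [main]
  obtain ⟨s, hs, hX⟩ := numeratorSeries_increasesAlong m
    fun i : Fin m => L (e i.succ) < L (e i.castSucc)
  intro k
  rw [numeratorSeries_comp_equiv e (IncreasesAlong _), hX, PowerSeries.coeff_X_pow, hm]
  split_ifs with h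
  · exact ⟨zero_le_one, fun hk => by omega⟩
  · exact ⟨le_rfl, fun _ => rfl⟩

/-- The numerator of `∑ nᵈ zⁿ` over `(1 - z) ^ (d + 1)`, an Eulerian polynomial. -/
noncomputable def powNumerator (d : ℕ) : PowerSeries ℤ :=
  (1 - PowerSeries.X) ^ (d + 1) * PowerSeries.mk fun n : ℕ => (n : ℤ) ^ d

theorem powNumerator_zero : powNumerator 0 = 1 := by
  have := PowerSeries.mk_one_mul_one_sub_eq_one ℤ
  rw [mul_comm] at this
  simpa [powNumerator, Pi.one_def] using this

theorem powNumerator_succ (d : ℕ) :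
    powNumerator (d + 1) = PowerSeries.X * ((1 - PowerSeries.X) *
      PowerSeries.derivative ℤ (powNumerator d) + PowerSeries.C ((d : ℤ) + 1) * powNumerator d) := by
  have hF : PowerSeries.mk (fun n : ℕ => (n : ℤ) ^ (d + 1)) = PowerSeries.X *
      PowerSeries.derivative ℤ (PowerSeries.mk fun n : ℕ => (n : ℤ) ^ d) := by
    ext n
    rcases n with _ | n
    · simp
    · simp [PowerSeries.coeff_succ_X_mul, PowerSeries.coeff_derivative, pow_succ]
  unfold powNumerator
  rw [hF]
  simp only [Derivation.leibniz, Derivation.leibniz_pow, map_sub, smul_eq_mul,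
    PowerSeries.derivative_X, Derivation.map_one_eq_zero, nsmul_eq_mul, map_add, map_natCast,
    map_one, Nat.add_sub_cancel]
  push_cast
  ring

theorem coeff_zero_powNumerator_succ (d : ℕ) :
    PowerSeries.coeff 0 (powNumerator (d + 1)) = 0 := by
  rw [powNumerator_succ]
  simp

theorem coeff_succ_powNumerator_succ (d k : ℕ) :
    PowerSeries.coeff (k + 1) (powNumerator (d + 1)) =
      (k + 1) * PowerSeries.coeff (k + 1) (powNumerator d) +
        (d + 1 - k) * PowerSeries.coeff k (powNumerator d) := by
  rw [powNumerator_succ, PowerSeries.coeff_succ_X_mul, map_add, PowerSeries.coeff_C_mul, sub_mul,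
    one_mul, map_sub]
  rcases k with _ | k
  · simp [PowerSeries.coeff_derivative]
  · rw [PowerSeries.coeff_succ_X_mul, PowerSeries.coeff_derivative, PowerSeries.coeff_derivative]
    push_cast
    ring

theorem coeff_powNumerator_of_lt {d k : ℕ} (h : d < k) :
    PowerSeries.coeff k (powNumerator d) = 0 := by
  induction d generalizing k with
  | zero => rw [powNumerator_zero, PowerSeries.coeff_one, if_neg (by omega)]
  | succ d ih =>
    obtain ⟨k, rfl⟩ := Nat.exists_eq_succ_of_ne_zero (by omega : k ≠ 0)
    rw [Nat.succ_eq_add_one, coeff_succ_powNumerator_succ, ih (by omega), ih (by omega)]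
    simp

theorem coeff_powNumerator_symm {d i j : ℕ} (hd : 1 ≤ d) (hij : i + j = d + 1) :
    PowerSeries.coeff i (powNumerator d) = PowerSeries.coeff j (powNumerator d) := by
  induction d, hd using Nat.le_induction generalizing i j with
  | base =>
    have h0 := coeff_zero_powNumerator_succ 0
    have h2 : PowerSeries.coeff 2 (powNumerator 1) = 0 := coeff_powNumerator_of_lt (by omega)
    obtain ⟨rfl, rfl⟩ | ⟨rfl, rfl⟩ | ⟨rfl, rfl⟩ :
        (i = 0 ∧ j = 2) ∨ (i = 1 ∧ j = 1) ∨ (i = 2 ∧ j = 0) := by omega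
    · exact h0.trans h2.symm
    · rfl
    · exact h2.trans h0.symm
  | succ d hd ih =>
    rcases i with _ | i
    · rw [coeff_zero_powNumerator_succ, coeff_powNumerator_of_lt (by omega)]
    rcases j with _ | j
    · rw [coeff_zero_powNumerator_succ, coeff_powNumerator_of_lt (by omega)]
    rw [coeff_succ_powNumerator_succ, coeff_succ_powNumerator_succ,
      ih (i := i + 1) (j := j) (by omega), ih (i := i) (j := j + 1) (by omega)]
    have : (d : ℤ) = i + j := by exact_mod_cast (by omega : d = i + j)
    rw [this]
    ring

theorem numeratorSeries_true {V : Type*} [Fintype V] :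
    numeratorSeries (fun _ : V → ℕ => True) = powNumerator (Fintype.card V) := by
  classical
  have : ∀ n, (boundedMaps (fun _ : V → ℕ => True) n).card = n ^ Fintype.card V := by
    intro n
    have : boundedMaps (fun _ : V → ℕ => True) n =
        Fintype.piFinset fun _ : V => Finset.range n := by
      ext c
      simp [mem_boundedMaps]
    simp [this]
  simp [numeratorSeries, powNumerator, this]

/-- Deletion–contraction for the numerator. -/
theorem numeratorSeries_and_ne {V : Type*} [Fintype V] (P : (V → ℕ) → Prop) (u v : V) :
    numeratorSeries (fun φ => φ u ≠ φ v ∧ P φ) =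
      numeratorSeries P - numeratorSeries (fun φ => P φ ∧ φ u = φ v) := by
  rw [numeratorSeries_eq_sum_fiber P fun φ => φ u = φ v, Fintype.sum_Prop]
  simp [and_comm]

theorem coeff_sum_inequality {V : Type*} [Fintype V] [Nonempty V] (E : Finset (V × V))
    (hE : ∀ p ∈ E, p.1 ≠ p.2) (i : ℕ) (hi : i ≤ Fintype.card V) :
    ∑ j ∈ Finset.range i,
        PowerSeries.coeff j (numeratorSeries fun φ : V → ℕ => ∀ p ∈ E, φ p.1 ≠ φ p.2) ≤
      ∑ j ∈ Finset.range i, PowerSeries.coeff (Fintype.card V - j)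
        (numeratorSeries fun φ : V → ℕ => ∀ p ∈ E, φ p.1 ≠ φ p.2) := by
  classical
  induction E using Finset.induction_on with
  | empty =>
    have hpos : HasNonnegNumerator fun _ : V → ℕ => True := by
      simpa using hasNonnegNumerator_ne fun _ _ : V => False
    have hd : 1 ≤ Fintype.card V := Fintype.card_pos
    obtain ⟨d, hd'⟩ := Nat.exists_eq_add_of_le' hd
    simp only [Finset.notMem_empty, IsEmpty.forall_iff, implies_true]
    rw [← sub_nonneg, ← Finset.sum_sub_distrib]
    have hstep : ∀ j ∈ Finset.range i,
        PowerSeries.coeff (Fintype.card V - j) (numeratorSeries fun _ : V → ℕ => True) -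
          PowerSeries.coeff j (numeratorSeries fun _ : V → ℕ => True) =
        PowerSeries.coeff (j + 1) (numeratorSeries fun _ : V → ℕ => True) -
          PowerSeries.coeff j (numeratorSeries fun _ : V → ℕ => True) := by
      intro j hj
      have := Finset.mem_range.1 hj
      rw [numeratorSeries_true, coeff_powNumerator_symm hd (j := j + 1) (by omega)]
    rw [Finset.sum_congr rfl hstep, Finset.sum_range_sub
      fun j => PowerSeries.coeff j (numeratorSeries fun _ : V → ℕ => True)]
    have h0 : PowerSeries.coeff 0 (numeratorSeries fun _ : V → ℕ => True) = 0 := by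
      rw [numeratorSeries_true, hd', coeff_zero_powNumerator_succ]
    rw [h0, sub_zero]
    exact (hpos i).1
  | insert p E _ ih =>
    obtain ⟨u, v⟩ := p
    have huv : u ≠ v := hE _ (Finset.mem_insert_self _ _)
    have ih := ih fun p hp => hE p (Finset.mem_insert_of_mem hp)
    simp only [Finset.forall_mem_insert]
    rw [numeratorSeries_and_ne, numeratorSeries_identify huv]
    set H := numeratorSeries fun φ : V → ℕ => ∀ p ∈ E, φ p.1 ≠ φ p.2
    set π : V → {x // x ≠ v} := fun x => if h : x = v then ⟨u, huv⟩ else ⟨x, h⟩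
    have : Nonempty {x // x ≠ v} := ⟨⟨u, huv⟩⟩
    have hQ : HasNonnegNumerator fun ψ : {x // x ≠ v} → ℕ =>
        ∀ p ∈ E, ψ (π p.1) ≠ ψ (π p.2) := by
      have heq : (fun ψ : {x // x ≠ v} → ℕ => ∀ p ∈ E, ψ (π p.1) ≠ ψ (π p.2)) =
          fun ψ => ∀ a b, (∃ p ∈ E, π p.1 = a ∧ π p.2 = b) → ψ a ≠ ψ b := by
        funext ψ
        refine propext ⟨?_, fun h p hp => h _ _ ⟨p, hp, rfl, rfl⟩⟩
        rintro h _ _ ⟨p, hp, rfl, rfl⟩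
        exact h p hp
      rw [heq]
      exact hasNonnegNumerator_ne _
    have hc : Fintype.card V = Fintype.card {x // x ≠ v} + 1 := by
      have : 0 < Fintype.card V := Fintype.card_pos
      rw [Fintype.card_subtype_compl, Fintype.card_subtype_eq]
      omega
    unfold HasNonnegNumerator at hQ
    set Q := numeratorSeries fun ψ : {x // x ≠ v} → ℕ => ∀ p ∈ E, ψ (π p.1) ≠ ψ (π p.2)
    have hlow : ∀ i, ∑ j ∈ Finset.range i, PowerSeries.coeff j ((1 - PowerSeries.X) * Q) =
        if i = 0 then 0 else PowerSeries.coeff (i - 1) Q := by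
      intro i
      induction i with
      | zero => simp
      | succ i ih =>
        rw [Finset.sum_range_succ, ih, sub_mul, one_mul, map_sub]
        rcases i with _ | i
        · simp
        · simp [PowerSeries.coeff_succ_X_mul]
    have hhigh : ∀ i ≤ Fintype.card V, ∑ j ∈ Finset.range i,
        PowerSeries.coeff (Fintype.card V - j) ((1 - PowerSeries.X) * Q) =
        - PowerSeries.coeff (Fintype.card V - i) Q := by
      intro i hi
      induction i with
      | zero => simp [(hQ (Fintype.card V)).2 (by omega)]
      | succ i ih =>
        rw [Finset.sum_range_succ, ih (by omega), sub_mul, one_mul, map_sub,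
          show Fintype.card V - i = (Fintype.card V - (i + 1)) + 1 by omega,
          PowerSeries.coeff_succ_X_mul]
        ring
    simp only [map_sub, Finset.sum_sub_distrib]
    have h1 := (hQ (i - 1)).1
    have h2 := (hQ (Fintype.card V - i)).1
    have hlow' : 0 ≤ ∑ j ∈ Finset.range i, PowerSeries.coeff j ((1 - PowerSeries.X) * Q) := by
      rw [hlow]
      split_ifs
      · exact le_rfl
      · exact h1
    have hhigh' := hhigh i hi
    linarith

theorem card_coloring_eq_card_boundedMaps {V : Type*} [Fintype V] (P : (V → ℕ) → Prop) (n : ℕ) :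
    Nat.card {φ : V → Fin n // P fun v => φ v} = (boundedMaps P n).card := by
  rw [← Nat.card_eq_finsetCard]
  refine Nat.card_congr ⟨fun φ => ⟨fun v => φ.1 v, mem_boundedMaps.2 ⟨fun v => (φ.1 v).2, φ.2⟩⟩,
    fun φ => ⟨fun v => ⟨φ.1 v, (mem_boundedMaps.1 φ.2).1 v⟩, (mem_boundedMaps.1 φ.2).2⟩,
    fun φ => rfl, fun φ => rfl⟩


/-- **Theorem.** For a finite simple graph `G` on `d ≥ 1` vertices, with `h_G` the
numerator polynomial of `Σ_{n≥0} χ_G(n) zⁿ` (with denominator `(1-z)^{d+1}`), for every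
`1 ≤ i ≤ ⌊(d+1)/2⌋` one has `h_d + ⋯ + h_{d-i+1} - h_0 - ⋯ - h_{i-1} ≥ 0`. -/
theorem chromatic_coefficient_inequalities (d : ℕ) (hd : 1 ≤ d)
    (G : SimpleGraph (Fin d)) (h : Polynomial ℤ)
    (hh : (1 - PowerSeries.X) ^ (d + 1) *
        PowerSeries.mk (fun n =>
          (Nat.card {φ : Fin d → Fin n // ∀ u v, G.Adj u v → φ u ≠ φ v} : ℤ)) =
      (h : PowerSeries ℤ)) :
    ∀ i : ℕ, 1 ≤ i → i ≤ (d + 1) / 2 →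
      0 ≤ (∑ j ∈ Finset.range i, h.coeff (d - j)) - ∑ j ∈ Finset.range i, h.coeff j := by
  classical
  intro i _ hi
  have : Nonempty (Fin d) := ⟨⟨0, hd⟩⟩
  have hnum : numeratorSeries (fun φ : Fin d → ℕ =>
      ∀ p ∈ Finset.univ.filter (fun p : Fin d × Fin d => G.Adj p.1 p.2), φ p.1 ≠ φ p.2) =
      (h : PowerSeries ℤ) := by
    rw [← hh, numeratorSeries, Fintype.card_fin]
    congr 2
    funext n
    rw [← card_coloring_eq_card_boundedMaps]
    simp [Fin.ext_iff]
  have key := coeff_sum_inequality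
    (Finset.univ.filter fun p : Fin d × Fin d => G.Adj p.1 p.2)
    (fun p hp => (Finset.mem_filter.1 hp).2.ne) i (by rw [Fintype.card_fin]; omega)
  rw [hnum] at key
  simpa using key
end
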